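/- Suppose in addition that Ω is twice continuously differentiable. Let μ be a Radon measure on ℂ such that for μ-almost every x ∈ ℂ: (i) 0 < liminf_{r↓0} μ(B(x,r))/r and limsup_{r↓0} μ(B(x,r))/r < ∞; (ii) the function y ↦ K(x−y)/|x−y|² is μ-integrable on ℂ∖B(x,ε) for every ε > 0 and the principal value lim_{ε↓0} ∫_{ℂ∖B(x,ε)} K(x−y)/|x−y|² dμ(y) exists in ℂ. Then μ is 1-rectifiable: there exists a countable family of Lipschitz maps γ_i : ℝ → ℂ such that μ(ℂ ∖ ⋃_i γ_i(ℝ)) = 0. -/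

import Mathlib

open MeasureTheory Metric Complex Filter Set
open scoped Topology ENNReal NNReal

noncomputable section

/-- The real inner product on `ℂ ≅ ℝ²`. -/
def rinner (u v : ℂ) : ℝ := u.re * v.re + u.im * v.im

/-- The geodesic distance on the unit circle `𝕊 ⊂ ℂ`. -/
def dS (u v : ℂ) : ℝ := Real.arccos (rinner u v)

/-- The kernel `K(x) = |x| Ω(x/|x|)` (with `K 0 = 0`). -/
def Kmap (Ω : ℂ → ℂ) (x : ℂ) : ℂ := (‖x‖ : ℂ) * Ω (x / (‖x‖ : ℂ))

/-- The support of a measure on `ℂ`. -/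
def spt (μ : Measure ℂ) : Set ℂ := {x : ℂ | ∀ r : ℝ, 0 < r → 0 < μ (ball x r)}

/-- Ahlfors 1-regularity with constant `C₀`. -/
def Ahlfors1 (μ : Measure ℂ) (C₀ : ℝ) : Prop :=
  ∀ x ∈ spt μ, ∀ r : ℝ, 0 < r →
    ENNReal.ofReal (C₀⁻¹ * r) ≤ μ (ball x r) ∧ μ (ball x r) ≤ ENNReal.ofReal (C₀ * r)

/-- `Ω`-symmetry of a measure. -/
def OmegaSym (Ω : ℂ → ℂ) (μ : Measure ℂ) : Prop :=
  ∀ x ∈ spt μ, ∀ r : ℝ, 0 < r → (∫ y in ball x r, Kmap Ω (x - y) ∂μ) = 0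

/-- `Ω` maps the unit circle to itself. -/
def MapsCircle (Ω : ℂ → ℂ) : Prop := ∀ u : ℂ, ‖u‖ = 1 → ‖Ω u‖ = 1

/-- `Ω` is odd on the unit circle. -/
def OddOnCircle (Ω : ℂ → ℂ) : Prop := ∀ u : ℂ, ‖u‖ = 1 → Ω (-u) = -(Ω u)

/-- `Ω` is bi-Lipschitz with constant `1 + δ` on the circle, w.r.t. geodesic distance. -/
def BiLipOnCircle (Ω : ℂ → ℂ) (δ : ℝ) : Prop :=
  ∀ u v : ℂ, ‖u‖ = 1 → ‖v‖ = 1 →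
    (1 + δ)⁻¹ * dS u v ≤ dS (Ω u) (Ω v) ∧ dS (Ω u) (Ω v) ≤ (1 + δ) * dS u v

/-- `Ω` is `C^k` as a circle map: it has a `C^k` lift `ω`. -/
def CircleCk (Ω : ℂ → ℂ) (k : ℕ) : Prop :=
  ∃ ω : ℝ → ℝ, ContDiff ℝ k ω ∧
    ∀ t : ℝ, Ω (Complex.exp ((t : ℂ) * Complex.I)) = Complex.exp ((ω t : ℂ) * Complex.I)

/-- Affine lines in `ℂ`. -/
def IsLine (L : Set ℂ) : Prop :=
  ∃ a b : ℂ, b ≠ 0 ∧ L = {z : ℂ | ∃ t : ℝ, z = a + t • b}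

/-- Admissible lifts of circle maps. -/
structure LiftOK (ω : ℝ → ℝ) (c : ℝ) : Prop where
  cd : ContDiff ℝ 1 ω
  cpos : 0 < c
  cle : c ≤ 1
  der : ∀ t, c ≤ deriv ω t
  per : ∀ t, ω (t + Real.pi) = ω t + Real.pi

/-- `U` is the zero-homogeneous map given by the lift `ω`. -/
def UOK (U : ℂ → ℂ) (ω : ℝ → ℝ) : Prop :=
  ∀ ρ : ℝ, 0 < ρ → ∀ θ : ℝ, U (ρ * Complex.exp (θ * I)) = Complex.exp (ω θ * I)

lemma dS_exp (s t : ℝ) (h : |s - t| ≤ Real.pi) :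
    dS (Complex.exp (s * I)) (Complex.exp (t * I)) = |s - t| := by
  have : rinner (Complex.exp (s * I)) (Complex.exp (t * I)) = Real.cos |s - t| := by
    simp [rinner, Complex.exp_ofReal_mul_I_re, Complex.exp_ofReal_mul_I_im, Real.cos_abs,
      Real.cos_sub]
  rw [dS, this, Real.arccos_cos (abs_nonneg _) h]

lemma lift_slope (ω : ℝ → ℝ) (Ω : ℂ → ℂ) (δ : ℝ) (hbilip : BiLipOnCircle Ω δ) (hω : Continuous ω)
    (h : ∀ t : ℝ, Ω (Complex.exp ((t : ℂ) * I)) = Complex.exp ((ω t : ℂ) * I)) (t : ℝ) :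
    ∀ᶠ s in 𝓝 t, (1 + δ)⁻¹ * |s - t| ≤ |ω s - ω t| ∧ |ω s - ω t| ≤ (1 + δ) * |s - t| := by
  have h1 : ∀ᶠ s in 𝓝 t, |s - t| < Real.pi := by
    have : Tendsto (fun s : ℝ => |s - t|) (𝓝 t) (𝓝 |t - t|) :=
      Continuous.tendsto (by fun_prop) t
    rw [sub_self, abs_zero] at this
    exact this.eventually_lt_const Real.pi_pos
  have h2 : ∀ᶠ s in 𝓝 t, |ω s - ω t| < Real.pi := by
    have : Tendsto (fun s : ℝ => |ω s - ω t|) (𝓝 t) (𝓝 |ω t - ω t|) :=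
      Continuous.tendsto (by fun_prop) t
    rw [sub_self, abs_zero] at this
    exact this.eventually_lt_const Real.pi_pos
  filter_upwards [h1, h2] with s hs1 hs2
  have := hbilip (Complex.exp (s * I)) (Complex.exp (t * I)) (Complex.norm_exp_ofReal_mul_I s)
    (Complex.norm_exp_ofReal_mul_I t)
  rwa [h, h, dS_exp _ _ hs1.le, dS_exp _ _ hs2.le] at this

lemma lift_deriv (ω : ℝ → ℝ) (Ω : ℂ → ℂ) (δ : ℝ) (hbilip : BiLipOnCircle Ω δ)
    (hω : Differentiable ℝ ω)
    (h : ∀ t : ℝ, Ω (Complex.exp ((t : ℂ) * I)) = Complex.exp ((ω t : ℂ) * I)) (t : ℝ) :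
    (1 + δ)⁻¹ ≤ |deriv ω t| ∧ |deriv ω t| ≤ 1 + δ := by
  have hd := (hω t).hasDerivAt.tendsto_slope.abs
  have hs := (lift_slope ω Ω δ hbilip hω.continuous h t).filter_mono
    (nhdsWithin_le_nhds (s := {t}ᶜ))
  have key : ∀ᶠ s in 𝓝[≠] t, (1 + δ)⁻¹ ≤ |slope ω t s| ∧ |slope ω t s| ≤ 1 + δ := by
    filter_upwards [hs, self_mem_nhdsWithin] with s hs hst
    have hpos : 0 < |s - t| := abs_pos.2 (sub_ne_zero.2 hst)
    rw [slope_def_field, abs_div, le_div_iff₀ hpos, div_le_iff₀ hpos]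
    exact hs
  exact ⟨ge_of_tendsto hd (key.mono fun _ h => h.1), le_of_tendsto hd (key.mono fun _ h => h.2)⟩

lemma exists_liftOK_aux (ω : ℝ → ℝ) (Ω : ℂ → ℂ) (δ : ℝ) (hδ0 : 0 ≤ δ) (hδ1 : δ ≤ 1 / 20)
    (hodd : OddOnCircle Ω) (hω : ContDiff ℝ 1 ω)
    (h : ∀ t : ℝ, Ω (Complex.exp ((t : ℂ) * I)) = Complex.exp ((ω t : ℂ) * I))
    (h1 : ∀ t, (1 + δ)⁻¹ ≤ deriv ω t) (h2 : ∀ t, deriv ω t ≤ 1 + δ) :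
    LiftOK ω (1 + δ)⁻¹ := by
  have hc : 0 < (1 + δ)⁻¹ := by positivity
  have hdiff : Differentiable ℝ ω := hω.differentiable (by norm_num)
  refine ⟨hω, hc, inv_le_one_of_one_le₀ (by linarith), h1, fun t => ?_⟩
  have e1 : Complex.exp ((ω (t + Real.pi) : ℂ) * I) = Complex.exp (((ω t + Real.pi : ℝ) : ℂ) * I) := by
    rw [← h]
    have : Complex.exp (((t + Real.pi : ℝ) : ℂ) * I) = - Complex.exp ((t : ℂ) * I) := by
      push_cast
      rw [add_mul, Complex.exp_add, Complex.exp_pi_mul_I]; ring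
    rw [this, hodd _ (Complex.norm_exp_ofReal_mul_I t), h]
    push_cast
    rw [add_mul, Complex.exp_add, Complex.exp_pi_mul_I]; ring
  obtain ⟨n, hn⟩ := Complex.exp_eq_exp_iff_exists_int.1 e1
  have hn' : ω (t + Real.pi) = ω t + Real.pi + n * (2 * Real.pi) := by
    have := congrArg Complex.im hn
    simpa using this
  have hp := Real.pi_pos
  have lo : 0 ≤ ω (t + Real.pi) - ω t := by
    have := mul_sub_le_image_sub_of_le_deriv hdiff (C := 0) (fun x => hc.le.trans (h1 x))
      (x := t) (y := t + Real.pi) (by linarith)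
    linarith
  have hi : ω (t + Real.pi) - ω t ≤ 2 * Real.pi := by
    have := image_sub_le_mul_sub_of_deriv_le hdiff (C := 2) (fun x => (h2 x).trans (by linarith))
      (x := t) (y := t + Real.pi) (by linarith)
    linarith
  have n1 : (-1 : ℝ) < n := by
    by_contra hcon
    push Not at hcon
    nlinarith
  have n2 : (n : ℝ) < 1 := by
    by_contra hcon
    push Not at hcon
    nlinarith
  have : n = 0 := by
    have a : (-1 : ℤ) < n := by exact_mod_cast n1
    have b : n < 1 := by exact_mod_cast n2
    lia
  rw [hn', this]; simp

lemma exists_liftOK (δ : ℝ) (hδ0 : 0 ≤ δ) (hδ1 : δ ≤ 1 / 20)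
    (Ω : ℂ → ℂ) (hodd : OddOnCircle Ω)
    (hbilip : BiLipOnCircle Ω δ) (hC2 : CircleCk Ω 2) :
    ∃ ω c, LiftOK ω c ∧ (UOK (fun y => Ω (y / (‖y‖ : ℂ))) ω ∨
      UOK (fun y => (starRingEnd ℂ) (Ω (y / (‖y‖ : ℂ)))) ω) := by
  obtain ⟨ω, hω2, h⟩ := hC2
  have hω : ContDiff ℝ 1 ω := hω2.of_le (by norm_num)
  have hdiff : Differentiable ℝ ω := hω.differentiable (by norm_num)
  have hd := lift_deriv ω Ω δ hbilip hdiff h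
  have hc : 0 < (1 + δ)⁻¹ := by positivity
  have hcont : Continuous (deriv ω) := hω.continuous_deriv (by norm_num)
  have hunit : ∀ ρ : ℝ, 0 < ρ → ∀ θ : ℝ,
      (ρ * Complex.exp (θ * I)) / (‖(ρ * Complex.exp (θ * I) : ℂ)‖ : ℂ) = Complex.exp (θ * I) := by
    intro ρ hρ θ
    rw [norm_mul, Complex.norm_exp_ofReal_mul_I, Complex.norm_real, Real.norm_of_nonneg hρ.le]
    have : (ρ : ℂ) ≠ 0 := by exact_mod_cast hρ.ne'
    field_simp
  have hsign : (∀ t, 0 < deriv ω t) ∨ (∀ t, deriv ω t < 0) := by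
    by_contra hcon
    push Not at hcon
    obtain ⟨⟨a, ha⟩, b, hb⟩ := hcon
    have := mem_range_of_exists_le_of_exists_ge hcont ⟨a, ha⟩ ⟨b, hb⟩
    obtain ⟨x, hx⟩ := this
    have := (hd x).1
    rw [hx, abs_zero] at this
    linarith
  rcases hsign with hs | hs
  · refine ⟨ω, _, exists_liftOK_aux ω Ω δ hδ0 hδ1 hodd hω h ?_ ?_, Or.inl ?_⟩
    · intro t; simpa [abs_of_pos (hs t)] using (hd t).1
    · intro t; simpa [abs_of_pos (hs t)] using (hd t).2
    · intro ρ hρ θ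
      simp only [hunit ρ hρ θ, h]
  · have h' : ∀ t : ℝ, (fun z => (starRingEnd ℂ) (Ω z)) (Complex.exp ((t : ℂ) * I))
        = Complex.exp (((-ω t : ℝ) : ℂ) * I) := by
      intro t
      simp only [h, ← Complex.exp_conj]
      simp
    have hder : ∀ t, deriv (fun t => - ω t) t = - deriv ω t := fun t => deriv.fun_neg
    refine ⟨fun t => - ω t, _, exists_liftOK_aux (fun t => - ω t) (fun z => (starRingEnd ℂ) (Ω z))
      δ hδ0 hδ1 ?_ hω.neg h' ?_ ?_, Or.inr ?_⟩
    · intro u hu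
      simp [hodd u hu]
    · intro t; rw [hder]; simpa [abs_of_neg (hs t)] using (hd t).1
    · intro t; rw [hder]; simpa [abs_of_neg (hs t)] using (hd t).2
    · intro ρ hρ θ
      simp only [hunit ρ hρ θ]
      exact h' θ

lemma LiftOK.mono_diff {ω : ℝ → ℝ} {c : ℝ} (h : LiftOK ω c) {a b : ℝ} (hab : a ≤ b) :
    c * (b - a) ≤ ω b - ω a :=
  mul_sub_le_image_sub_of_le_deriv (h.cd.differentiable (by norm_num)) h.der hab

lemma LiftOK.sin_core {ω : ℝ → ℝ} {c : ℝ} (h : LiftOK ω c) (e β : ℝ) (h0 : 0 ≤ β)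
    (h1 : β ≤ Real.pi) : c * Real.sin β ≤ Real.sin (ω (e + β) - ω e) := by
  have hc := h.cpos
  have hc1 := h.cle
  have hconc : ∀ x, 0 ≤ x → x ≤ Real.pi → c * Real.sin x ≤ Real.sin (c * x) := by
    intro x hx0 hx1
    have := strictConcaveOn_sin_Icc.concaveOn.2 (show (0 : ℝ) ∈ Icc 0 Real.pi from
      ⟨le_rfl, Real.pi_pos.le⟩) (show x ∈ Icc 0 Real.pi from ⟨hx0, hx1⟩)
      (show 0 ≤ 1 - c by linarith) hc.le (by ring)
    simpa using this
  have lo := h.mono_diff (a := e) (b := e + β) (by linarith)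
  have hi := h.mono_diff (a := e + β) (b := e + Real.pi) (by linarith)
  rw [h.per] at hi
  set α := ω (e + β) - ω e with hα
  have lo' : c * β ≤ α := by linarith [show c * (e + β - e) = c * β by ring]
  have hi' : c * (Real.pi - β) ≤ Real.pi - α := by
    have : c * (e + Real.pi - (e + β)) = c * (Real.pi - β) := by ring
    linarith
  have hcb : 0 ≤ c * β := by positivity
  have hcb' : 0 ≤ c * (Real.pi - β) := mul_nonneg hc.le (by linarith)
  rcases le_total α (Real.pi / 2) with ha | ha
  · calc c * Real.sin β ≤ Real.sin (c * β) := hconc β h0 h1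
      _ ≤ Real.sin α := Real.sin_le_sin_of_le_of_le_pi_div_two (by linarith [Real.pi_pos]) ha lo'
  · calc c * Real.sin β = c * Real.sin (Real.pi - β) := by rw [Real.sin_pi_sub]
      _ ≤ Real.sin (c * (Real.pi - β)) := hconc _ (by linarith) (by linarith)
      _ ≤ Real.sin (Real.pi - α) := Real.sin_le_sin_of_le_of_le_pi_div_two
          (by linarith [Real.pi_pos]) (by linarith) hi'
      _ = Real.sin α := Real.sin_pi_sub α

lemma LiftOK.per_nat {ω : ℝ → ℝ} {c : ℝ} (h : LiftOK ω c) (n : ℕ) :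
    ∀ t, ω (t + n * Real.pi) = ω t + n * Real.pi := by
  induction n with
  | zero => intro t; simp
  | succ k ih =>
    intro t
    have : t + ((k + 1 : ℕ) : ℝ) * Real.pi = (t + k * Real.pi) + Real.pi := by push_cast; ring
    rw [this, h.per, ih]; push_cast; ring

lemma LiftOK.per_int {ω : ℝ → ℝ} {c : ℝ} (h : LiftOK ω c) (n : ℤ) (t : ℝ) :
    ω (t + n * Real.pi) = ω t + n * Real.pi := by
  rcases Int.eq_nat_or_neg n with ⟨k, rfl | rfl⟩
  · simpa using h.per_nat k t
  · have := h.per_nat k (t + ((-(k : ℤ) : ℤ) : ℝ) * Real.pi)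
    push_cast at this ⊢
    have e : t + -(k : ℝ) * Real.pi + k * Real.pi = t := by ring
    rw [e] at this
    linarith

lemma LiftOK.sin_mul {ω : ℝ → ℝ} {c : ℝ} (h : LiftOK ω c) (e θ : ℝ) :
    c * Real.sin (θ - e) ^ 2 ≤ Real.sin (ω θ - ω e) * Real.sin (θ - e) := by
  obtain ⟨n, β, hn, h0, h1⟩ : ∃ (n : ℤ) (β : ℝ), θ = e + β + n * Real.pi ∧ 0 ≤ β ∧ β ≤ Real.pi := by
    refine ⟨⌊(θ - e) / Real.pi⌋, θ - e - ⌊(θ - e) / Real.pi⌋ * Real.pi, by ring, ?_, ?_⟩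
    · have := Int.floor_le ((θ - e) / Real.pi)
      rw [le_div_iff₀ Real.pi_pos] at this
      linarith
    · have := (Int.lt_floor_add_one ((θ - e) / Real.pi)).le
      rw [div_le_iff₀ Real.pi_pos] at this
      linarith
  have core := h.sin_core e β h0 h1
  have hs := Real.sin_nonneg_of_nonneg_of_le_pi h0 h1
  rw [hn, h.per_int]
  have e1 : e + β + n * Real.pi - e = β + n * Real.pi := by ring
  have e2 : ω (e + β) + n * Real.pi - ω e = (ω (e + β) - ω e) + n * Real.pi := by ring
  rw [e1, e2, Real.sin_add_int_mul_pi, Real.sin_add_int_mul_pi]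
  have hsq : ((-1 : ℝ) ^ n) ^ 2 = 1 := by
    rcases Int.even_or_odd n with hh | hh
    · rw [hh.neg_one_zpow]; norm_num
    · rw [hh.neg_one_zpow]; norm_num
  set m := (-1 : ℝ) ^ n
  have a1 : (m * Real.sin β) ^ 2 = Real.sin β ^ 2 := by rw [mul_pow, hsq, one_mul]
  have a2 : m * Real.sin (ω (e + β) - ω e) * (m * Real.sin β)
      = Real.sin (ω (e + β) - ω e) * Real.sin β := by
    calc _ = m ^ 2 * (Real.sin (ω (e + β) - ω e) * Real.sin β) := by ring
      _ = _ := by rw [hsq, one_mul]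
  rw [a1, a2]
  nlinarith

/-- Admissible radial test functions, supported in `[a,b] ⊂ (0,∞)`. -/
structure TF (ψ : ℝ → ℝ) (a b : ℝ) : Prop where
  cd : ContDiff ℝ 1 ψ
  apos : 0 < a
  zero : ∀ ρ, ρ ∉ Icc a b → ψ ρ = 0

/-- The test kernel `ψ(|w|) U(w)`. -/
def GK (U : ℂ → ℂ) (ψ : ℝ → ℝ) (w : ℂ) : ℂ := (ψ ‖w‖ : ℂ) * U w

lemma polar (w : ℂ) (hw : w ≠ 0) : ∃ ρ θ : ℝ, 0 < ρ ∧ w = ρ * Complex.exp (θ * I) :=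
  ⟨‖w‖, Complex.arg w, norm_pos_iff.2 hw, (Complex.norm_mul_exp_arg_mul_I w).symm⟩

lemma unit_polar (w : ℂ) (hw : ‖w‖ = 1) : ∃ θ : ℝ, w = Complex.exp (θ * I) := by
  refine ⟨Complex.arg w, ?_⟩
  have := Complex.norm_mul_exp_arg_mul_I w
  rw [hw] at this
  simpa using this.symm

lemma UOK.local_formula {U : ℂ → ℂ} {ω : ℝ → ℝ} (h : UOK U ω) (θ : ℝ) (y : ℂ) (hy : y ≠ 0) :
    U y = Complex.exp ((ω (θ + (Complex.log (y * Complex.exp (-θ * I))).im) : ℝ) * I) := by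
  have hn : ‖y * Complex.exp (-θ * I)‖ = ‖y‖ := by
    have : Complex.exp (-θ * I) = Complex.exp ((-θ : ℝ) * I) := by push_cast; rfl
    rw [norm_mul, this, Complex.norm_exp_ofReal_mul_I, mul_one]
  have e := Complex.norm_mul_exp_arg_mul_I (y * Complex.exp (-θ * I))
  rw [hn] at e
  have : y = ‖y‖ * Complex.exp (((θ + (y * Complex.exp (-θ * I)).arg : ℝ) : ℂ) * I) := by
    push_cast
    rw [add_mul, Complex.exp_add]
    calc y = y * Complex.exp (-θ * I) * Complex.exp (θ * I) := by
            rw [mul_assoc, ← Complex.exp_add]; simp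
      _ = (‖y‖ * Complex.exp ((y * Complex.exp (-θ * I)).arg * I)) * Complex.exp (θ * I) := by
            rw [e]
      _ = _ := by ring
  rw [Complex.log_im]
  conv_lhs => rw [this]
  rw [h _ (norm_pos_iff.2 hy)]

lemma UOK.contDiffAt {U : ℂ → ℂ} {ω : ℝ → ℝ} {c : ℝ} (h : UOK U ω) (hω : LiftOK ω c) (y : ℂ)
    (hy : y ≠ 0) : ContDiffAt ℝ 1 U y := by
  obtain ⟨ρ, θ, hρ, rfl⟩ := polar y hy
  have hev : U =ᶠ[𝓝 (ρ * Complex.exp (θ * I))] fun y =>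
      Complex.exp ((ω (θ + (Complex.log (y * Complex.exp (-θ * I))).im) : ℝ) * I) := by
    filter_upwards [isOpen_ne.mem_nhds hy] with z hz using h.local_formula θ z hz
  refine ContDiffAt.congr_of_eventuallyEq ?_ hev
  have hz : ρ * Complex.exp (θ * I) * Complex.exp (-θ * I) = ρ := by
    rw [mul_assoc, ← Complex.exp_add]; simp
  have hlog : ContDiffAt ℝ 1 (fun y : ℂ => Complex.log (y * Complex.exp (-θ * I)))
      (ρ * Complex.exp (θ * I)) := by
    have : ContDiffAt ℂ 1 Complex.log (ρ * Complex.exp (θ * I) * Complex.exp (-θ * I)) := by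
      rw [hz]
      exact Complex.contDiffAt_log (Complex.ofReal_mem_slitPlane.2 hρ)
    exact (this.restrict_scalars ℝ).comp (ρ * Complex.exp (θ * I))
      (contDiffAt_id.mul contDiffAt_const)
  have him : ContDiffAt ℝ 1 (fun y : ℂ => (Complex.log (y * Complex.exp (-θ * I))).im)
      (ρ * Complex.exp (θ * I)) := Complex.imCLM.contDiff.contDiffAt.comp _ hlog
  have hom : ContDiffAt ℝ 1 (fun y : ℂ => ω (θ + (Complex.log (y * Complex.exp (-θ * I))).im))
      (ρ * Complex.exp (θ * I)) :=
    hω.cd.contDiffAt.comp (ρ * Complex.exp (θ * I)) (contDiffAt_const.add him)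
  have hof : ContDiffAt ℝ 1 (fun y : ℂ => ((ω (θ + (Complex.log (y * Complex.exp (-θ * I))).im) : ℝ)
      : ℂ) * I) (ρ * Complex.exp (θ * I)) :=
    (Complex.ofRealCLM.contDiff.contDiffAt.comp (ρ * Complex.exp (θ * I)) hom).mul contDiffAt_const
  exact hof.cexp

lemma UOK.norm_eq {U : ℂ → ℂ} {ω : ℝ → ℝ} (h : UOK U ω) (y : ℂ) (hy : y ≠ 0) : ‖U y‖ = 1 := by
  obtain ⟨ρ, θ, hρ, rfl⟩ := polar y hy
  rw [h ρ hρ, Complex.norm_exp_ofReal_mul_I]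

lemma GK_zero_near {U : ℂ → ℂ} {ψ : ℝ → ℝ} {a b : ℝ} (hψ : TF ψ a b) :
    GK U ψ =ᶠ[𝓝 0] fun _ => 0 := by
  filter_upwards [ball_mem_nhds (0 : ℂ) hψ.apos] with z hz
  have : ‖z‖ < a := by simpa using hz
  simp [GK, hψ.zero ‖z‖ (fun h => absurd h.1 (not_le.2 this))]

lemma GK_contDiff {U : ℂ → ℂ} {ω : ℝ → ℝ} {c : ℝ} (h : UOK U ω) (hω : LiftOK ω c)
    {ψ : ℝ → ℝ} {a b : ℝ} (hψ : TF ψ a b) : ContDiff ℝ 1 (GK U ψ) := by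
  rw [contDiff_iff_contDiffAt]
  intro y
  by_cases hy : y = 0
  · subst hy
    exact contDiffAt_const.congr_of_eventuallyEq (GK_zero_near hψ)
  · have h1 : ContDiffAt ℝ 1 (fun w : ℂ => ((ψ ‖w‖ : ℝ) : ℂ)) y :=
      Complex.ofRealCLM.contDiff.contDiffAt.comp y
        (hψ.cd.contDiffAt.comp y (contDiffAt_norm ℝ hy))
    exact h1.mul (h.contDiffAt hω y hy)

lemma GK_zero {U : ℂ → ℂ} {ψ : ℝ → ℝ} {a b : ℝ} (hψ : TF ψ a b) (w : ℂ) (hw : w ∉ closedBall 0 b) :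
    GK U ψ w = 0 := by
  simp only [mem_closedBall, dist_zero_right, not_le] at hw
  simp [GK, hψ.zero ‖w‖ (fun h => absurd h.2 (not_le.2 hw))]

lemma GK_compact {U : ℂ → ℂ} {ψ : ℝ → ℝ} {a b : ℝ} (hψ : TF ψ a b) :
    HasCompactSupport (GK U ψ) :=
  HasCompactSupport.intro (isCompact_closedBall 0 b) (fun w hw => GK_zero hψ w hw)

/-- Line derivative of the component of the test kernel. -/
lemma GK_lineDeriv {U : ℂ → ℂ} {ω : ℝ → ℝ} {c : ℝ} (h : UOK U ω) (hω : LiftOK ω c)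
    {ψ : ℝ → ℝ} {a b : ℝ} (hψ : TF ψ a b) (ρ θ e : ℝ) (hρ : 0 < ρ) :
    HasDerivAt (fun t : ℝ =>
      ((starRingEnd ℂ) (Complex.exp (ω e * I)) *
        GK U ψ (ρ * Complex.exp (θ * I) + t * Complex.exp (e * I))).re)
      (deriv ψ ρ * Real.cos (θ - e) * Real.cos (ω θ - ω e) +
        ψ ρ * (deriv ω θ * Real.sin (ω θ - ω e) * Real.sin (θ - e) / ρ)) 0 := by
  set w : ℂ := ρ * Complex.exp (θ * I) with hw
  set v : ℂ := Complex.exp (e * I) with hv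
  have hρc : (ρ : ℂ) ≠ 0 := by exact_mod_cast hρ.ne'
  have hw0 : w ≠ 0 := mul_ne_zero hρc (Complex.exp_ne_zero _)
  let f : ℝ → ℂ := fun t => Complex.log ((w + t * v) * Complex.exp (-θ * I))
  have hz0 : (w + (0 : ℝ) * v) * Complex.exp (-θ * I) = ρ := by
    rw [hw]; simp; rw [mul_assoc, ← Complex.exp_add]; simp
  have hf : HasDerivAt f (v * Complex.exp (-θ * I) / ρ) 0 := by
    have h1 : HasDerivAt (fun t : ℝ => (w + t * v) * Complex.exp (-θ * I))
        (v * Complex.exp (-θ * I)) 0 := by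
      have : HasDerivAt (fun t : ℝ => (t : ℂ)) 1 0 := Complex.ofRealCLM.hasDerivAt
      simpa using ((this.mul_const v).const_add w).mul_const (Complex.exp (-θ * I))
    have := h1.clog_real (by rw [hz0]; exact Complex.ofReal_mem_slitPlane.2 hρ)
    rwa [hz0] at this
  have hval : v * Complex.exp (-θ * I) / ρ = Complex.exp (((e - θ : ℝ) : ℂ) * I) / ρ := by
    rw [hv, ← Complex.exp_add]; push_cast; ring_nf
  rw [hval] at hf
  have hre : HasDerivAt (fun t => (f t).re) (Real.cos (θ - e) / ρ) 0 := by
    have := (Complex.reCLM.hasFDerivAt.comp_hasDerivAt (0 : ℝ) hf)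
    have e1 : Complex.reCLM (Complex.exp (((e - θ : ℝ) : ℂ) * I) / ρ) = Real.cos (θ - e) / ρ := by
      rw [Complex.reCLM_apply, Complex.div_ofReal_re, Complex.exp_ofReal_mul_I_re,
        ← Real.cos_neg, neg_sub]
    rw [e1] at this
    exact this
  have him : HasDerivAt (fun t => (f t).im) (- Real.sin (θ - e) / ρ) 0 := by
    have := (Complex.imCLM.hasFDerivAt.comp_hasDerivAt (0 : ℝ) hf)
    have e1 : Complex.imCLM (Complex.exp (((e - θ : ℝ) : ℂ) * I) / ρ) = - Real.sin (θ - e) / ρ := by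
      rw [Complex.imCLM_apply, Complex.div_ofReal_im, Complex.exp_ofReal_mul_I_im,
        ← Real.sin_neg, neg_sub]
    rw [e1] at this
    exact this
  have hf0 : f 0 = Real.log ρ := by
    simp only [f]; rw [hz0, Complex.ofReal_log hρ.le]
  have hf0re : (f 0).re = Real.log ρ := by rw [hf0]; simp
  have hf0im : (f 0).im = 0 := by rw [hf0]; simp
  have hnorm : HasDerivAt (fun t => Real.exp (f t).re) (Real.cos (θ - e)) 0 := by
    have := hre.exp
    rw [hf0re, Real.exp_log hρ] at this
    convert this using 1
    field_simp
  have hpsi : HasDerivAt (fun t => ψ (Real.exp (f t).re)) (deriv ψ ρ * Real.cos (θ - e)) 0 := by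
    have hd : HasDerivAt ψ (deriv ψ ρ) (Real.exp (f 0).re) := by
      rw [hf0re, Real.exp_log hρ]
      exact (hψ.cd.differentiable (by norm_num) ρ).hasDerivAt
    exact hd.comp 0 hnorm
  have hom : HasDerivAt (fun t => ω (θ + (f t).im) - ω e) (deriv ω θ * (- Real.sin (θ - e) / ρ)) 0 := by
    have hd : HasDerivAt ω (deriv ω θ) (θ + (f 0).im) := by
      rw [hf0im, add_zero]
      exact (hω.cd.differentiable (by norm_num) θ).hasDerivAt
    exact (hd.comp (0 : ℝ) (him.const_add θ)).sub_const _
  have hmain := hpsi.mul hom.cos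
  have hev : (fun t : ℝ => ((starRingEnd ℂ) (Complex.exp (ω e * I)) * GK U ψ (w + t * v)).re)
      =ᶠ[𝓝 0] fun t => ψ (Real.exp (f t).re) * Real.cos (ω (θ + (f t).im) - ω e) := by
    have hne : ∀ᶠ t : ℝ in 𝓝 0, w + t * v ≠ 0 := by
      have hc : Continuous fun t : ℝ => w + t * v := by fun_prop
      refine (hc.tendsto 0).eventually_ne ?_
      simpa using hw0
    filter_upwards [hne] with t ht
    have hnn : Real.exp (f t).re = ‖w + t * v‖ := by
      have hn : ‖(w + t * v) * Complex.exp (-θ * I)‖ = ‖w + t * v‖ := by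
        have : Complex.exp (-θ * I) = Complex.exp ((-θ : ℝ) * I) := by push_cast; rfl
        rw [norm_mul, this, Complex.norm_exp_ofReal_mul_I, mul_one]
      simp only [f]
      rw [Complex.log_re, hn, Real.exp_log (norm_pos_iff.2 ht)]
    rw [hnn, GK, h.local_formula θ _ ht, ← Complex.exp_conj]
    rw [mul_left_comm, ← Complex.exp_add, Complex.re_ofReal_mul]
    congr 1
    have : (starRingEnd ℂ) (↑(ω e) * I) + ((ω (θ + (Complex.log ((w + t * v) * Complex.exp (-θ * I))).im) : ℝ) : ℂ) * I
      = ((ω (θ + (f t).im) - ω e : ℝ) : ℂ) * I := by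
      simp [f]; ring
    rw [this, Complex.exp_ofReal_mul_I_re]
  refine (hmain.congr_of_eventuallyEq hev).congr_deriv ?_
  simp only [hf0re, hf0im, Real.exp_log hρ, add_zero]
  ring

lemma exists_cutoff : ∃ M : ℝ, 0 < M ∧ ∀ s R : ℝ, 0 < s → 2 * s ≤ R → ∃ ψ : ℝ → ℝ, TF ψ s (2 * R) ∧
    (∀ ρ, 0 ≤ ψ ρ) ∧ (∀ ρ, ψ ρ ≤ 1) ∧ (∀ ρ, 2 * s ≤ ρ → ρ ≤ R → ψ ρ = 1) ∧
    (∀ ρ, |deriv ψ ρ| ≤ M / s) ∧ (∀ ρ, 2 * s < ρ → |deriv ψ ρ| ≤ M / R) ∧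
    (∀ ρ, 2 * R < ρ → deriv ψ ρ = 0) := by
  have hT : ContDiff ℝ 1 Real.smoothTransition := Real.smoothTransition.contDiff
  have hTd : Differentiable ℝ Real.smoothTransition := hT.differentiable (by norm_num)
  have hz1 : ∀ x, 1 < x → deriv Real.smoothTransition x = 0 := by
    intro x hx
    have : Real.smoothTransition =ᶠ[𝓝 x] fun _ => 1 := by
      filter_upwards [lt_mem_nhds hx] with y hy using Real.smoothTransition.one_of_one_le hy.le
    rw [this.deriv_eq]; simp
  have hz0 : ∀ x, x < 0 → deriv Real.smoothTransition x = 0 := by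
    intro x hx
    have : Real.smoothTransition =ᶠ[𝓝 x] fun _ => 0 := by
      filter_upwards [gt_mem_nhds hx] with y hy using Real.smoothTransition.zero_of_nonpos hy.le
    rw [this.deriv_eq]; simp
  obtain ⟨M, hM⟩ := (isCompact_Icc (a := (0 : ℝ)) (b := 1)).exists_bound_of_continuousOn
    (hT.continuous_deriv (by norm_num)).continuousOn
  have hb : ∀ x, |deriv Real.smoothTransition x| ≤ |M| + 1 := by
    intro x
    by_cases hx : x ∈ Icc (0 : ℝ) 1
    · exact (hM x hx).trans (by linarith [le_abs_self M])
    · rw [mem_Icc, not_and_or] at hx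
      push Not at hx
      rcases hx with hx | hx
      · rw [hz0 x hx]; simp; positivity
      · rw [hz1 x hx]; simp; positivity
  refine ⟨2 * (|M| + 1), by positivity, fun s R hs hsR => ?_⟩
  have hR : 0 < R := by linarith
  set T := Real.smoothTransition with hTdef
  have n0 : ∀ x, 0 ≤ T x := Real.smoothTransition.nonneg
  have n1 : ∀ x, T x ≤ 1 := Real.smoothTransition.le_one
  have hder : ∀ ρ, HasDerivAt (fun ρ => T (ρ / s - 1) * T (2 - ρ / R))
      (deriv T (ρ / s - 1) * (1 / s) * T (2 - ρ / R) + T (ρ / s - 1) * (deriv T (2 - ρ / R) * (-(1 / R)))) ρ := by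
    intro ρ
    have h1 : HasDerivAt (fun ρ : ℝ => ρ / s - 1) (1 / s) ρ := ((hasDerivAt_id ρ).div_const s).sub_const 1
    have h2 : HasDerivAt (fun ρ : ℝ => 2 - ρ / R) (-(1 / R)) ρ := ((hasDerivAt_id ρ).div_const R).const_sub 2
    exact ((hTd _).hasDerivAt.comp ρ h1).mul ((hTd _).hasDerivAt.comp ρ h2)
  have hMs : (|M| + 1) / R ≤ (|M| + 1) / s := by gcongr; linarith
  have t2 : ∀ ρ, |T (ρ / s - 1) * (deriv T (2 - ρ / R) * (-(1 / R)))| ≤ (|M| + 1) / R := by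
    intro ρ
    rw [abs_mul, abs_mul, abs_neg, abs_of_nonneg (n0 _), abs_of_pos (by positivity : 0 < 1 / R)]
    calc T (ρ / s - 1) * (|deriv T (2 - ρ / R)| * (1 / R)) ≤ 1 * ((|M| + 1) * (1 / R)) := by
          gcongr
          · exact n1 _
          · exact hb _
      _ = _ := by ring
  have t1 : ∀ ρ, |deriv T (ρ / s - 1) * (1 / s) * T (2 - ρ / R)| ≤ (|M| + 1) / s := by
    intro ρ
    rw [abs_mul, abs_mul, abs_of_nonneg (n0 _), abs_of_pos (by positivity : 0 < 1 / s)]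
    calc |deriv T (ρ / s - 1)| * (1 / s) * T (2 - ρ / R) ≤ (|M| + 1) * (1 / s) * 1 := by
          gcongr
          · exact n0 _
          · exact hb _
          · exact n1 _
      _ = _ := by ring
  refine ⟨fun ρ => T (ρ / s - 1) * T (2 - ρ / R), ⟨?_, hs, ?_⟩, ?_, ?_, ?_, ?_, ?_, ?_⟩
  · exact (hT.comp (by fun_prop)).mul (hT.comp (by fun_prop))
  · intro ρ hρ
    rw [mem_Icc, not_and_or] at hρ
    push Not at hρ
    rcases hρ with hρ | hρ
    · have : T (ρ / s - 1) = 0 := Real.smoothTransition.zero_of_nonpos (by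
        rw [sub_nonpos, div_le_one hs]; exact hρ.le)
      simp [this]
    · have : T (2 - ρ / R) = 0 := Real.smoothTransition.zero_of_nonpos (by
        rw [sub_nonpos, le_div_iff₀ hR]; exact hρ.le)
      simp [this]
  · intro ρ; exact mul_nonneg (n0 _) (n0 _)
  · intro ρ; exact mul_le_one₀ (n1 _) (n0 _) (n1 _)
  · intro ρ h1 h2
    have a1 : T (ρ / s - 1) = 1 := Real.smoothTransition.one_of_one_le (by
      rw [le_sub_iff_add_le, le_div_iff₀ hs]; linarith)
    have a2 : T (2 - ρ / R) = 1 := Real.smoothTransition.one_of_one_le (by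
      rw [le_sub_comm, div_le_iff₀ hR]; linarith)
    simp [a1, a2]
  · intro ρ
    rw [(hder ρ).deriv]
    calc _ ≤ (|M| + 1) / s + (|M| + 1) / R := (abs_add_le _ _).trans (add_le_add (t1 ρ) (t2 ρ))
      _ ≤ (|M| + 1) / s + (|M| + 1) / s := by linarith
      _ = _ := by ring
  · intro ρ hρ
    rw [(hder ρ).deriv]
    have : deriv T (ρ / s - 1) = 0 := hz1 _ (by rw [lt_sub_iff_add_lt, lt_div_iff₀ hs]; linarith)
    rw [this]
    simp only [zero_mul, zero_add]
    refine (t2 ρ).trans ?_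
    gcongr
    linarith [abs_nonneg M]
  · intro ρ hρ
    rw [(hder ρ).deriv]
    have a1 : deriv T (ρ / s - 1) = 0 := hz1 _ (by rw [lt_sub_iff_add_lt, lt_div_iff₀ hs]; linarith)
    have a2 : deriv T (2 - ρ / R) = 0 := hz0 _ (by rw [sub_lt_zero, lt_div_iff₀ hR]; exact hρ)
    simp [a1, a2]

/-- Tangential component. -/
def cre (e w : ℂ) : ℝ := e.re * w.re + e.im * w.im

/-- Normal component. -/
def cim (e w : ℂ) : ℝ := e.re * w.im - e.im * w.re

/-- Ahlfors regular measures with support `X`, symmetric with respect to `U`. -/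
structure SymM (U : ℂ → ℂ) (ν : Measure ℂ) (X : Set ℂ) (C : ℝ) : Prop where
  closed : IsClosed X
  null : ν Xᶜ = 0
  Cpos : 0 < C
  lower : ∀ x ∈ X, ∀ r : ℝ, 0 < r → ENNReal.ofReal (r / C) ≤ ν (closedBall x r)
  upper : ∀ x ∈ X, ∀ r : ℝ, 0 < r → ν (closedBall x r) ≤ ENNReal.ofReal (C * r)
  sym : ∀ x ∈ X, ∀ (ψ : ℝ → ℝ) (a b : ℝ), TF ψ a b → ∫ y, GK U ψ (x - y) ∂ν = 0

lemma normSq_eq_cre_cim (e w : ℂ) (he : ‖e‖ = 1) : ‖w‖ ^ 2 = cre e w ^ 2 + cim e w ^ 2 := by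
  have h1 : e.re ^ 2 + e.im ^ 2 = 1 := by
    have := Complex.sq_norm e
    rw [he, Complex.normSq_apply] at this
    nlinarith
  rw [Complex.sq_norm, Complex.normSq_apply, cre, cim]
  linear_combination (-(w.re * w.re) - w.im * w.im) * h1

lemma abs_cim_le (e w : ℂ) (he : ‖e‖ = 1) : |cim e w| ≤ ‖w‖ :=
  abs_le_of_sq_le_sq (by nlinarith [normSq_eq_cre_cim e w he, sq_nonneg (cre e w)]) (norm_nonneg _)

lemma abs_cre_le (e w : ℂ) (he : ‖e‖ = 1) : |cre e w| ≤ ‖w‖ :=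
  abs_le_of_sq_le_sq (by nlinarith [normSq_eq_cre_cim e w he, sq_nonneg (cim e w)]) (norm_nonneg _)

lemma norm_le_cre_cim (e w : ℂ) (he : ‖e‖ = 1) : ‖w‖ ≤ |cre e w| + |cim e w| := by
  refine abs_le_of_sq_le_sq' ?_ (by positivity) |>.2
  rw [normSq_eq_cre_cim e w he]
  nlinarith [sq_abs (cre e w), sq_abs (cim e w), abs_nonneg (cre e w), abs_nonneg (cim e w),
    mul_nonneg (abs_nonneg (cre e w)) (abs_nonneg (cim e w))]

lemma decomp_cre_cim (e w : ℂ) (he : ‖e‖ = 1) : w = cre e w * e + cim e w * (I * e) := by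
  have h1 : e.re ^ 2 + e.im ^ 2 = 1 := by
    have := Complex.sq_norm e
    rw [he, Complex.normSq_apply] at this
    nlinarith
  apply Complex.ext
  · simp [cre, cim]
    linear_combination (-w.re) * h1
  · simp [cre, cim]
    linear_combination (-w.im) * h1

lemma cim_polar (ρ θ e : ℝ) :
    cim (Complex.exp (e * I)) (ρ * Complex.exp (θ * I)) = ρ * Real.sin (θ - e) := by
  simp only [cim, Complex.re_ofReal_mul, Complex.im_ofReal_mul, Complex.exp_ofReal_mul_I_re,
    Complex.exp_ofReal_mul_I_im, Real.sin_sub]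
  ring

lemma continuous_cim (e : ℂ) : Continuous (cim e) := by
  unfold cim; fun_prop

lemma norm_polar (ρ θ : ℝ) (hρ : 0 < ρ) : ‖(ρ * Complex.exp (θ * I) : ℂ)‖ = ρ := by
  rw [norm_mul, Complex.norm_exp_ofReal_mul_I, Complex.norm_real, Real.norm_of_nonneg hρ.le,
    mul_one]

lemma UOK.exp_eq {U : ℂ → ℂ} {ω : ℝ → ℝ} (h : UOK U ω) (θ : ℝ) :
    U (Complex.exp (θ * I)) = Complex.exp (ω θ * I) := by
  simpa using h 1 one_pos θ

lemma S_polar {U : ℂ → ℂ} {ω : ℝ → ℝ} (h : UOK U ω) (ρ θ e : ℝ) (hρ : 0 < ρ) :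
    cim (U (Complex.exp (e * I))) (U (ρ * Complex.exp (θ * I))) = Real.sin (ω θ - ω e) := by
  rw [h ρ hρ, h.exp_eq]
  have := cim_polar 1 (ω θ) (ω e)
  simpa using this

lemma S_pos {U : ℂ → ℂ} {ω : ℝ → ℝ} {c : ℝ} (h : UOK U ω) (hω : LiftOK ω c) (e w : ℂ)
    (he : ‖e‖ = 1) (hw : 0 < cim e w) : 0 < cim (U e) (U w) := by
  have hw0 : w ≠ 0 := by rintro rfl; simp [cim] at hw
  obtain ⟨ρ, θ, hρ, rfl⟩ := polar w hw0
  obtain ⟨t, rfl⟩ := unit_polar e he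
  rw [cim_polar] at hw
  rw [S_polar h _ _ _ hρ]
  have hs : 0 < Real.sin (θ - t) := by
    by_contra hcon
    push Not at hcon
    nlinarith
  have := hω.sin_mul t θ
  by_contra hcon
  push Not at hcon
  have := mul_pos hω.cpos (pow_pos hs 2)
  nlinarith

lemma S_zero {U : ℂ → ℂ} {ω : ℝ → ℝ} {c : ℝ} (h : UOK U ω) (hω : LiftOK ω c) (e w : ℂ)
    (he : ‖e‖ = 1) (hw0 : w ≠ 0) (hw : cim e w = 0) : cim (U e) (U w) = 0 := by
  obtain ⟨ρ, θ, hρ, rfl⟩ := polar w hw0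
  obtain ⟨t, rfl⟩ := unit_polar e he
  rw [cim_polar] at hw
  rw [S_polar h _ _ _ hρ]
  have hs : Real.sin (θ - t) = 0 := by
    rcases mul_eq_zero.1 hw with h | h
    · exact absurd h hρ.ne'
    · exact h
  obtain ⟨n, hn⟩ := Real.sin_eq_zero_iff.1 hs
  have : θ = t + n * Real.pi := by linarith
  rw [this, hω.per_int, add_sub_cancel_left, Real.sin_int_mul_pi]

lemma S_nonneg {U : ℂ → ℂ} {ω : ℝ → ℝ} {c : ℝ} (h : UOK U ω) (hω : LiftOK ω c) (e w : ℂ)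
    (he : ‖e‖ = 1) (hw0 : w ≠ 0) (hw : 0 ≤ cim e w) : 0 ≤ cim (U e) (U w) := by
  rcases hw.eq_or_lt with h' | h'
  · exact (S_zero h hω e w he hw0 h'.symm).ge
  · exact (S_pos h hω e w he h').le

section classif

variable {U : ℂ → ℂ} {ω : ℝ → ℝ} {c : ℝ} {ν : Measure ℂ} {X : Set ℂ} {C : ℝ}

lemma hasCompactSupport_sub {E : Type*} [Zero E] {g : ℂ → E} (hg : HasCompactSupport g) (x : ℂ) :
    HasCompactSupport (fun y => g (x - y)) :=
  hg.comp_homeomorph (Homeomorph.subLeft x)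

lemma SymM.isolated (hS : SymM U ν X C) (x : ℂ) (hx : x ∈ X) (s : ℝ) (hs : 0 < s) :
    ∃ y ∈ X, y ≠ x ∧ ‖y - x‖ < s := by
  by_contra hcon
  push Not at hcon
  have hCp := hS.Cpos
  have h1 : ∀ r : ℝ, 0 < r → r < s / 2 → ν (closedBall x (s / 2)) ≤ ENNReal.ofReal (C * r) := by
    intro r hr hrs
    refine le_trans ?_ (hS.upper x hx r hr)
    have : closedBall x (s / 2) ⊆ closedBall x r ∪ Xᶜ := by
      intro y hy
      by_cases hyX : y ∈ X
      · left
        by_cases hyx : y = x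
        · subst hyx; exact mem_closedBall_self hr.le
        · have := hcon y hyX hyx
          rw [mem_closedBall, dist_eq_norm] at hy
          linarith
      · right; exact hyX
    refine (measure_mono this).trans ((measure_union_le _ _).trans ?_)
    rw [hS.null, add_zero]
  have h2 := hS.lower x hx (s / 2) (by linarith)
  set r := min (s / 4) (s / (4 * C * C)) with hr
  have hrp : 0 < r := lt_min (by linarith) (by positivity)
  have h3 := h2.trans (h1 r hrp ((min_le_left _ _).trans_lt (by linarith)))
  rw [ENNReal.ofReal_le_ofReal_iff (by positivity)] at h3
  have h4 : C * r ≤ C * (s / (4 * C * C)) := by gcongr; exact min_le_right _ _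
  have h5 : C * (s / (4 * C * C)) = s / 2 / C / 2 := by field_simp; ring
  have h6 : 0 < s / 2 / C := by positivity
  linarith

lemma SymM.unbounded (hS : SymM U ν X C) (x : ℂ) (hx : x ∈ X) (R : ℝ) :
    ∃ y ∈ X, R < ‖y - x‖ := by
  by_contra hcon
  push Not at hcon
  have hCp := hS.Cpos
  set R1 := |R| + 1
  have hR1 : 0 < R1 := by positivity
  have h1 : ∀ r : ℝ, ν (closedBall x r) ≤ ENNReal.ofReal (C * R1) := by
    intro r
    refine le_trans ?_ (hS.upper x hx R1 hR1)
    have : closedBall x r ⊆ closedBall x R1 ∪ Xᶜ := by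
      intro y hy
      by_cases hyX : y ∈ X
      · left
        have := hcon y hyX
        rw [mem_closedBall, dist_eq_norm]
        have := le_abs_self R
        simp only [R1]; linarith
      · right; exact hyX
    refine (measure_mono this).trans ((measure_union_le _ _).trans ?_)
    rw [hS.null, add_zero]
  have h2 := (hS.lower x hx (2 * C * C * R1) (by positivity)).trans (h1 _)
  rw [ENNReal.ofReal_le_ofReal_iff (by positivity)] at h2
  have : 2 * C * C * R1 / C = 2 * (C * R1) := by field_simp
  have : 0 < C * R1 := by positivity
  linarith

lemma SymM.open_pos (hS : SymM U ν X C) (V : Set ℂ) (hV : IsOpen V) (x : ℂ) (hx : x ∈ X)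
    (hxV : x ∈ V) : 0 < ν V := by
  obtain ⟨r, hr, hrV⟩ := Metric.isOpen_iff.1 hV x hxV
  have hCp := hS.Cpos
  have := hS.lower x hx (r / 2) (by linarith)
  refine lt_of_lt_of_le ?_ (this.trans (measure_mono
    ((closedBall_subset_ball (by linarith)).trans hrV)))
  rw [ENNReal.ofReal_pos]; positivity

lemma SymM.ae_mem (hS : SymM U ν X C) : ∀ᵐ y ∂ν, y ∈ X := by
  rw [ae_iff]; exact hS.null

lemma SymM.posvanish [IsLocallyFiniteMeasure ν] (h : UOK U ω) (hω : LiftOK ω c)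
    (hS : SymM U ν X C) (x e : ℂ) (hx : x ∈ X)
    (he : ‖e‖ = 1) (ρ₁ : ℝ)
    (hpos : ∀ y ∈ X, ‖y - x‖ < ρ₁ → 0 ≤ cim e (x - y)) (y : ℂ) (hy : y ∈ X)
    (hyd : 2 * ‖y - x‖ < ρ₁) : cim e (x - y) = 0 := by
  by_contra hne
  have hyx : 0 < ‖y - x‖ := by
    rw [norm_pos_iff, sub_ne_zero]
    rintro rfl
    simp [cim] at hne
  have hcp : 0 < cim e (x - y) := lt_of_le_of_ne (hpos y hy (by linarith)) (Ne.symm hne)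
  obtain ⟨M, hM, hcut⟩ := exists_cutoff
  set d := ‖y - x‖
  obtain ⟨R, hR1, hR2⟩ : ∃ R, d < R ∧ 2 * R < ρ₁ := ⟨(d + ρ₁ / 2) / 2, by linarith, by linarith⟩
  obtain ⟨ψ, hψ, n0, -, n1, -, -, -⟩ := hcut (d / 4) R (by linarith) (by linarith)
  have hcont := (GK_contDiff h hω hψ).continuous
  have hint : Integrable (fun y => GK U ψ (x - y)) ν :=
    (hcont.comp (by fun_prop : Continuous fun y : ℂ => x - y)).integrable_of_hasCompactSupport
      (hasCompactSupport_sub (GK_compact hψ) x)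
  have hzero := hS.sym x hx ψ _ _ hψ
  let A : ℂ →L[ℝ] ℝ := (U e).re • Complex.imCLM - (U e).im • Complex.reCLM
  have hA : ∀ w, A w = cim (U e) w := by
    intro w; simp [A, cim]
  have h0 : ∫ y, cim (U e) (GK U ψ (x - y)) ∂ν = 0 := by
    have := A.integral_comp_comm hint
    simp only [hA, hzero] at this
    rw [this]; simp [cim]
  have hGc : ∀ w, cim (U e) (GK U ψ w) = ψ ‖w‖ * cim (U e) (U w) := by
    intro w
    simp only [cim, GK, Complex.re_ofReal_mul, Complex.im_ofReal_mul]; ring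
  have hint' : Integrable (fun y => cim (U e) (GK U ψ (x - y))) ν := by
    have := A.integrable_comp hint
    simpa only [hA] using this
  have hnn : 0 ≤ᵐ[ν] fun y => cim (U e) (GK U ψ (x - y)) := by
    filter_upwards [hS.ae_mem] with z hz
    simp only [Pi.zero_apply]
    rw [hGc]
    by_cases hzx : ‖x - z‖ ∈ Icc (d / 4) (2 * R)
    · refine mul_nonneg (n0 _) (S_nonneg h hω e _ he ?_ ?_)
      · rw [← norm_pos_iff]
        exact lt_of_lt_of_le (by linarith) hzx.1
      · exact hpos z hz (by rw [norm_sub_rev]; exact lt_of_le_of_lt hzx.2 hR2)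
    · rw [hψ.zero _ hzx]; simp
  have hae := (integral_eq_zero_iff_of_nonneg_ae hnn hint').1 h0
  let V : Set ℂ := {z | d / 2 < ‖x - z‖ ∧ ‖x - z‖ < R ∧ 0 < cim e (x - z)}
  have hV : IsOpen V := by
    have v1 : IsOpen {z : ℂ | d / 2 < ‖x - z‖} := isOpen_lt continuous_const (by fun_prop)
    have v2 : IsOpen {z : ℂ | ‖x - z‖ < R} := isOpen_lt (by fun_prop) continuous_const
    have v3 : IsOpen {z : ℂ | 0 < cim e (x - z)} :=
      isOpen_lt continuous_const ((continuous_cim e).comp (by fun_prop))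
    exact v1.inter (v2.inter v3)
  have hyV : y ∈ V := by
    refine ⟨?_, ?_, hcp⟩
    · rw [norm_sub_rev]; change d / 2 < d; linarith
    · rw [norm_sub_rev]; exact hR1
  have hVpos := hS.open_pos V hV y hy hyV
  refine hVpos.ne' ?_
  refine measure_mono_null ?_ hae
  intro z hz
  simp only [mem_compl_iff, mem_setOf_eq, Pi.zero_apply]
  rw [hGc, n1 _ (by linarith [hz.1]) hz.2.1.le, one_mul]
  exact (S_pos h hω e _ he hz.2.2).ne'

/-- `x` is a point of `X` where `X` is (weakly) tangent to the direction `e`. -/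
def Tang (X : Set ℂ) (x e : ℂ) : Prop :=
  ∀ η : ℝ, 0 < η → ∀ s : ℝ, 0 < s → ∃ y ∈ X, y ≠ x ∧ ‖y - x‖ < s ∧ |cim e (y - x)| ≤ η * ‖y - x‖

lemma SymM.touch [IsLocallyFiniteMeasure ν] (h : UOK U ω) (hω : LiftOK ω c)
    (hS : SymM U ν X C) (x e : ℂ) (hx : x ∈ X) (he : ‖e‖ = 1) (d : ℝ) (hd : 0 < d)
    (hempty : ∀ y ∈ X, d ≤ ‖y - (x + d * (I * e))‖) : Tang X x e := by
  intro η hη s hs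
  by_contra hcon
  push Not at hcon
  have h1 : e.re ^ 2 + e.im ^ 2 = 1 := by
    have := Complex.sq_norm e
    rw [he, Complex.normSq_apply] at this
    nlinarith
  have hq : ∀ y ∈ X, 2 * d * cim e (y - x) ≤ ‖y - x‖ ^ 2 := by
    intro y hy
    have h2 := pow_le_pow_left₀ hd.le (hempty y hy) 2
    rw [Complex.sq_norm, Complex.normSq_apply] at h2
    rw [Complex.sq_norm, Complex.normSq_apply]
    simp [cim] at h2 ⊢
    nlinarith
  have hneg : ∀ y ∈ X, y ≠ x → ‖y - x‖ < min s (2 * d * η) → cim e (y - x) < 0 := by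
    intro y hy hyx hlt
    have a1 := hcon y hy hyx (hlt.trans_le (min_le_left _ _))
    have a2 := hq y hy
    have a3 := hlt.trans_le (min_le_right _ _)
    have hp : 0 < ‖y - x‖ := norm_pos_iff.2 (sub_ne_zero.2 hyx)
    by_contra hge
    push Not at hge
    rw [abs_of_nonneg hge] at a1
    nlinarith
  have hρ : 0 < min s (2 * d * η) := lt_min hs (by positivity)
  have hcs : ∀ y, cim e (x - y) = - cim e (y - x) := by intro y; simp [cim]; ring
  obtain ⟨y, hy, hyx, hlt⟩ := hS.isolated x hx (min s (2 * d * η) / 2) (by linarith)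
  have := hS.posvanish h hω x e hx he (min s (2 * d * η)) ?_ y hy (by linarith)
  · have h3 := hneg y hy hyx (by linarith)
    rw [hcs] at this
    linarith
  · intro z hz hzl
    rw [hcs]
    by_cases hzx : z = x
    · subst hzx; simp [cim]
    · linarith [hneg z hz hzx hzl]

end classif

section classif2

variable {U : ℂ → ℂ} {ω : ℝ → ℝ} {c : ℝ} {ν : Measure ℂ} {X : Set ℂ} {C : ℝ}

lemma fderiv_zero_outside {g : ℂ → ℝ} {b : ℝ} (hz : ∀ w, w ∉ closedBall (0 : ℂ) b → g w = 0)
    (w : ℂ) (hw : w ∉ closedBall (0 : ℂ) b) : fderiv ℝ g w = 0 := by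
  have : g =ᶠ[𝓝 w] fun _ => 0 := by
    filter_upwards [isClosed_closedBall.isOpen_compl.mem_nhds hw] with v hv using hz v hv
  rw [this.fderiv_eq]
  simp

lemma hasFDerivAt_conv [IsLocallyFiniteMeasure ν] {g : ℂ → ℝ} (hg : ContDiff ℝ 1 g) (b : ℝ)
    (hz : ∀ w, w ∉ closedBall (0 : ℂ) b → g w = 0) (x₀ : ℂ) :
    HasFDerivAt (fun x => ∫ y, g (x - y) ∂ν) (∫ y, fderiv ℝ g (x₀ - y) ∂ν) x₀ ∧
      Integrable (fun y => fderiv ℝ g (x₀ - y)) ν := by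
  have hgc : HasCompactSupport g := HasCompactSupport.intro (isCompact_closedBall 0 b) hz
  have hdc : Continuous (fderiv ℝ g) := hg.continuous_fderiv one_ne_zero
  have hdcs : HasCompactSupport (fderiv ℝ g) := hgc.fderiv ℝ
  obtain ⟨B, hB⟩ := hdc.bounded_above_of_compact_support hdcs
  have hmap : ∀ x : ℂ, Continuous fun y : ℂ => x - y := fun x => by fun_prop
  have hI : Integrable (fun y => fderiv ℝ g (x₀ - y)) ν :=
    (hdc.comp (hmap x₀)).integrable_of_hasCompactSupport (hasCompactSupport_sub hdcs x₀)
  refine ⟨?_, hI⟩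
  refine hasFDerivAt_integral_of_dominated_of_fderiv_le (F := fun x y => g (x - y))
    (F' := fun x y => fderiv ℝ g (x - y))
    (bound := (closedBall x₀ (b + 1)).indicator fun _ => B)
    (ball_mem_nhds x₀ zero_lt_one) ?_ ?_ ?_ ?_ ?_ ?_
  · exact Eventually.of_forall fun x => (hg.continuous.comp (hmap x)).aestronglyMeasurable
  · exact (hg.continuous.comp (hmap x₀)).integrable_of_hasCompactSupport (hasCompactSupport_sub hgc x₀)
  · exact hI.aestronglyMeasurable
  · refine Eventually.of_forall fun y x hx => ?_
    by_cases hy : y ∈ closedBall x₀ (b + 1)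
    · rw [indicator_of_mem hy]; exact hB _
    · rw [indicator_of_notMem hy, fderiv_zero_outside hz, norm_zero]
      intro hcon
      apply hy
      rw [mem_closedBall] at hcon ⊢
      rw [mem_ball] at hx
      rw [dist_zero_right] at hcon
      have h3 : dist y x₀ ≤ dist y x + dist x x₀ := dist_triangle _ _ _
      rw [dist_comm y x, dist_eq_norm x y] at h3
      linarith
  · exact (integrable_indicator_iff measurableSet_closedBall).2
      (integrableOn_const (isCompact_closedBall _ _).measure_lt_top.ne)
  · refine Eventually.of_forall fun y x hx => ?_
    have h1 := (hg.differentiable one_ne_zero (x - y)).hasFDerivAt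
    have h2 : HasFDerivAt (fun x : ℂ => x - y) (ContinuousLinearMap.id ℝ ℂ) x :=
      (hasFDerivAt_id x).sub_const y
    simpa using! h1.comp x h2

/-- A function vanishing on `X` has zero derivative in the tangent direction. -/
lemma Tang.deriv_zero {x e : ℂ} (hT : Tang X x e) (he : ‖e‖ = 1) (hx : x ∈ X) {f : ℂ → ℝ}
    (hf : ∀ y ∈ X, f y = 0) {L : ℂ →L[ℝ] ℝ} (hL : HasFDerivAt f L x) : L e = 0 := by
  by_contra hne
  set A := |L e| with hA
  have hApos : 0 < A := abs_pos.2 hne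
  set N := ‖L‖ + 1
  have hN : 0 < N := by positivity
  obtain ⟨η, hη, hη1, hη2⟩ : ∃ η : ℝ, 0 < η ∧ η ≤ 1 / 2 ∧ η * N ≤ A / 8 :=
    ⟨min (1 / 2) (A / 8 / N), lt_min (by norm_num) (by positivity), min_le_left _ _, by
      calc _ ≤ (A / 8 / N) * N := by gcongr; exact min_le_right _ _
        _ = A / 8 := by field_simp⟩
  have hlo := hL.isLittleO
  rw [Asymptotics.isLittleO_iff] at hlo
  have h1 := hlo (c := A / 8) (by positivity)
  obtain ⟨s, hs, h2⟩ := Metric.eventually_nhds_iff.1 h1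
  obtain ⟨y, hyX, hyx, hys, hyc⟩ := hT η hη s hs
  have h3 := h2 (y := y) (by rwa [dist_eq_norm])
  rw [hf y hyX, hf x hx, sub_zero, zero_sub, norm_neg, Real.norm_eq_abs] at h3
  have hd : 0 < ‖y - x‖ := norm_pos_iff.2 (sub_ne_zero.2 hyx)
  have h4 := decomp_cre_cim e (y - x) he
  have h5 : L (y - x) = cre e (y - x) * L e + cim e (y - x) * L (I * e) := by
    conv_lhs => rw [h4]
    rw [map_add, ← Complex.real_smul, ← Complex.real_smul, map_smul, map_smul, smul_eq_mul,
      smul_eq_mul]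
  have h6 : |L (I * e)| ≤ N := by
    have := L.le_opNorm (I * e)
    rw [norm_mul, he, Complex.norm_I, Real.norm_eq_abs] at this
    simp only [N]; linarith
  have h7 := norm_le_cre_cim e (y - x) he
  have h8 : ‖y - x‖ / 2 ≤ |cre e (y - x)| := by nlinarith
  have h9 : |cre e (y - x) * L e| ≤ |L (y - x)| + |cim e (y - x) * L (I * e)| := by
    have : cre e (y - x) * L e = L (y - x) - cim e (y - x) * L (I * e) := by rw [h5]; ring
    rw [this]; exact abs_sub _ _
  rw [abs_mul, abs_mul] at h9
  have h10 : |cim e (y - x)| * |L (I * e)| ≤ (η * ‖y - x‖) * N := by gcongr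
  have h11 : ‖y - x‖ / 2 * A ≤ |cre e (y - x)| * |L e| := by gcongr
  have h12 : (η * N) * ‖y - x‖ ≤ A / 8 * ‖y - x‖ := by gcongr
  have h13 := mul_pos hApos hd
  nlinarith

/-- Pointwise lower bound for the derivative of the test kernel. -/
lemma GK_deriv_lower (h : UOK U ω) (hω : LiftOK ω c) {ψ : ℝ → ℝ} {a b : ℝ} (hψ : TF ψ a b)
    (hn : ∀ ρ, 0 ≤ ψ ρ) (e : ℂ) (he : ‖e‖ = 1) (w : ℂ) :
    c ^ 2 * (ψ ‖w‖ * (cim e w ^ 2 / ‖w‖ ^ 3)) ≤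
      fderiv ℝ (fun w => (starRingEnd ℂ (U e) * GK U ψ w).re) w e + |deriv ψ ‖w‖| := by
  have hgd : Differentiable ℝ (fun w => (starRingEnd ℂ (U e) * GK U ψ w).re) := by
    have := (GK_contDiff h hω hψ).differentiable one_ne_zero
    have h2 : Differentiable ℝ (fun w => starRingEnd ℂ (U e) * GK U ψ w) := this.const_mul _
    exact Complex.reCLM.differentiable.comp h2
  by_cases hw : w = 0
  · subst hw
    have : (fun w => (starRingEnd ℂ (U e) * GK U ψ w).re) =ᶠ[𝓝 0] fun _ => 0 := by
      filter_upwards [GK_zero_near (U := U) hψ] with v hv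
      rw [hv]; simp
    rw [this.fderiv_eq]
    simp
  obtain ⟨ρ, θ, hρ, rfl⟩ := polar w hw
  obtain ⟨t, rfl⟩ := unit_polar e he
  have h1 := GK_lineDeriv h hω hψ ρ θ t hρ
  set w : ℂ := ρ * Complex.exp (θ * I)
  set e : ℂ := Complex.exp (t * I)
  have h2 : HasDerivAt (fun s : ℝ => (starRingEnd ℂ (U e) * GK U ψ (w + s * e)).re)
      (fderiv ℝ (fun w => (starRingEnd ℂ (U e) * GK U ψ w).re) w e) 0 := by
    have h3 : HasDerivAt (fun s : ℝ => w + s * e) e 0 := by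
      have := ((Complex.ofRealCLM.hasDerivAt (x := (0 : ℝ))).mul_const e).const_add w
      simpa using this
    have h4 := (hgd (w + ((0 : ℝ) : ℂ) * e)).hasFDerivAt.comp_hasDerivAt (0 : ℝ) h3
    simpa using! h4
  rw [h.exp_eq] at h2
  have h5 := h1.unique h2
  rw [h.exp_eq, ← h5, cim_polar, norm_polar _ _ hρ]
  have h6 := hω.sin_mul t θ
  have h7 := hω.der θ
  have hc := hω.cpos
  have h8 : c ^ 2 * (ψ ρ * ((ρ * Real.sin (θ - t)) ^ 2 / ρ ^ 3)) ≤
      ψ ρ * (deriv ω θ * Real.sin (ω θ - ω t) * Real.sin (θ - t) / ρ) := by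
    have e1 : c ^ 2 * (ψ ρ * ((ρ * Real.sin (θ - t)) ^ 2 / ρ ^ 3)) =
      ψ ρ * ((c * (c * Real.sin (θ - t) ^ 2)) / ρ) := by field_simp
    rw [e1]
    have h9 : c * (c * Real.sin (θ - t) ^ 2) ≤
        deriv ω θ * Real.sin (ω θ - ω t) * Real.sin (θ - t) := by
      rw [mul_assoc]
      exact mul_le_mul h7 h6 (by positivity) (by linarith)
    have := hn ρ
    gcongr
  have h10 : -|deriv ψ ρ| ≤ deriv ψ ρ * Real.cos (θ - t) * Real.cos (ω θ - ω t) := by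
    refine (abs_le.1 ?_).1
    rw [abs_mul, abs_mul]
    have a1 := Real.abs_cos_le_one (θ - t)
    have a2 := Real.abs_cos_le_one (ω θ - ω t)
    calc _ ≤ |deriv ψ ρ| * 1 * 1 := by gcongr
      _ = _ := by ring
  linarith

end classif2

section classif3

variable {U : ℂ → ℂ} {ω : ℝ → ℝ} {c : ℝ} {ν : Measure ℂ} {X : Set ℂ} {C : ℝ}

lemma cim_sub (e a b : ℂ) : cim e (a - b) = cim e a - cim e b := by
  simp [cim]; ring

lemma cim_neg (e a : ℂ) : cim e (-a) = - cim e a := by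
  simp [cim]; ring

lemma cim_add (e a b : ℂ) : cim e (a + b) = cim e a + cim e b := by
  simp [cim]; ring

lemma SymM.tang_bound [IsLocallyFiniteMeasure ν] (h : UOK U ω) (hω : LiftOK ω c)
    (hS : SymM U ν X C) (x e : ℂ) (hx : x ∈ X) (he : ‖e‖ = 1) (hT : Tang X x e) :
    ∃ B : ℝ≥0∞, B < ⊤ ∧ ∀ R : ℝ, 2 ≤ R →
      ∫⁻ y in {y | 2 ≤ ‖x - y‖ ∧ ‖x - y‖ ≤ R}, ENNReal.ofReal (cim e (x - y) ^ 2 / ‖x - y‖ ^ 3) ∂ν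
        ≤ B := by
  obtain ⟨M, hM, hcut⟩ := exists_cutoff
  have hCp := hS.Cpos
  have hc := hω.cpos
  refine ⟨ENNReal.ofReal ((c ^ 2)⁻¹) * (ENNReal.ofReal M * ENNReal.ofReal (C * 2) +
    ENNReal.ofReal M * ENNReal.ofReal (C * 2)), ?_, ?_⟩
  · finiteness
  intro R hR
  have hR0 : 0 < R := by linarith
  obtain ⟨ψ, hψ, n0, -, n1, d1, d2, d3⟩ := hcut 1 R one_pos (by linarith)
  set g : ℂ → ℝ := fun w => (starRingEnd ℂ (U e) * GK U ψ w).re with hg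
  have hgC : ContDiff ℝ 1 g := by
    have h2 : ContDiff ℝ 1 (fun w => starRingEnd ℂ (U e) * GK U ψ w) :=
      contDiff_const.mul (GK_contDiff h hω hψ)
    exact Complex.reCLM.contDiff.comp h2
  have hgz : ∀ w, w ∉ closedBall (0 : ℂ) (2 * R) → g w = 0 := by
    intro w hw; simp [hg, GK_zero hψ w hw]
  obtain ⟨hder, hint⟩ := hasFDerivAt_conv (ν := ν) hgC _ hgz x
  have hmap : ∀ x : ℂ, Continuous fun y : ℂ => x - y := fun x => by fun_prop
  have hfz : ∀ z ∈ X, (∫ y, g (z - y) ∂ν) = 0 := by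
    intro z hz
    have hi : Integrable (fun y => GK U ψ (z - y)) ν :=
      ((GK_contDiff h hω hψ).continuous.comp (hmap z)).integrable_of_hasCompactSupport
        (hasCompactSupport_sub (GK_compact hψ) z)
    have h1 := (Complex.reCLM).integral_comp_comm (hi.const_mul (starRingEnd ℂ (U e)))
    have h2 := hS.sym z hz ψ _ _ hψ
    rw [integral_const_mul, h2] at h1
    rw [mul_zero, map_zero] at h1
    exact h1
  have hLe := hT.deriv_zero he hx hfz hder
  have hint' : Integrable (fun y => fderiv ℝ g (x - y) e) ν := hint.apply_continuousLinearMap e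
  have hI0 : ∫ y, fderiv ℝ g (x - y) e ∂ν = 0 := by
    rw [← ContinuousLinearMap.integral_apply hint]; exact hLe
  have hdc : Continuous (deriv ψ) := hψ.cd.continuous_deriv le_rfl
  have hdint : Integrable (fun y => |deriv ψ ‖x - y‖|) ν := by
    refine Continuous.integrable_of_hasCompactSupport (by fun_prop) ?_
    refine HasCompactSupport.intro (isCompact_closedBall x (2 * R)) fun y hy => ?_
    rw [d3, abs_zero]
    rw [mem_closedBall, dist_comm, dist_eq_norm] at hy
    linarith
  have hFI : ∫ y, (fderiv ℝ g (x - y) e + |deriv ψ ‖x - y‖|) ∂ν = ∫ y, |deriv ψ ‖x - y‖| ∂ν := by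
    rw [integral_add hint' hdint, hI0, zero_add]
  have hlow := fun y => GK_deriv_lower h hω hψ n0 e he (x - y)
  have hFnn : ∀ y, 0 ≤ fderiv ℝ g (x - y) e + |deriv ψ ‖x - y‖| := by
    intro y
    refine le_trans ?_ (hlow y)
    have := n0 ‖x - y‖
    positivity
  have hms : MeasurableSet {y : ℂ | 2 ≤ ‖x - y‖ ∧ ‖x - y‖ ≤ R} := by
    have m1 : IsClosed {y : ℂ | 2 ≤ ‖x - y‖} := isClosed_le continuous_const (by fun_prop)
    have m2 : IsClosed {y : ℂ | ‖x - y‖ ≤ R} := isClosed_le (by fun_prop) continuous_const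
    exact (m1.inter m2).measurableSet
  calc ∫⁻ y in {y | 2 ≤ ‖x - y‖ ∧ ‖x - y‖ ≤ R}, ENNReal.ofReal (cim e (x - y) ^ 2 / ‖x - y‖ ^ 3) ∂ν
      ≤ ∫⁻ y in {y | 2 ≤ ‖x - y‖ ∧ ‖x - y‖ ≤ R}, ENNReal.ofReal ((c ^ 2)⁻¹) *
          ENNReal.ofReal (fderiv ℝ g (x - y) e + |deriv ψ ‖x - y‖|) ∂ν := by
        refine setLIntegral_mono' hms fun y hy => ?_
        rw [← ENNReal.ofReal_mul (by positivity)]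
        refine ENNReal.ofReal_le_ofReal ?_
        have h1 := hlow y
        rw [n1 _ (by linarith [hy.1]) hy.2, one_mul] at h1
        rw [inv_mul_eq_div, le_div_iff₀ (by positivity), mul_comm]
        exact h1
    _ ≤ ∫⁻ y, ENNReal.ofReal ((c ^ 2)⁻¹) *
          ENNReal.ofReal (fderiv ℝ g (x - y) e + |deriv ψ ‖x - y‖|) ∂ν := setLIntegral_le_lintegral _ _
    _ = ENNReal.ofReal ((c ^ 2)⁻¹) * ∫⁻ y, ENNReal.ofReal |deriv ψ ‖x - y‖| ∂ν := by
        rw [lintegral_const_mul' _ _ ENNReal.ofReal_ne_top,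
          ← ofReal_integral_eq_lintegral_ofReal (f := fun y => fderiv ℝ g (x - y) e + |deriv ψ ‖x - y‖|)
            (hint'.add hdint) (Eventually.of_forall hFnn), hFI, ← ofReal_integral_eq_lintegral_ofReal hdint (Eventually.of_forall fun _ => abs_nonneg _)]
    _ ≤ _ := by
        gcongr
        calc ∫⁻ y, ENNReal.ofReal |deriv ψ ‖x - y‖| ∂ν
            ≤ ∫⁻ y, ((closedBall x 2).indicator (fun _ => ENNReal.ofReal M) y +
              (closedBall x (2 * R)).indicator (fun _ => ENNReal.ofReal (M / R)) y) ∂ν := by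
              refine lintegral_mono fun y => ?_
              by_cases hy : y ∈ closedBall x 2
              · refine le_trans ?_ le_self_add
                rw [indicator_of_mem hy]
                have := d1 ‖x - y‖
                rw [div_one] at this
                exact ENNReal.ofReal_le_ofReal this
              · refine le_trans ?_ le_add_self
                have hy' : 2 < ‖x - y‖ := by
                  rw [mem_closedBall, dist_comm, dist_eq_norm] at hy
                  linarith
                by_cases hy2 : y ∈ closedBall x (2 * R)
                · rw [indicator_of_mem hy2]
                  exact ENNReal.ofReal_le_ofReal (d2 _ (by linarith))
                · rw [d3, abs_zero, ENNReal.ofReal_zero]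
                  · exact zero_le
                  · rw [mem_closedBall, dist_comm, dist_eq_norm] at hy2
                    linarith
          _ = ENNReal.ofReal M * ν (closedBall x 2) +
              ENNReal.ofReal (M / R) * ν (closedBall x (2 * R)) := by
              rw [lintegral_add_left (measurable_const.indicator measurableSet_closedBall),
                lintegral_indicator_const measurableSet_closedBall,
                lintegral_indicator_const measurableSet_closedBall]
          _ ≤ _ := by
              refine add_le_add ?_ ?_
              · gcongr
                exact hS.upper x hx 2 (by norm_num)
              · calc _ ≤ ENNReal.ofReal (M / R) * ENNReal.ofReal (C * (2 * R)) := by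
                      gcongr
                      exact hS.upper x hx _ (by linarith)
                  _ = _ := by
                      rw [← ENNReal.ofReal_mul (by positivity), ← ENNReal.ofReal_mul (by positivity)]
                      congr 1
                      field_simp

lemma SymM.flat_infty [IsLocallyFiniteMeasure ν] (h : UOK U ω) (hω : LiftOK ω c)
    (hS : SymM U ν X C) (x e : ℂ) (hx : x ∈ X) (he : ‖e‖ = 1) (hT : Tang X x e) (η : ℝ)
    (hη : 0 < η) : ∃ R0 : ℝ, 0 < R0 ∧ ∀ y ∈ X, R0 ≤ ‖y - x‖ → |cim e (y - x)| ≤ η * ‖y - x‖ := by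
  wlog hη1 : η ≤ 1 generalizing η
  · obtain ⟨R0, h0, h1⟩ := this 1 one_pos le_rfl
    exact ⟨R0, h0, fun y hy hyR => (h1 y hy hyR).trans (by gcongr; linarith)⟩
  obtain ⟨B, hB, hBR⟩ := hS.tang_bound h hω x e hx he hT
  have hCp := hS.Cpos
  set lam : Measure ℂ := ν.withDensity fun y => ENNReal.ofReal (cim e (x - y) ^ 2 / ‖x - y‖ ^ 3)
    with hlam
  let T : ℕ → Set ℂ := fun n => {y | (n : ℝ) + 2 ≤ ‖x - y‖}
  have hTc : ∀ n, IsClosed (T n) := fun n => isClosed_le continuous_const (by fun_prop)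
  have hT0 : lam (T 0) ≤ B := by
    have hTU : T 0 = ⋃ n : ℕ, {y | 2 ≤ ‖x - y‖ ∧ ‖x - y‖ ≤ (n : ℝ) + 2} := by
      ext y
      simp only [T, mem_iUnion, mem_ofPred_eq, Nat.cast_zero, zero_add]
      constructor
      · intro hy
        obtain ⟨n, hn⟩ := exists_nat_ge ‖x - y‖
        exact ⟨n, hy, by linarith⟩
      · rintro ⟨n, hn, -⟩; exact hn
    have hmono : Monotone fun n : ℕ => {y : ℂ | 2 ≤ ‖x - y‖ ∧ ‖x - y‖ ≤ (n : ℝ) + 2} := by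
      intro m n hmn y hy
      have : (m : ℝ) ≤ n := by exact_mod_cast hmn
      exact ⟨hy.1, by linarith [hy.2]⟩
    have htd := tendsto_measure_iUnion_atTop (μ := lam) hmono
    rw [← hTU] at htd
    refine le_of_tendsto' htd fun n => ?_
    have hms : MeasurableSet {y : ℂ | 2 ≤ ‖x - y‖ ∧ ‖x - y‖ ≤ (n : ℝ) + 2} := by
      have m1 : IsClosed {y : ℂ | 2 ≤ ‖x - y‖} := isClosed_le continuous_const (by fun_prop)
      have m2 : IsClosed {y : ℂ | ‖x - y‖ ≤ (n : ℝ) + 2} := isClosed_le (by fun_prop) continuous_const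
      exact (m1.inter m2).measurableSet
    rw [Function.comp_apply, hlam, withDensity_apply _ hms]
    exact hBR _ (by linarith [(Nat.cast_nonneg n : (0 : ℝ) ≤ n)])
  have hanti : Antitone T := by
    intro m n hmn y hy
    have h1 : (m : ℝ) ≤ n := by exact_mod_cast hmn
    have h2 : (n : ℝ) + 2 ≤ ‖x - y‖ := hy
    change (m : ℝ) + 2 ≤ ‖x - y‖
    linarith
  have htail := tendsto_measure_iInter_atTop (μ := lam) (fun n => (hTc n).measurableSet.nullMeasurableSet)
    hanti ⟨0, (hT0.trans_lt hB).ne⟩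
  have hemp : (⋂ n, T n) = ∅ := by
    ext y
    simp only [T, mem_iInter, mem_ofPred_eq, mem_empty_iff_false, iff_false, not_forall, not_le]
    obtain ⟨n, hn⟩ := exists_nat_ge ‖x - y‖
    exact ⟨n, by linarith⟩
  rw [hemp, measure_empty] at htail
  have hκ : 0 < ENNReal.ofReal (η ^ 3 / (128 * C)) := by
    rw [ENNReal.ofReal_pos]; positivity
  obtain ⟨n, hn⟩ := (htail.eventually (gt_mem_nhds hκ)).exists
  refine ⟨2 * (n + 2), by positivity, fun y hy hyR => ?_⟩
  by_contra hcon
  push Not at hcon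
  set d := ‖y - x‖
  have hd : 0 < d := lt_of_lt_of_le (by positivity) hyR
  refine absurd hn (not_lt.2 ?_)
  have hηd : η * d ≤ d := by nlinarith
  have key : ∀ z ∈ closedBall y (η * d / 4), (n : ℝ) + 2 ≤ ‖x - z‖ ∧
      η ^ 2 / (32 * d) ≤ cim e (x - z) ^ 2 / ‖x - z‖ ^ 3 := by
    intro z hz
    rw [mem_closedBall, dist_eq_norm] at hz
    have h1 : ‖x - z‖ ≤ 2 * d := by
      have := norm_sub_le_norm_sub_add_norm_sub x y z
      rw [norm_sub_rev x y, norm_sub_rev y z] at this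
      change ‖x - z‖ ≤ d + _ at this
      linarith
    have h2 : d / 2 ≤ ‖x - z‖ := by
      have := norm_sub_le_norm_sub_add_norm_sub x z y
      rw [norm_sub_rev x y] at this
      change d ≤ _ at this
      linarith
    have h3 : η * d / 2 ≤ |cim e (x - z)| := by
      have e1 : cim e (y - x) = cim e (y - z) - cim e (x - z) := by
        rw [← cim_sub]; congr 1; ring
      have e2 := abs_cim_le e (y - z) he
      rw [norm_sub_rev] at e2
      rw [e1] at hcon
      have := abs_sub (cim e (y - z)) (cim e (x - z))
      have := mul_pos hη hd
      linarith
    refine ⟨by linarith, ?_⟩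
    have hp : 0 < ‖x - z‖ := by linarith
    rw [div_le_div_iff₀ (by positivity) (by positivity)]
    have h4 : (η * d / 2) ^ 2 ≤ cim e (x - z) ^ 2 := by
      rw [← sq_abs (cim e (x - z))]; gcongr
    have h5 : ‖x - z‖ ^ 3 ≤ (2 * d) ^ 3 := by gcongr
    calc η ^ 2 * ‖x - z‖ ^ 3 ≤ η ^ 2 * (2 * d) ^ 3 := by gcongr
      _ = (η * d / 2) ^ 2 * (32 * d) := by ring
      _ ≤ _ := by gcongr
  have hsub : closedBall y (η * d / 4) ⊆ T n := fun z hz => (key z hz).1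
  refine le_trans ?_ (measure_mono hsub)
  rw [hlam, withDensity_apply _ measurableSet_closedBall]
  calc ENNReal.ofReal (η ^ 3 / (128 * C))
      = ENNReal.ofReal (η ^ 2 / (32 * d)) * ENNReal.ofReal (η * d / 4 / C) := by
        rw [← ENNReal.ofReal_mul (by positivity)]
        congr 1
        field_simp
        norm_num
    _ ≤ ENNReal.ofReal (η ^ 2 / (32 * d)) * ν (closedBall y (η * d / 4)) := by
        gcongr
        exact hS.lower y hy _ (by positivity)
    _ = ∫⁻ z in closedBall y (η * d / 4), ENNReal.ofReal (η ^ 2 / (32 * d)) ∂ν := by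
        rw [setLIntegral_const]
    _ ≤ _ := setLIntegral_mono' measurableSet_closedBall fun z hz =>
        ENNReal.ofReal_le_ofReal (key z hz).2

end classif3

section classif4

variable {U : ℂ → ℂ} {ω : ℝ → ℝ} {c : ℝ} {ν : Measure ℂ} {X : Set ℂ} {C : ℝ}

lemma cim_real_mul (e w : ℂ) (t : ℝ) : cim e (t * w) = t * cim e w := by
  simp [cim]; ring

lemma unit_sq (e : ℂ) (he : ‖e‖ = 1) : e.re ^ 2 + e.im ^ 2 = 1 := by
  have := Complex.sq_norm e
  rw [he, Complex.normSq_apply] at this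
  nlinarith

lemma cim_I_self (e : ℂ) (he : ‖e‖ = 1) : cim e (I * e) = 1 := by
  have := unit_sq e he
  simp [cim]; nlinarith

lemma cim_self (e : ℂ) : cim e e = 0 := by
  simp [cim]; ring

lemma SymM.two_tang [IsLocallyFiniteMeasure ν] (h : UOK U ω) (hω : LiftOK ω c)
    (hS : SymM U ν X C) (x e x' e' : ℂ) (hx : x ∈ X) (he : ‖e‖ = 1) (hT : Tang X x e)
    (hx' : x' ∈ X) (he' : ‖e'‖ = 1) (hT' : Tang X x' e') : cim e e' = 0 := by
  by_contra hne
  set K := |cim e e'| with hK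
  have hKp : 0 < K := abs_pos.2 hne
  have hK1 : K ≤ 1 := by rw [← he']; exact abs_cim_le e e' he
  obtain ⟨R0, -, hR0⟩ := hS.flat_infty h hω x e hx he hT (K / 8) (by positivity)
  obtain ⟨R1, -, hR1⟩ := hS.flat_infty h hω x' e' hx' he' hT' (K / 8) (by positivity)
  set D := ‖x - x'‖
  have hD : 0 ≤ D := norm_nonneg _
  obtain ⟨y, hy, hyR⟩ := hS.unbounded x' hx' (max R1 (max (R0 + D) (4 * D / K)))
  have b1 : R1 < ‖y - x'‖ := (le_max_left _ _).trans_lt hyR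
  have b2 : R0 + D < ‖y - x'‖ :=
    ((le_max_left _ _).trans (le_max_right _ _)).trans_lt hyR
  have b3 : 4 * D / K < ‖y - x'‖ :=
    ((le_max_right _ _).trans (le_max_right _ _)).trans_lt hyR
  rw [div_lt_iff₀ hKp] at b3
  have t1 : ‖y - x'‖ ≤ ‖y - x‖ + D := norm_sub_le_norm_sub_add_norm_sub y x x'
  have t2 : ‖y - x‖ ≤ ‖y - x'‖ + D := by
    have := norm_sub_le_norm_sub_add_norm_sub y x' x
    rwa [norm_sub_rev x' x] at this
  have f1 := hR0 y hy (by linarith)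
  have f2 := hR1 y hy b1.le
  set v := y - x'
  have g1 : |cim e v| ≤ K / 8 * ‖y - x‖ + D := by
    have e1 : cim e v = cim e (y - x) + cim e (x - x') := by
      rw [← cim_add]; congr 1; simp only [v]; ring
    have e2 := abs_cim_le e (x - x') he
    rw [e1]
    exact (abs_add_le _ _).trans (by linarith)
  have g2 : cim e v = cre e' v * cim e e' + cim e' v * cim e (I * e') := by
    conv_lhs => rw [decomp_cre_cim e' v he']
    rw [cim_add, cim_real_mul, cim_real_mul]
  have g3 : |cim e (I * e')| ≤ 1 := by
    have := abs_cim_le e (I * e') he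
    simpa [he'] using this
  have g4 : |cre e' v| * K ≤ |cim e v| + |cim e' v| := by
    have : cre e' v * cim e e' = cim e v - cim e' v * cim e (I * e') := by rw [g2]; ring
    rw [hK, ← abs_mul, this]
    refine (abs_sub _ _).trans ?_
    rw [abs_mul]
    have := mul_le_mul_of_nonneg_left g3 (abs_nonneg (cim e' v))
    linarith
  have g5 := norm_le_cre_cim e' v he'
  have g6 : (‖v‖ - K / 8 * ‖v‖) * K ≤ |cre e' v| * K := by
    gcongr; linarith
  have hv : 0 ≤ ‖v‖ := norm_nonneg _
  have g7 : K * K * ‖v‖ ≤ K * ‖v‖ := by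
    have : K * K ≤ K * 1 := by gcongr
    nlinarith
  have g8 : K * ‖y - x‖ ≤ K * ‖v‖ + D := by
    have : K * ‖y - x‖ ≤ K * (‖v‖ + D) := by gcongr
    have : K * D ≤ 1 * D := by gcongr
    linarith
  nlinarith

lemma eq_of_cim_zero (e e' : ℂ) (he : ‖e‖ = 1) (he' : ‖e'‖ = 1) (h : cim e e' = 0) :
    e' = e ∨ e' = -e := by
  have h1 := decomp_cre_cim e e' he
  have h2 := normSq_eq_cre_cim e e' he
  rw [h, he'] at h2
  have h3 : cre e e' = 1 ∨ cre e e' = -1 := by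
    rw [← sq_eq_one_iff]; linarith
  rw [h] at h1
  rcases h3 with h3 | h3
  · left; rw [h1, h3]; simp
  · right; rw [h1, h3]; simp

lemma SymM.ne_univ [IsLocallyFiniteMeasure ν] (h : UOK U ω) (hω : LiftOK ω c)
    (hS : SymM U ν X C) : ∃ z, z ∉ X := by
  by_contra hcon
  push Not at hcon
  have hT : ∀ e : ℂ, ‖e‖ = 1 → Tang X 0 e := by
    intro e he η hη s hs
    refine ⟨((s / 2 : ℝ) : ℂ) * e, hcon _, ?_, ?_, ?_⟩
    · have : e ≠ 0 := by rintro rfl; simp at he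
      have : ((s / 2 : ℝ) : ℂ) ≠ 0 := by
        rw [Complex.ofReal_ne_zero]; positivity
      positivity
    · rw [sub_zero, norm_mul, he, Complex.norm_real, Real.norm_eq_abs, abs_of_pos (by positivity)]
      linarith
    · rw [sub_zero, cim_real_mul, cim_self]; simp; positivity
  have := hS.two_tang h hω 0 1 0 I (hcon _) (by simp) (hT 1 (by simp)) (hcon _) (by simp)
    (hT I (by simp))
  simp [cim] at this

/-- Contact point of an empty ball. -/
lemma SymM.contact [IsLocallyFiniteMeasure ν] (h : UOK U ω) (hω : LiftOK ω c)
    (hS : SymM U ν X C) (p : ℂ) (hne : X.Nonempty) (hp : p ∉ X) :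
    ∃ w ∈ X, ∃ e : ℂ, ‖e‖ = 1 ∧ p = w + infDist p X * (I * e) ∧ Tang X w e ∧ 0 < infDist p X := by
  obtain ⟨w, hw, hd⟩ := hS.closed.exists_infDist_eq_dist hne p
  have hpos : 0 < infDist p X := by
    rw [hd, dist_pos]; rintro rfl; exact hp hw
  set d := infDist p X
  have hdc : (d : ℂ) ≠ 0 := by rw [Complex.ofReal_ne_zero]; exact hpos.ne'
  refine ⟨w, hw, -I * ((p - w) / d), ?_, ?_, ?_, hpos⟩
  · rw [norm_mul, norm_neg, Complex.norm_I, norm_div, ← dist_eq_norm, ← hd, Complex.norm_real,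
      Real.norm_of_nonneg hpos.le, one_mul, div_self hpos.ne']
  · field_simp
    rw [Complex.I_sq]; ring
  · have hp' : w + d * (I * (-I * ((p - w) / d))) = p := by
      field_simp
      rw [Complex.I_sq]; ring
    refine hS.touch h hω w _ hw ?_ d hpos ?_
    · rw [norm_mul, norm_neg, Complex.norm_I, norm_div, ← dist_eq_norm, ← hd, Complex.norm_real,
        Real.norm_of_nonneg hpos.le, one_mul, div_self hpos.ne']
    · intro y hy
      rw [hp', ← dist_eq_norm, dist_comm]
      exact infDist_le_dist_of_mem hy

lemma SymM.halfplane [IsLocallyFiniteMeasure ν] (h : UOK U ω) (hω : LiftOK ω c)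
    (hS : SymM U ν X C) (hne : X.Nonempty) :
    ∃ x ∈ X, ∃ e : ℂ, ‖e‖ = 1 ∧ ∀ y ∈ X, cim e (y - x) ≤ 0 := by
  obtain ⟨z0, hz0⟩ := hS.ne_univ h hω
  obtain ⟨x, hx, e, he, -, hTg, -⟩ := hS.contact h hω z0 hne hz0
  obtain ⟨R0, hR0, hflat⟩ := hS.flat_infty h hω x e hx he hTg (1 / 2) (by norm_num)
  have hIe : ‖I * e‖ = 1 := by simp [he]
  have hcimn := cim_I_self e he
  set n := I * e with hn
  have hcont : Continuous fun t : ℝ => x + t * n := by fun_prop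
  have hHc : IsClosed {t : ℝ | x + t * n ∈ X} := hS.closed.preimage hcont
  have hHb : {t : ℝ | x + t * n ∈ X} ⊆ closedBall 0 R0 := by
    intro t ht
    by_contra hcon
    simp only [mem_closedBall, dist_zero_right, Real.norm_eq_abs, not_le] at hcon
    have hnt : ‖x + t * n - x‖ = |t| := by
      rw [add_sub_cancel_left, norm_mul, hIe, mul_one, Complex.norm_real, Real.norm_eq_abs]
    have := hflat _ ht (by rw [hnt]; exact hcon.le)
    rw [hnt, add_sub_cancel_left, cim_real_mul, hcimn, mul_one] at this
    linarith
  have hHcpt : IsCompact {t : ℝ | x + t * n ∈ X} :=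
    (isCompact_closedBall (0 : ℝ) R0).of_isClosed_subset hHc hHb
  obtain ⟨t0, ht0, hmax⟩ := hHcpt.exists_isMaxOn ⟨0, by simpa using hx⟩ continuousOn_id
  have hmax' : ∀ t : ℝ, x + t * n ∈ X → t ≤ t0 := fun t ht => hmax ht
  set xs := x + t0 * n with hxs
  refine ⟨xs, ht0, e, he, fun y hy => ?_⟩
  by_contra hcon
  push Not at hcon
  set p := cim e (y - xs)
  obtain ⟨d, hdp, hd⟩ : ∃ d : ℝ, 0 < d ∧ ‖y - xs‖ ^ 2 < 2 * d * p := by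
    refine ⟨(‖y - xs‖ ^ 2 + 1) / (2 * p), by positivity, ?_⟩
    have : 2 * ((‖y - xs‖ ^ 2 + 1) / (2 * p)) * p = ‖y - xs‖ ^ 2 + 1 := by field_simp
    linarith
  have hyclose : ‖y - (xs + d * n)‖ < d := by
    have e1 : y - (xs + d * n) = (y - xs) - d * n := by ring
    refine lt_of_pow_lt_pow_left₀ 2 hdp.le ?_
    rw [normSq_eq_cre_cim e _ he, e1, cim_sub, cim_real_mul, hcimn]
    have e2 : cre e (y - xs - d * n) = cre e (y - xs) := by
      simp [cre, hn]; ring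
    rw [e2]
    have e3 := normSq_eq_cre_cim e (y - xs) he
    change _ + (p - _) ^ 2 < _
    change _ = _ + p ^ 2 at e3
    nlinarith
  set F : Set ℝ := {T | d ≤ T ∧ infDist (xs + T * n) X ≤ d} with hF
  have hFc : IsClosed F := by
    have c1 : IsClosed {T : ℝ | d ≤ T} := isClosed_le continuous_const continuous_id
    have c2 : IsClosed {T : ℝ | infDist (xs + T * n) X ≤ d} :=
      isClosed_le ((continuous_infDist_pt X).comp (by fun_prop)) continuous_const
    exact c1.inter c2
  have hdF : d ∈ F := by
    refine ⟨le_rfl, ?_⟩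
    refine (infDist_le_dist_of_mem (s := X) (y := xs) ht0).trans ?_
    rw [dist_eq_norm, add_sub_cancel_left, norm_mul, hIe, mul_one, Complex.norm_real,
      Real.norm_of_nonneg hdp.le]
  have hFb : F ⊆ Icc d (3 * d + 3 * |t0| + R0) := by
    rintro T ⟨hT1, hT2⟩
    refine ⟨hT1, ?_⟩
    obtain ⟨w, hw, hwd⟩ := hS.closed.exists_infDist_eq_dist hne (xs + T * n)
    rw [hwd, dist_comm, dist_eq_norm] at hT2
    set u := w - (xs + T * n)
    have hwx : w - x = ((t0 + T : ℝ) : ℂ) * n + u := by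
      simp only [u, hxs]; push_cast; ring
    have c1 : t0 + T - d ≤ cim e (w - x) := by
      rw [hwx, cim_add, cim_real_mul, hcimn]
      have := (abs_le.1 ((abs_cim_le e u he).trans hT2)).1
      linarith
    have c2 : ‖w - x‖ ≤ |t0| + T + d := by
      rw [hwx]
      refine (norm_add_le _ _).trans ?_
      rw [norm_mul, hIe, mul_one, Complex.norm_real, Real.norm_eq_abs]
      have := abs_add_le t0 T
      rw [abs_of_pos (by linarith : 0 < T)] at this
      linarith
    have a0 := abs_le.1 (le_refl |t0|)
    have c3 := le_abs_self (cim e (w - x))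
    by_cases hwR : R0 ≤ ‖w - x‖
    · have := hflat w hw hwR
      linarith [a0.1]
    · have := abs_cim_le e (w - x) he
      push Not at hwR
      linarith [a0.1, a0.2, abs_nonneg t0]
  have hFcpt : IsCompact F := isCompact_Icc.of_isClosed_subset hFc hFb
  obtain ⟨T, hT, hTmax⟩ := hFcpt.exists_isMaxOn ⟨d, hdF⟩ continuousOn_id
  have hTd : infDist (xs + T * n) X = d := by
    refine le_antisymm hT.2 ?_
    by_contra hlt
    push Not at hlt
    set s := d - infDist (xs + T * n) X
    have hs : 0 < s := by simp only [s]; linarith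
    have : T + s ∈ F := by
      refine ⟨by linarith [hT.1], ?_⟩
      have := infDist_le_infDist_add_dist (s := X) (x := xs + ((T + s : ℝ) : ℂ) * n) (y := xs + T * n)
      refine this.trans ?_
      have e1 : xs + ((T + s : ℝ) : ℂ) * n - (xs + T * n) = s * n := by push_cast; ring
      rw [dist_eq_norm, e1, norm_mul, hIe, mul_one, Complex.norm_real, Real.norm_of_nonneg hs.le]
      simp only [s]; linarith
    have h2 : T + s ≤ T := hTmax this
    linarith
  have hnotX : xs + T * n ∉ X := by
    intro hmem
    rw [infDist_zero_of_mem hmem] at hTd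
    linarith
  obtain ⟨w, hw, e', he', heq, hT', -⟩ := hS.contact h hω _ hne hnotX
  rw [hTd] at heq
  have hTle : T ≤ d := by
    rcases eq_of_cim_zero e e' he he' (hS.two_tang h hω x e w e' hx he hTg hw he' hT') with h1 | h1
    · have : w = x + ((t0 + (T - d) : ℝ) : ℂ) * n := by
        rw [h1] at heq
        have : w = xs + T * n - d * n := by rw [heq, hn]; ring
        rw [this, hxs]; push_cast; ring
      have := hmax' _ (this ▸ hw)
      linarith
    · have : w = x + ((t0 + (T + d) : ℝ) : ℂ) * n := by
        rw [h1] at heq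
        have : w = xs + T * n + d * n := by rw [heq, hn]; ring
        rw [this, hxs]; push_cast; ring
      have := hmax' _ (this ▸ hw)
      linarith [hT.1]
  have hTeq : T = d := le_antisymm hTle hT.1
  have h9 := infDist_le_dist_of_mem (x := xs + T * n) hy
  rw [hTd, hTeq, dist_comm, dist_eq_norm] at h9
  linarith

/-- Classification: symmetric measures are supported on lines. -/
theorem SymM.is_line [IsLocallyFiniteMeasure ν] (h : UOK U ω) (hω : LiftOK ω c)
    (hS : SymM U ν X C) (h0 : (0 : ℂ) ∈ X) :
    ∃ e : ℂ, ‖e‖ = 1 ∧ (∀ t : ℝ, (t : ℂ) * e ∈ X) ∧ ∀ y ∈ X, cim e y = 0 := by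
  obtain ⟨x, hx, e, he, hneg⟩ := hS.halfplane h hω ⟨0, h0⟩
  have hline : ∀ y ∈ X, cim e (x - y) = 0 := by
    intro y hy
    refine hS.posvanish h hω x e hx he (2 * ‖y - x‖ + 1) ?_ y hy (by linarith)
    intro z hz _
    have := hneg z hz
    rw [← neg_sub z x, cim_neg]; linarith
  have hx0 : cim e x = 0 := by simpa using hline 0 h0
  have hl : ∀ y ∈ X, cim e y = 0 := by
    intro y hy
    have := hline y hy
    rw [cim_sub, hx0] at this; linarith
  have hrep : ∀ y ∈ X, y = cre e y * e := by
    intro y hy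
    have := decomp_cre_cim e y he
    rw [hl y hy] at this
    simpa using this
  refine ⟨e, he, fun t => ?_, hl⟩
  by_contra hp
  obtain ⟨q, hq, hd⟩ := hS.closed.exists_infDist_eq_dist ⟨0, h0⟩ (t * e)
  obtain ⟨a, ha⟩ : ∃ a : ℝ, q = a * e := ⟨_, hrep q hq⟩
  set s := a - t with hs
  have hnr : ∀ r : ℝ, ‖(r : ℂ) * e‖ = |r| := by
    intro r; rw [norm_mul, he, mul_one, Complex.norm_real, Real.norm_eq_abs]
  have hds : infDist (t * e) X = |s| := by
    rw [hd, ha, dist_comm, dist_eq_norm, ← sub_mul, ← Complex.ofReal_sub, hnr]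
  have hs0 : s ≠ 0 := by
    intro h0
    apply hp
    have : t = a := by linarith
    rw [this, ← ha]; exact hq
  have hspos : 0 < |s| := abs_pos.2 hs0
  have hsgn : ∀ u : ℝ, |u| < |s| → |s| ≤ |u + s| → 0 ≤ u * s := by
    intro u h1 h2
    have := sq_le_sq' (by linarith [abs_nonneg (u + s)]) h2
    rw [sq_abs, sq_abs] at this
    have h3 : u ^ 2 ≤ |u| * |s| := by rw [← sq_abs]; nlinarith [abs_nonneg u]
    rw [← abs_mul] at h3
    by_contra hlt
    push Not at hlt
    rw [abs_of_neg hlt] at h3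
    nlinarith
  set σ := s / |s| with hσ
  have hσs : s = σ * |s| := by rw [hσ]; field_simp
  have hσn : |σ| = 1 := by rw [hσ, abs_div, abs_abs, div_self hspos.ne']
  have hIe : ‖I * e‖ = 1 := by simp [he]
  have hcimu : ∀ u : ℝ, cim (σ * (I * e)) (u * e) = - (u * σ) := by
    intro u
    have := unit_sq e he
    simp [cim]
    linear_combination (-(u * σ)) * this
  have hyq : ∀ y ∈ X, ∃ u : ℝ, y = q + u * e ∧ ‖y - q‖ = |u| := by
    intro y hy
    refine ⟨cre e y - a, ?_, ?_⟩
    · conv_lhs => rw [hrep y hy]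
      rw [ha]; push_cast; ring
    · conv_lhs => rw [hrep y hy, ha]
      rw [← sub_mul, ← Complex.ofReal_sub, hnr]
  have key : ∀ y ∈ X, 2 * ‖y - q‖ < |s| → y = q := by
    intro y hy hys
    have := hS.posvanish h hω q (σ * (I * e)) hq
      (by rw [norm_mul, hIe, mul_one, Complex.norm_real, Real.norm_eq_abs, hσn]) |s| ?_ y hy hys
    · obtain ⟨u, hu, -⟩ := hyq y hy
      have e1 : q - y = ((-u : ℝ) : ℂ) * e := by rw [hu]; push_cast; ring
      rw [e1, hcimu] at this
      have hu0 : u = 0 := by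
        have hσ0 : σ ≠ 0 := by rintro h0; rw [h0] at hσn; simp at hσn
        have : u * σ = 0 := by linarith
        exact (mul_eq_zero.1 this).resolve_right hσ0
      rw [hu, hu0]; simp
    · intro z hz hzs
      obtain ⟨u, hu, hun⟩ := hyq z hz
      have e1 : q - z = ((-u : ℝ) : ℂ) * e := by rw [hu]; push_cast; ring
      rw [e1, hcimu]
      rw [hun] at hzs
      have h1 : |s| ≤ |u + s| := by
        rw [← hds]
        refine (infDist_le_dist_of_mem hz).trans ?_
        rw [dist_comm, dist_eq_norm, hu, ha]
        have : (a : ℂ) * e + u * e - t * e = ((u + s : ℝ) : ℂ) * e := by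
          rw [hs]; push_cast; ring
        rw [this, hnr]
      have h2 := hsgn u hzs h1
      rw [hσs] at h2
      have h3 : 0 ≤ u * σ := by
        by_contra hlt
        push Not at hlt
        nlinarith
      linarith
  obtain ⟨y, hy, hyne, hyl⟩ := hS.isolated q hq (|s| / 2) (by positivity)
  exact hyne (key y hy (by linarith))

end classif4

section pv

/-- Existence of principal values gives decay of smooth truncations. -/
lemma pv_smooth (Ω : ℂ → ℂ) (μ : Measure ℂ) [IsLocallyFiniteMeasure μ] (x z : ℂ)
    (hint : ∀ ε : ℝ, 0 < ε →
        IntegrableOn (fun y => Kmap Ω (x - y) / ((‖x - y‖ : ℂ)) ^ 2) (ball x ε)ᶜ μ)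
    (hlim : Tendsto
        (fun ε : ℝ => ∫ y in (ball x ε)ᶜ, Kmap Ω (x - y) / ((‖x - y‖ : ℂ)) ^ 2 ∂μ)
        (𝓝[>] (0 : ℝ)) (𝓝 z)) (K : ℝ) (hK1 : 1 ≤ K) :
    ∃ r0 : ℝ, 0 < r0 ∧ ∀ r : ℝ, 0 < r → r < r0 → ∀ ψ : ℝ → ℝ, TF ψ K⁻¹ K → (∀ ρ, |ψ ρ| ≤ K) →
      (∀ ρ, |deriv ψ ρ| ≤ K) →
      ‖∫ y, GK (fun w => Ω (w / (‖w‖ : ℂ))) ψ ((x - y) / r) ∂μ‖ ≤ r / K := by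
  have hK : 0 < K := by linarith
  set k : ℂ → ℂ := fun y => Kmap Ω (x - y) / ((‖x - y‖ : ℂ)) ^ 2 with hk
  set P := K + 2 * K * K with hP
  have hPp : 0 < P := by positivity
  set s := (P * (2 * K) * K)⁻¹ with hs
  have hsp : 0 < s := by positivity
  have h1 := (Metric.tendsto_nhds.1 hlim) s hsp
  rw [eventually_nhdsWithin_iff, Metric.eventually_nhds_iff] at h1
  obtain ⟨t0, ht0, h1⟩ := h1
  refine ⟨t0 / (2 * K), by positivity, ?_⟩
  intro r hr hrr ψ hψ hb hd
  rw [lt_div_iff₀ (by positivity)] at hrr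
  set a' := K⁻¹ * r / 2 with ha'
  set b' := 2 * K * r with hb'
  have ha'p : 0 < a' := by positivity
  set Φ : ℝ → ℝ := fun t => t * ψ (t / r) with hΦ
  set Φ' : ℝ → ℝ := fun t => ψ (t / r) + t / r * deriv ψ (t / r) with hΦ'
  have hder : ∀ t, HasDerivAt Φ (Φ' t) t := by
    intro t
    have e1 : HasDerivAt (fun t : ℝ => t / r) (1 / r) t := (hasDerivAt_id t).div_const r
    have e2 := (hψ.cd.differentiable one_ne_zero (t / r)).hasDerivAt.comp t e1
    have e3 := (hasDerivAt_id t).mul e2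
    have e4 : Φ' t = 1 * ψ (t / r) + t * (deriv ψ (t / r) * (1 / r)) := by
      simp only [hΦ']; ring
    rw [e4]; exact e3
  have hdc : Continuous (deriv ψ) := hψ.cd.continuous_deriv le_rfl
  have hψc : Continuous ψ := hψ.cd.continuous
  have hΦ'c : Continuous Φ' := by
    rw [hΦ']; fun_prop
  have hΦa : Φ a' = 0 := by
    have : ψ (a' / r) = 0 := by
      apply hψ.zero
      intro hmem
      have h2 : a' / r = K⁻¹ / 2 := by rw [ha']; field_simp
      rw [h2] at hmem
      have : 0 < K⁻¹ := by positivity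
      linarith [hmem.1]
    simp [hΦ, this]
  have hΦb : ∀ t, b' ≤ t → Φ t = 0 := by
    intro t ht
    have : ψ (t / r) = 0 := by
      apply hψ.zero
      intro hmem
      have := hmem.2
      rw [div_le_iff₀ hr] at this
      have : 0 < K * r := by positivity
      linarith
    simp [hΦ, this]
  have hI0 : ∀ u, a' ≤ u → ∫ t in Ioc a' u, Φ' t = Φ u := by
    intro u hu
    rw [← intervalIntegral.integral_of_le hu,
      intervalIntegral.integral_eq_sub_of_hasDerivAt (fun t _ => hder t)
        (hΦ'c.intervalIntegrable _ _), hΦa, sub_zero]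
  have hab : a' ≤ b' := by
    have h2 : K⁻¹ ≤ 1 := inv_le_one_of_one_le₀ hK1
    rw [ha', hb']
    nlinarith
  set A : Set ℂ := (ball x a')ᶜ with hA
  have hAm : MeasurableSet A := measurableSet_ball.compl
  have hAmem : ∀ y, y ∈ A ↔ a' ≤ ‖x - y‖ := by
    intro y
    rw [hA, mem_compl_iff, mem_ball, dist_comm, dist_eq_norm, not_lt]
  have hkA : Integrable k (μ.restrict A) := hint a' ha'p
  have hcut : ∀ y ∈ A, (∫ t in Ioc a' b', (if t ≤ ‖x - y‖ then Φ' t else 0)) = Φ ‖x - y‖ := by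
    intro y hy
    rw [hAmem] at hy
    have e1 : (fun t => if t ≤ ‖x - y‖ then Φ' t else 0) = (Iic ‖x - y‖).indicator Φ' := by
      ext t; simp [indicator]
    rw [e1, setIntegral_indicator measurableSet_Iic]
    have e2 : Ioc a' b' ∩ Iic ‖x - y‖ = Ioc a' (min b' ‖x - y‖) := by
      ext t; simp
    rw [e2, hI0 _ (le_min hab hy)]
    rcases le_total b' ‖x - y‖ with h2 | h2
    · rw [min_eq_left h2, hΦb _ le_rfl, hΦb _ h2]
    · rw [min_eq_right h2]
  have hGK : ∀ y ∈ A, GK (fun w => Ω (w / (‖w‖ : ℂ))) ψ ((x - y) / r) = (Φ ‖x - y‖ : ℂ) * k y := by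
    intro y hy
    rw [hAmem] at hy
    have hpos : 0 < ‖x - y‖ := by linarith
    have hn : ‖(x - y) / (r : ℂ)‖ = ‖x - y‖ / r := by
      rw [norm_div, Complex.norm_real, Real.norm_of_nonneg hr.le]
    have hrc : (r : ℂ) ≠ 0 := by rw [Complex.ofReal_ne_zero]; exact hr.ne'
    have hpc : (‖x - y‖ : ℂ) ≠ 0 := by rw [Complex.ofReal_ne_zero]; exact hpos.ne'
    have hu : (x - y) / (r : ℂ) / ((‖x - y‖ / r : ℝ) : ℂ) = (x - y) / (‖x - y‖ : ℂ) := by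
      push_cast; field_simp
    simp only [GK, hn, hu, hΦ, hk, Kmap]
    push_cast
    field_simp
  have hGK0 : ∀ y, y ∉ A → GK (fun w => Ω (w / (‖w‖ : ℂ))) ψ ((x - y) / r) = 0 := by
    intro y hy
    rw [hAmem, not_le] at hy
    have hn : ‖(x - y) / (r : ℂ)‖ = ‖x - y‖ / r := by
      rw [norm_div, Complex.norm_real, Real.norm_of_nonneg hr.le]
    have : ψ (‖x - y‖ / r) = 0 := by
      apply hψ.zero
      intro hmem
      have h2 := hmem.1
      rw [le_div_iff₀ hr] at h2
      have : 0 < K⁻¹ * r := by positivity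
      linarith
    simp only [GK, hn, this, Complex.ofReal_zero, zero_mul]
  set f : ℂ → ℝ → ℂ := fun y t => (if t ≤ ‖x - y‖ then Φ' t else 0 : ℝ) • k y with hf
  have hΦ'b : ∀ t ∈ Ioc a' b', |Φ' t| ≤ P := by
    intro t ht
    have htr : |t / r| ≤ 2 * K := by
      rw [abs_of_nonneg (div_nonneg (by linarith [ht.1]) hr.le), div_le_iff₀ hr]
      exact ht.2
    calc |Φ' t| ≤ |ψ (t / r)| + |t / r * deriv ψ (t / r)| := abs_add_le _ _
      _ ≤ K + 2 * K * K := by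
        rw [abs_mul]
        gcongr
        · exact hb _
        · exact hd _
  have hF : Integrable (Function.uncurry f) ((μ.restrict A).prod (volume.restrict (Ioc a' b'))) := by
    have i1 : Integrable Φ' (volume.restrict (Ioc a' b')) :=
      (hΦ'c.integrableOn_Icc (a := a') (b := b')).mono_set Ioc_subset_Icc_self
    have i2 := hkA.mul_prod (L := ℂ) i1.ofReal
    have hms : MeasurableSet {p : ℂ × ℝ | p.2 ≤ ‖x - p.1‖} :=
      (isClosed_le continuous_snd (by fun_prop)).measurableSet
    refine (i2.indicator hms).congr (Eventually.of_forall fun p => ?_)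
    simp only [Function.uncurry, hf, indicator, mem_ofPred_eq]
    split_ifs
    · rw [Complex.real_smul, mul_comm]; rfl
    · simp
  have hinner : EqOn (fun t => ∫ y in A, f y t ∂μ)
      (fun t => Φ' t • (∫ y in (ball x t)ᶜ, k y ∂μ)) (Ioc a' b') := by
    intro t ht
    have e1 : ∀ y, f y t = (ball x t)ᶜ.indicator (fun y => Φ' t • k y) y := by
      intro y
      simp only [hf, indicator, mem_compl_iff, mem_ball, dist_comm y x, dist_eq_norm, not_lt]
      split_ifs <;> simp
    simp only [e1]
    rw [setIntegral_indicator measurableSet_ball.compl, integral_smul]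
    congr 3
    rw [hA, ← compl_union, union_eq_self_of_subset_left (ball_subset_ball ht.1.le)]
  have hmain : ∫ y, GK (fun w => Ω (w / (‖w‖ : ℂ))) ψ ((x - y) / r) ∂μ =
      ∫ t in Ioc a' b', Φ' t • ((∫ y in (ball x t)ᶜ, k y ∂μ) - z) := by
    calc ∫ y, GK (fun w => Ω (w / (‖w‖ : ℂ))) ψ ((x - y) / r) ∂μ
        = ∫ y in A, GK (fun w => Ω (w / (‖w‖ : ℂ))) ψ ((x - y) / r) ∂μ :=
          (setIntegral_eq_integral_of_forall_compl_eq_zero hGK0).symm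
      _ = ∫ y in A, (∫ t in Ioc a' b', f y t) ∂μ := by
          refine setIntegral_congr_fun hAm fun y hy => ?_
          simp only [hf]
          rw [integral_smul_const, hcut y hy, hGK y hy, Complex.real_smul]
      _ = ∫ t in Ioc a' b', ∫ y in A, f y t ∂μ := integral_integral_swap hF
      _ = ∫ t in Ioc a' b', Φ' t • (∫ y in (ball x t)ᶜ, k y ∂μ) :=
          setIntegral_congr_fun measurableSet_Ioc hinner
      _ = _ := by
          simp_rw [smul_sub]
          rw [integral_sub, integral_smul_const, hI0 b' hab, hΦb b' le_rfl, zero_smul, sub_zero]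
          · refine (hF.integral_prod_right).congr ?_
            filter_upwards [ae_restrict_mem measurableSet_Ioc] with t ht
            exact hinner ht
          · exact Integrable.smul_const
              ((hΦ'c.integrableOn_Icc (a := a') (b := b')).mono_set Ioc_subset_Icc_self) z
  rw [hmain]
  have hbd : ∀ t ∈ Ioc a' b', ‖Φ' t • ((∫ y in (ball x t)ᶜ, k y ∂μ) - z)‖ ≤ P * s := by
    intro t ht
    have htp : 0 < t := by linarith [ht.1]
    have := h1 (y := t) (by rw [dist_zero_right, Real.norm_of_nonneg htp.le]; linarith [ht.2]) htp
    rw [dist_eq_norm] at this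
    rw [norm_smul, Real.norm_eq_abs]
    exact mul_le_mul (hΦ'b t ht) this.le (norm_nonneg _) hPp.le
  have := norm_setIntegral_le_of_norm_le_const (μ := volume) (s := Ioc a' b') (by simp) hbd
  refine this.trans ?_
  rw [measureReal_def, Real.volume_Ioc, ENNReal.toReal_ofReal (by linarith)]
  calc P * s * (b' - a') ≤ P * s * b' := by gcongr; linarith
    _ = r / K := by rw [hs, hb']; field_simp

end pv

section egorov

lemma isClosed_ball_le (μ : Measure ℂ) (r : ℝ) (m : ℝ≥0∞) : IsClosed {x : ℂ | μ (ball x r) ≤ m} := by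
  rw [← isOpen_compl_iff, Metric.isOpen_iff]
  intro x hx
  simp only [mem_compl_iff, mem_ofPred_eq, not_le] at hx
  have hU : ball x r = ⋃ n : ℕ, ball x (r - 1 / ((n : ℝ) + 1)) := by
    ext y
    simp only [mem_ball, mem_iUnion]
    constructor
    · intro hy
      obtain ⟨n, hn⟩ := exists_nat_one_div_lt (sub_pos.2 hy)
      exact ⟨n, by linarith⟩
    · rintro ⟨n, hn⟩
      have : 0 < 1 / ((n : ℝ) + 1) := by positivity
      linarith
  have hmono : Monotone fun n : ℕ => ball x (r - 1 / ((n : ℝ) + 1)) := by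
    intro a b hab
    apply ball_subset_ball
    have : (a : ℝ) ≤ b := by exact_mod_cast hab
    gcongr
  rw [hU, hmono.measure_iUnion, lt_iSup_iff] at hx
  obtain ⟨n, hn⟩ := hx
  refine ⟨1 / ((n : ℝ) + 1), by positivity, fun y hy => ?_⟩
  simp only [mem_compl_iff, mem_ofPred_eq, not_le]
  refine hn.trans_le (measure_mono ?_)
  apply ball_subset_ball'
  rw [mem_ball, dist_comm] at hy
  linarith

lemma isClosed_le_closedBall (μ : Measure ℂ) [IsLocallyFiniteMeasure μ] (r : ℝ) (m : ℝ≥0∞) :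
    IsClosed {x : ℂ | m ≤ μ (closedBall x r)} := by
  rw [← isOpen_compl_iff, Metric.isOpen_iff]
  intro x hx
  simp only [mem_compl_iff, mem_ofPred_eq, not_le] at hx
  have hU : closedBall x r = ⋂ n : ℕ, closedBall x (r + 1 / ((n : ℝ) + 1)) := by
    ext y
    simp only [mem_closedBall, mem_iInter]
    constructor
    · intro hy n
      have : 0 < 1 / ((n : ℝ) + 1) := by positivity
      linarith
    · intro hy
      by_contra hcon
      push Not at hcon
      obtain ⟨n, hn⟩ := exists_nat_one_div_lt (sub_pos.2 hcon)
      linarith [hy n]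
  have hanti : Antitone fun n : ℕ => closedBall x (r + 1 / ((n : ℝ) + 1)) := by
    intro a b hab
    apply closedBall_subset_closedBall
    have : (a : ℝ) ≤ b := by exact_mod_cast hab
    gcongr
  rw [hU, hanti.measure_iInter (fun n => measurableSet_closedBall.nullMeasurableSet)
    ⟨0, measure_closedBall_lt_top.ne⟩, iInf_lt_iff] at hx
  obtain ⟨n, hn⟩ := hx
  refine ⟨1 / ((n : ℝ) + 1), by positivity, fun y hy => ?_⟩
  simp only [mem_compl_iff, mem_ofPred_eq, not_le]
  refine (measure_mono ?_).trans_lt hn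
  apply closedBall_subset_closedBall'
  rw [mem_ball] at hy
  linarith

lemma continuous_conv (μ : Measure ℂ) [IsLocallyFiniteMeasure μ] {g : ℂ → ℂ} (hg : Continuous g)
    (b : ℝ) (hz : ∀ w, w ∉ closedBall (0 : ℂ) b → g w = 0) :
    Continuous fun x => ∫ y, g (x - y) ∂μ := by
  rw [continuous_iff_continuousAt]
  intro x0
  have := continuousOn_integral_of_compact_support (μ := μ) (f := fun x y => g (x - y))
    (s := ball x0 1) (isCompact_closedBall x0 (b + 1))
    (by
      apply Continuous.continuousOn
      exact hg.comp (continuous_fst.sub continuous_snd)) ?_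
  · exact this.continuousAt (ball_mem_nhds _ one_pos)
  · intro x y hx hy
    apply hz
    intro hcon
    apply hy
    rw [mem_closedBall, dist_zero_right, ← dist_eq_norm] at hcon
    rw [mem_ball] at hx
    rw [mem_closedBall]
    have := dist_triangle y x x0
    rw [dist_comm y x] at this
    linarith

lemma exists_compact_pos (μ : Measure ℂ) [IsLocallyFiniteMeasure μ] (S : Set ℂ)
    (hS : MeasurableSet S) (hpos : 0 < μ S) : ∃ K ⊆ S, IsCompact K ∧ 0 < μ K :=
  hS.exists_lt_isCompact hpos

/-- Egorov type selection. -/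
lemma egorov_closed (μ : Measure ℂ) [IsLocallyFiniteMeasure μ] (S : Set ℂ) (hS : MeasurableSet S)
    (hpos : 0 < μ S) (P : ℕ → ℕ → Set ℂ) (hcl : ∀ k j, IsClosed (P k j)) (hmono : ∀ k, Monotone (P k))
    (hae : ∀ᵐ x ∂μ, x ∈ S → ∀ k, ∃ j, x ∈ P k j) :
    ∃ E ⊆ S, IsCompact E ∧ 0 < μ E ∧ ∃ j : ℕ → ℕ, ∀ k, E ⊆ P k (j k) := by
  obtain ⟨S0, hS0, hc, hp⟩ := exists_compact_pos μ S hS hpos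
  obtain ⟨ε, hε, hsum⟩ := ENNReal.exists_pos_sum_of_countable hp.ne' ℕ
  have hk : ∀ k, ∃ j, μ (S0 \ P k j) ≤ ε k := by
    intro k
    have hanti : Antitone fun j => S0 \ P k j := fun a b hab => sdiff_subset_sdiff_right (hmono k hab)
    have h1 := tendsto_measure_iInter_atTop (μ := μ)
      (fun j => (hc.measurableSet.diff (hcl k j).measurableSet).nullMeasurableSet) hanti
      ⟨0, ((measure_mono sdiff_subset).trans_lt hc.measure_lt_top).ne⟩
    have h2 : μ (⋂ j, S0 \ P k j) = 0 := by
      refine measure_mono_null ?_ hae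
      intro x hx
      rw [mem_iInter] at hx
      simp only [mem_compl_iff, mem_ofPred_eq]
      intro hcon
      obtain ⟨j, hj⟩ := hcon (hS0 (hx 0).1) k
      exact (hx j).2 hj
    rw [h2] at h1
    have h3 : (0 : ℝ≥0∞) < ε k := by exact_mod_cast hε k
    obtain ⟨j, hj⟩ := (h1.eventually (gt_mem_nhds h3)).exists
    exact ⟨j, hj.le⟩
  choose j hj using hk
  refine ⟨S0 ∩ ⋂ k, P k (j k), inter_subset_left.trans hS0,
    hc.inter_right (isClosed_iInter fun k => hcl k _), ?_, j, ?_⟩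
  · by_contra hcon
    have h0 : μ (S0 ∩ ⋂ k, P k (j k)) = 0 := by simpa using hcon
    have hsub : S0 ⊆ (S0 ∩ ⋂ k, P k (j k)) ∪ ⋃ k, (S0 \ P k (j k)) := by
      intro x hx
      by_cases hx2 : x ∈ ⋂ k, P k (j k)
      · exact Or.inl ⟨hx, hx2⟩
      · right
        simp only [mem_iInter, not_forall] at hx2
        obtain ⟨k, hk⟩ := hx2
        exact mem_iUnion.2 ⟨k, hx, hk⟩
    have := (measure_mono (μ := μ) hsub).trans (measure_union_le _ _)
    rw [h0, zero_add] at this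
    have h4 := (this.trans (measure_iUnion_le _)).trans (ENNReal.tsum_le_tsum hj)
    exact absurd hsum (not_lt.2 h4)
  · intro k x hx
    exact mem_iInter.1 hx.2 k

/-- Uniformly good sets. -/
structure Good (U : ℂ → ℂ) (μ : Measure ℂ) (E1 : Set ℂ) (C r0 : ℝ) : Prop where
  cpt : IsCompact E1
  C1 : 1 ≤ C
  r0p : 0 < r0
  upper : ∀ x ∈ E1, ∀ r, 0 < r → r < r0 → μ (closedBall x r) ≤ ENNReal.ofReal (C * r)
  lower : ∀ x ∈ E1, ∀ r, 0 < r → r < r0 → ENNReal.ofReal (r / C) ≤ μ (closedBall x r)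
  pv : ∀ K : ℕ, 1 ≤ K → ∃ r1 : ℝ, 0 < r1 ∧ ∀ x ∈ E1, ∀ r : ℝ, 0 < r → r < r1 → ∀ ψ : ℝ → ℝ,
    TF ψ (K : ℝ)⁻¹ K → (∀ ρ, |ψ ρ| ≤ K) → (∀ ρ, |deriv ψ ρ| ≤ K) →
      ‖∫ y, GK U ψ ((x - y) / r) ∂μ‖ ≤ r / K

/-- Uniform density points. -/
def UDens (μ : Measure ℂ) (E1 E2 : Set ℂ) : Prop :=
  ∀ η : ℝ, 0 < η → ∃ r1 : ℝ, 0 < r1 ∧ ∀ x ∈ E2, ∀ r, 0 < r → r < r1 →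
    μ (closedBall x r \ E1) ≤ ENNReal.ofReal (η * r)

lemma exists_good {U : ℂ → ℂ} {ω : ℝ → ℝ} {c : ℝ} (h : UOK U ω) (hω : LiftOK ω c)
    (μ : Measure ℂ) [IsLocallyFiniteMeasure μ]
    (hdens : ∀ᵐ x ∂μ,
      0 < Filter.liminf (fun r : ℝ => μ (ball x r) / ENNReal.ofReal r) (𝓝[>] (0 : ℝ)) ∧
      Filter.limsup (fun r : ℝ => μ (ball x r) / ENNReal.ofReal r) (𝓝[>] (0 : ℝ)) < ⊤)
    (hpv : ∀ᵐ x ∂μ, ∀ K : ℝ, 1 ≤ K → ∃ r1 : ℝ, 0 < r1 ∧ ∀ r : ℝ, 0 < r → r < r1 → ∀ ψ : ℝ → ℝ,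
      TF ψ K⁻¹ K → (∀ ρ, |ψ ρ| ≤ K) → (∀ ρ, |deriv ψ ρ| ≤ K) →
      ‖∫ y, GK U ψ ((x - y) / r) ∂μ‖ ≤ r / K)
    (S : Set ℂ) (hS : MeasurableSet S) (hpos : 0 < μ S) :
    ∃ E1 ⊆ S, ∃ C r0, 0 < μ E1 ∧ Good U μ E1 C r0 := by
  set Q : ℕ → Set ℂ := fun j => {x | ∀ r : ℝ, 0 < r → r < 1 / ((j : ℝ) + 1) →
    μ (ball x r) ≤ ENNReal.ofReal (((j : ℝ) + 1) * r) ∧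
    ENNReal.ofReal (r / ((j : ℝ) + 1)) ≤ μ (closedBall x r)} with hQ
  set V : ℕ → ℕ → Set ℂ := fun k j => {x | ∀ r : ℝ, 0 < r → r < 1 / ((j : ℝ) + 1) → ∀ ψ : ℝ → ℝ,
      TF ψ ((k : ℝ) + 1)⁻¹ ((k : ℝ) + 1) → (∀ ρ, |ψ ρ| ≤ (k : ℝ) + 1) →
      (∀ ρ, |deriv ψ ρ| ≤ (k : ℝ) + 1) →
      ‖∫ y, GK U ψ ((x - y) / r) ∂μ‖ ≤ r / ((k : ℝ) + 1)} with hV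
  have hQcl : ∀ j, IsClosed (Q j) := by
    intro j
    simp only [hQ, ofPred_forall, ofPred_and]
    refine isClosed_iInter fun r => isClosed_iInter fun h1 => isClosed_iInter fun h2 => ?_
    exact (isClosed_ball_le μ r _).inter (isClosed_le_closedBall μ r _)
  have hVcl : ∀ k j, IsClosed (V k j) := by
    intro k j
    simp only [hV, ofPred_forall]
    refine isClosed_iInter fun r => isClosed_iInter fun h1 => isClosed_iInter fun h2 =>
      isClosed_iInter fun ψ => isClosed_iInter fun hψ => isClosed_iInter fun _ =>
      isClosed_iInter fun _ => ?_
    refine isClosed_le (Continuous.norm ?_) continuous_const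
    refine continuous_conv μ (g := fun w => GK U ψ (w / r)) ?_ (r * ((k : ℝ) + 1)) ?_
    · exact (GK_contDiff h hω hψ).continuous.comp (by fun_prop)
    · intro w hw
      apply GK_zero hψ
      rw [mem_closedBall, dist_zero_right] at hw ⊢
      rw [norm_div, Complex.norm_real, Real.norm_of_nonneg h1.le, div_le_iff₀ h1, mul_comm]
      exact hw
  have hinv : ∀ a b : ℕ, a ≤ b → 1 / ((b : ℝ) + 1) ≤ 1 / ((a : ℝ) + 1) := by
    intro a b hab
    have : (a : ℝ) ≤ b := by exact_mod_cast hab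
    gcongr
  have hPcl : ∀ k j, IsClosed ((fun k => Nat.casesOn k Q V : ℕ → ℕ → Set ℂ) k j) := by
    rintro (_ | k) j
    · exact hQcl j
    · exact hVcl k j
  have hPm : ∀ k, Monotone ((fun k => Nat.casesOn k Q V : ℕ → ℕ → Set ℂ) k) := by
    rintro (_ | k) a b hab x hx r hr hrb
    · have hx' : x ∈ Q a := hx
      have h1 := hx' r hr (hrb.trans_le (hinv a b hab))
      have : (a : ℝ) ≤ b := by exact_mod_cast hab
      refine ⟨h1.1.trans (ENNReal.ofReal_le_ofReal (by gcongr)),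
        le_trans (ENNReal.ofReal_le_ofReal (by gcongr)) h1.2⟩
    · have hx' : x ∈ V k a := hx
      exact hx' r hr (hrb.trans_le (hinv a b hab))
  have hPae : ∀ᵐ x ∂μ, x ∈ S → ∀ k, ∃ j, x ∈ (fun k => Nat.casesOn k Q V : ℕ → ℕ → Set ℂ) k j := by
    filter_upwards [hdens, hpv] with x hx1 hx2 _ k
    rcases k with _ | k
    · obtain ⟨m, hm0, hm⟩ := exists_between hx1.1
      obtain ⟨M, hM0, hM⟩ := exists_between hx1.2
      have e1 := eventually_lt_of_lt_liminf hm
      have e2 := eventually_lt_of_limsup_lt hM0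
      have e3 := e1.and e2
      rw [eventually_nhdsWithin_iff, Metric.eventually_nhds_iff] at e3
      obtain ⟨t, ht, e3⟩ := e3
      obtain ⟨n1, hn1⟩ := exists_nat_one_div_lt ht
      obtain ⟨n2, hn2⟩ := ENNReal.exists_nat_gt hM.ne
      obtain ⟨n3, hn3⟩ := ENNReal.exists_inv_nat_lt hm0.ne'
      set n := max n1 (max n2 n3) with hn
      refine ⟨n, fun r hr hrn => ?_⟩
      have hrt : r < t := (hrn.trans_le (hinv n1 n (le_max_left _ _))).trans hn1
      obtain ⟨f1, f2⟩ := e3 (y := r) (by rwa [dist_zero_right, Real.norm_of_nonneg hr.le]) hr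
      have hr0 : ENNReal.ofReal r ≠ 0 := by simpa using hr
      have hcast : ENNReal.ofReal ((n : ℝ) + 1) = (n : ℝ≥0∞) + 1 := by
        rw [ENNReal.ofReal_add (by positivity) (by norm_num)]; simp
      have hn2' : (n2 : ℝ≥0∞) ≤ n := by exact_mod_cast (le_max_left _ _).trans (le_max_right _ _)
      have hn3' : (n3 : ℝ≥0∞) ≤ n := by exact_mod_cast (le_max_right _ _).trans (le_max_right _ _)
      constructor
      · rw [ENNReal.ofReal_mul (by positivity), hcast]
        rw [← ENNReal.div_le_iff hr0 ENNReal.ofReal_ne_top]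
        exact f2.le.trans (hn2.le.trans (hn2'.trans le_self_add))
      · refine le_trans ?_ (measure_mono ball_subset_closedBall)
        rw [div_eq_inv_mul, ENNReal.ofReal_mul (by positivity),
          ENNReal.ofReal_inv_of_pos (by positivity), hcast]
        rw [← ENNReal.le_div_iff_mul_le (Or.inl hr0) (Or.inl ENNReal.ofReal_ne_top)]
        refine le_trans ?_ (hn3.le.trans f1.le)
        exact ENNReal.inv_le_inv.2 (hn3'.trans le_self_add)
    · obtain ⟨r1, hr1, h1⟩ := hx2 ((k : ℝ) + 1) (by linarith [(Nat.cast_nonneg k : (0 : ℝ) ≤ k)])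
      obtain ⟨n, hn⟩ := exists_nat_one_div_lt hr1
      exact ⟨n, fun r hr hrn => h1 r hr (hrn.trans hn)⟩
  obtain ⟨E, hES, hEc, hEp, j, hj⟩ := egorov_closed μ S hS hpos _ hPcl hPm hPae
  have h0 : ∀ x ∈ E, x ∈ Q (j 0) := fun x hx => hj 0 hx
  have hj0 : (0 : ℝ) ≤ j 0 := Nat.cast_nonneg _
  have hC : (1 : ℝ) ≤ 2 * ((j 0 : ℝ) + 1) := by linarith
  have hp1 : 0 < 1 / ((j 0 : ℝ) + 1) := by positivity
  refine ⟨E, hES, 2 * ((j 0 : ℝ) + 1), 1 / ((j 0 : ℝ) + 1) / 2, hEp, hEc, hC, by positivity, ?_, ?_, ?_⟩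
  · intro x hx r hr hrr
    have := (h0 x hx (2 * r) (by linarith) (by linarith)).1
    refine (measure_mono (closedBall_subset_ball (by linarith))).trans (this.trans ?_)
    apply ENNReal.ofReal_le_ofReal; linarith
  · intro x hx r hr hrr
    have := (h0 x hx r (by linarith) (by linarith)).2
    refine le_trans ?_ this
    apply ENNReal.ofReal_le_ofReal
    gcongr; linarith
  · intro K hK
    obtain ⟨k, rfl⟩ : ∃ k, K = k + 1 := ⟨K - 1, by omega⟩
    refine ⟨1 / ((j (k + 1) : ℝ) + 1), by positivity, fun x hx r hr hrr ψ h1 h2 h3 => ?_⟩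
    have : x ∈ V k (j (k + 1)) := hj (k + 1) hx
    push_cast at h1 h2 h3 ⊢
    exact this r hr hrr ψ h1 h2 h3

lemma exists_udens (μ : Measure ℂ) [IsLocallyFiniteMeasure μ] (E1 S : Set ℂ) (hE1 : IsCompact E1)
    (hS : MeasurableSet S) (hSE : S ⊆ E1) (hpos : 0 < μ S) (C r0 : ℝ) (hr0 : 0 < r0)
    (hC : 0 < C)
    (hup : ∀ x ∈ E1, ∀ r, 0 < r → r < r0 → μ (closedBall x r) ≤ ENNReal.ofReal (C * r)) :
    ∃ E2 ⊆ S, IsCompact E2 ∧ 0 < μ E2 ∧ UDens μ E1 E2 := by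
  set P : ℕ → ℕ → Set ℂ := fun k j => {x | ∀ r : ℝ, 0 < r → r < 1 / ((j : ℝ) + 1) →
    μ.restrict E1ᶜ (ball x r) ≤ ENNReal.ofReal (r / ((k : ℝ) + 1))} with hP
  have hinv : ∀ a b : ℕ, a ≤ b → 1 / ((b : ℝ) + 1) ≤ 1 / ((a : ℝ) + 1) := by
    intro a b hab
    have : (a : ℝ) ≤ b := by exact_mod_cast hab
    gcongr
  have hcl : ∀ k j, IsClosed (P k j) := by
    intro k j
    simp only [hP, ofPred_forall]
    exact isClosed_iInter fun r => isClosed_iInter fun h1 => isClosed_iInter fun h2 =>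
      isClosed_ball_le _ r _
  have hm : ∀ k, Monotone (P k) := fun k a b hab x hx r hr hrb =>
    hx r hr (hrb.trans_le (hinv a b hab))
  have hae : ∀ᵐ x ∂μ, x ∈ S → ∀ k, ∃ j, x ∈ P k j := by
    have hd := Besicovitch.ae_tendsto_measure_inter_div μ E1
    rw [ae_restrict_iff' hE1.measurableSet] at hd
    filter_upwards [hd] with x hx hxS k
    have hxE := hSE hxS
    have h1 := hx hxE
    set η : ℝ := (((k : ℝ) + 1) * C)⁻¹ with hη
    have hηp : 0 < η := by positivity
    have h2 : ∀ᶠ r in 𝓝[>] (0 : ℝ), 1 - ENNReal.ofReal η < μ (E1 ∩ closedBall x r) / μ (closedBall x r) := by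
      refine h1.eventually (lt_mem_nhds ?_)
      exact ENNReal.sub_lt_self (by simp) (by simp) (by simpa using hηp)
    rw [eventually_nhdsWithin_iff, Metric.eventually_nhds_iff] at h2
    obtain ⟨t, ht, h2⟩ := h2
    obtain ⟨n, hn⟩ := exists_nat_one_div_lt (lt_min ht hr0)
    refine ⟨n, fun r hr hrn => ?_⟩
    have h3 := h2 (y := r) (by
      rw [dist_zero_right, Real.norm_of_nonneg hr.le]
      exact (hrn.trans hn).trans_le (min_le_left _ _)) hr
    have hub := hup x hxE r hr ((hrn.trans hn).trans_le (min_le_right _ _))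
    have hfin : μ (closedBall x r) ≠ ⊤ := measure_closedBall_lt_top.ne
    calc μ.restrict E1ᶜ (ball x r) ≤ μ.restrict E1ᶜ (closedBall x r) :=
          measure_mono ball_subset_closedBall
      _ = μ (closedBall x r \ E1) := by
          rw [Measure.restrict_apply measurableSet_closedBall, sdiff_eq]
      _ ≤ ENNReal.ofReal η * μ (closedBall x r) := by
          have h4 : (1 - ENNReal.ofReal η) * μ (closedBall x r) ≤ μ (E1 ∩ closedBall x r) :=
            ENNReal.mul_le_of_le_div h3.le
          have h5 := measure_inter_add_sdiff (μ := μ) (closedBall x r) hE1.measurableSet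
          rw [inter_comm] at h5
          have hfin2 : μ (E1 ∩ closedBall x r) ≠ ⊤ :=
            ((measure_mono inter_subset_right).trans_lt measure_closedBall_lt_top).ne
          refine (ENNReal.add_le_add_iff_left hfin2).1 ?_
          rw [h5]
          calc μ (closedBall x r) = 1 * μ (closedBall x r) := (one_mul _).symm
            _ ≤ ((1 - ENNReal.ofReal η) + ENNReal.ofReal η) * μ (closedBall x r) := by
                gcongr; exact le_tsub_add
            _ = (1 - ENNReal.ofReal η) * μ (closedBall x r) + ENNReal.ofReal η * μ (closedBall x r) :=
                add_mul _ _ _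
            _ ≤ _ := by gcongr
      _ ≤ ENNReal.ofReal η * ENNReal.ofReal (C * r) := by gcongr
      _ = ENNReal.ofReal (r / ((k : ℝ) + 1)) := by
          rw [← ENNReal.ofReal_mul hηp.le]
          congr 1
          rw [hη]; field_simp
  obtain ⟨E, hES, hEc, hEp, j, hj⟩ := egorov_closed μ S hS hpos P hcl hm hae
  refine ⟨E, hES, hEc, hEp, fun η hη => ?_⟩
  obtain ⟨k, hk⟩ := exists_nat_one_div_lt (half_pos hη)
  refine ⟨1 / ((j k : ℝ) + 1) / 2, by positivity, fun x hx r hr hrr => ?_⟩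
  have h1 := hj k hx (2 * r) (by linarith) (by linarith)
  calc μ (closedBall x r \ E1) ≤ μ.restrict E1ᶜ (ball x (2 * r)) := by
        rw [Measure.restrict_apply measurableSet_ball, sdiff_eq]
        gcongr
        exact closedBall_subset_ball (by linarith)
    _ ≤ _ := h1
    _ ≤ _ := by
        apply ENNReal.ofReal_le_ofReal
        have : 2 * r / ((k : ℝ) + 1) = 2 * r * (1 / ((k : ℝ) + 1)) := by ring
        rw [this]
        nlinarith

end egorov


/-! ### Blow-up limits along an ultrafilter -/

lemma exists_ultra_limit (𝒰 : Ultrafilter ℕ) (m : ℕ → Measure ℂ)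
    [∀ i, IsLocallyFiniteMeasure (m i)]
    (hb : ∀ R : ℝ, ∃ B : ℝ, ∀ᶠ i in (𝒰 : Filter ℕ), m i (closedBall 0 R) ≤ ENNReal.ofReal B) :
    ∃ ν : Measure ℂ, IsLocallyFiniteMeasure ν ∧ ∀ f : ℂ → ℝ, Continuous f → HasCompactSupport f →
      Tendsto (fun i => ∫ y, f y ∂(m i)) 𝒰 (𝓝 (∫ y, f y ∂ν)) := by
  have hint : ∀ (f : CompactlySupportedContinuousMap ℂ ℝ) i, Integrable f (m i) := fun f i =>
    f.continuous.integrable_of_hasCompactSupport f.hasCompactSupport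
  have key : ∀ f : CompactlySupportedContinuousMap ℂ ℝ, ∃ L : ℝ,
      Tendsto (fun i => ∫ y, f y ∂(m i)) 𝒰 (𝓝 L) := by
    intro f
    obtain ⟨R, hR⟩ := f.hasCompactSupport.isBounded.subset_closedBall (0 : ℂ)
    obtain ⟨M, hM⟩ := f.continuous.bounded_above_of_compact_support f.hasCompactSupport
    obtain ⟨B, hB⟩ := hb R
    have hM0 : 0 ≤ M := (norm_nonneg _).trans (hM 0)
    have hbd : ∀ᶠ i in (𝒰 : Filter ℕ), (∫ y, f y ∂(m i)) ∈ Icc (-(M * max B 0)) (M * max B 0) := by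
      filter_upwards [hB] with i hi
      rw [mem_Icc, ← abs_le, ← Real.norm_eq_abs]
      have h1 : ∫ y, f y ∂(m i) = ∫ y in closedBall 0 R, f y ∂(m i) := by
        rw [setIntegral_eq_integral_of_forall_compl_eq_zero]
        intro y hy
        exact image_eq_zero_of_notMem_tsupport (fun h => hy (hR h))
      have hfin : m i (closedBall 0 R) < ⊤ := hi.trans_lt ENNReal.ofReal_lt_top
      rw [h1]
      refine (norm_setIntegral_le_of_norm_le_const hfin (fun y _ => hM y)).trans ?_
      refine mul_le_mul_of_nonneg_left ?_ hM0
      have := ENNReal.toReal_mono ENNReal.ofReal_ne_top hi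
      rw [ENNReal.toReal_ofReal'] at this
      exact this
    obtain ⟨L, -, hL⟩ := (isCompact_Icc (a := -(M * max B 0)) (b := M * max B 0)).ultrafilter_le_nhds
      (𝒰.map fun i => ∫ y, f y ∂(m i)) (by rw [le_principal_iff]; exact hbd)
    exact ⟨L, hL⟩
  choose L hL using key
  let Λ : CompactlySupportedContinuousMap ℂ ℝ →ₚ[ℝ] ℝ := PositiveLinearMap.mk₀
    { toFun := L
      map_add' := by
        intro f g
        refine tendsto_nhds_unique (hL (f + g)) ?_
        refine ((hL f).add (hL g)).congr fun i => ?_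
        rw [← integral_add (hint f i) (hint g i)]
        rfl
      map_smul' := by
        intro c f
        refine tendsto_nhds_unique (hL (c • f)) ?_
        refine ((hL f).const_mul c).congr fun i => ?_
        rw [← integral_const_mul]
        rfl }
    (by
      intro f hf
      refine ge_of_tendsto (hL f) (Eventually.of_forall fun i => ?_)
      exact integral_nonneg hf)
  refine ⟨RealRMK.rieszMeasure Λ, inferInstance, fun f hf hc => ?_⟩
  let F : CompactlySupportedContinuousMap ℂ ℝ := ⟨⟨f, hf⟩, hc⟩
  have := hL F
  have h2 := RealRMK.integral_rieszMeasure Λ F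
  have h3 : ∫ y, f y ∂(RealRMK.rieszMeasure Λ) = L F := h2
  rw [h3]
  exact this

/-- A tent function. -/
def tent (z : ℂ) (a b : ℝ) (y : ℂ) : ℝ := max 0 (min 1 ((b - ‖y - z‖) / (b - a)))

lemma tent_cont (z : ℂ) (a b : ℝ) : Continuous (tent z a b) := by
  unfold tent; fun_prop

lemma tent_nonneg (z : ℂ) (a b : ℝ) (y : ℂ) : 0 ≤ tent z a b y := le_max_left _ _

lemma tent_le_one (z : ℂ) (a b : ℝ) (y : ℂ) : tent z a b y ≤ 1 :=
  max_le zero_le_one (min_le_left _ _)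

lemma tent_eq_one {z : ℂ} {a b : ℝ} (hab : a < b) {y : ℂ} (hy : y ∈ closedBall z a) :
    tent z a b y = 1 := by
  rw [mem_closedBall_iff_norm] at hy
  have : 1 ≤ (b - ‖y - z‖) / (b - a) := by
    rw [le_div_iff₀ (by linarith)]; linarith
  rw [tent, min_eq_left this]; simp

lemma tent_eq_zero {z : ℂ} {a b : ℝ} (hab : a < b) {y : ℂ} (hy : y ∉ closedBall z b) :
    tent z a b y = 0 := by
  rw [mem_closedBall_iff_norm, not_le] at hy
  have : (b - ‖y - z‖) / (b - a) ≤ 0 := 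
    div_nonpos_of_nonpos_of_nonneg (by linarith) (by linarith)
  rw [tent, max_eq_left]
  exact (min_le_right _ _).trans this

lemma tent_compact {z : ℂ} {a b : ℝ} (hab : a < b) : HasCompactSupport (tent z a b) :=
  HasCompactSupport.intro (isCompact_closedBall z b) (fun _ hy => tent_eq_zero hab hy)

lemma le_tent_integral (m : Measure ℂ) [IsLocallyFiniteMeasure m] {z : ℂ} {a b : ℝ} (hab : a < b) :
    m (closedBall z a) ≤ ENNReal.ofReal (∫ y, tent z a b y ∂m) := by
  rw [ofReal_integral_eq_lintegral_ofReal
    ((tent_cont z a b).integrable_of_hasCompactSupport (tent_compact hab))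
    (Eventually.of_forall (tent_nonneg z a b)), ← lintegral_indicator_one measurableSet_closedBall]
  refine lintegral_mono fun y => ?_
  by_cases hy : y ∈ closedBall z a
  · simp [hy, tent_eq_one hab hy]
  · simp [hy]

lemma tent_integral_le (m : Measure ℂ) [IsLocallyFiniteMeasure m] {z : ℂ} {a b : ℝ} (hab : a < b) :
    ENNReal.ofReal (∫ y, tent z a b y ∂m) ≤ m (closedBall z b) := by
  rw [ofReal_integral_eq_lintegral_ofReal
    ((tent_cont z a b).integrable_of_hasCompactSupport (tent_compact hab))
    (Eventually.of_forall (tent_nonneg z a b)), ← lintegral_indicator_one measurableSet_closedBall]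
  refine lintegral_mono fun y => ?_
  by_cases hy : y ∈ closedBall z b
  · simpa [hy] using tent_le_one z a b y
  · simp [hy, tent_eq_zero hab hy]

section ultra
variable {𝒰 : Ultrafilter ℕ} {m : ℕ → Measure ℂ} [∀ i, IsLocallyFiniteMeasure (m i)]
  {ν : Measure ℂ} [IsLocallyFiniteMeasure ν]

lemma ultra_le (hν : ∀ f : ℂ → ℝ, Continuous f → HasCompactSupport f →
      Tendsto (fun i => ∫ y, f y ∂(m i)) 𝒰 (𝓝 (∫ y, f y ∂ν))) {z : ℂ} {a b : ℝ} (hab : a < b)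
    {t : ℝ≥0∞} (h : ∀ᶠ i in (𝒰 : Filter ℕ), m i (closedBall z b) ≤ t) : ν (closedBall z a) ≤ t := by
  refine (le_tent_integral ν hab).trans ?_
  have := ENNReal.tendsto_ofReal (hν _ (tent_cont z a b) (tent_compact hab))
  refine le_of_tendsto this ?_
  filter_upwards [h] with i hi
  exact (tent_integral_le (m i) hab).trans hi

lemma ultra_ge (hν : ∀ f : ℂ → ℝ, Continuous f → HasCompactSupport f →
      Tendsto (fun i => ∫ y, f y ∂(m i)) 𝒰 (𝓝 (∫ y, f y ∂ν))) {z : ℂ} {a b : ℝ} (hab : a < b)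
    {t : ℝ≥0∞} (h : ∀ᶠ i in (𝒰 : Filter ℕ), t ≤ m i (closedBall z a)) : t ≤ ν (closedBall z b) := by
  refine le_trans ?_ (tent_integral_le ν hab)
  have := ENNReal.tendsto_ofReal (hν _ (tent_cont z a b) (tent_compact hab))
  refine ge_of_tendsto this ?_
  filter_upwards [h] with i hi
  exact hi.trans (le_tent_integral (m i) hab)

end ultra

/-- The rescaled measure. -/
def blow (μ : Measure ℂ) (x : ℂ) (r : ℝ) : Measure ℂ :=
  ENNReal.ofReal r⁻¹ • μ.map (fun y => (y - x) / (r : ℂ))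

lemma blow_closedBall (μ : Measure ℂ) (x : ℂ) {r : ℝ} (hr : 0 < r) (z : ℂ) (ρ : ℝ) :
    blow μ x r (closedBall z ρ) = ENNReal.ofReal r⁻¹ * μ (closedBall (x + r * z) (r * ρ)) := by
  rw [blow, Measure.smul_apply, Measure.map_apply (by fun_prop) measurableSet_closedBall, smul_eq_mul]
  congr 2
  ext y
  simp only [mem_preimage, mem_closedBall_iff_norm]
  have h1 : y - (x + r * z) = r * ((y - x) / r - z) := by
    have : (r : ℂ) ≠ 0 := by exact_mod_cast hr.ne'
    field_simp
    ring
  rw [h1, norm_mul, Complex.norm_real, Real.norm_of_nonneg hr.le, mul_le_mul_iff_right₀ hr]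

lemma blow_locFin (μ : Measure ℂ) [IsLocallyFiniteMeasure μ] (x : ℂ) {r : ℝ} (hr : 0 < r) :
    IsLocallyFiniteMeasure (blow μ x r) := by
  refine ⟨fun z => ⟨closedBall z 1, closedBall_mem_nhds z one_pos, ?_⟩⟩
  rw [blow_closedBall μ x hr]
  exact ENNReal.mul_lt_top ENNReal.ofReal_lt_top (isCompact_closedBall _ _).measure_lt_top

lemma blow_integral {E : Type*} [NormedAddCommGroup E] [NormedSpace ℝ E]
    (μ : Measure ℂ) (x : ℂ) {r : ℝ} (hr : 0 < r) {f : ℂ → E}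
    (hf : AEStronglyMeasurable f (μ.map (fun y => (y - x) / (r : ℂ)))) :
    ∫ y, f y ∂(blow μ x r) = r⁻¹ • ∫ y, f ((y - x) / r) ∂μ := by
  rw [blow, integral_smul_measure, integral_map (by fun_prop) hf,
    ENNReal.toReal_ofReal (by positivity)]

/-- Limit set of `E1` blown up. -/
def LimSet (𝒰 : Ultrafilter ℕ) (E1 : Set ℂ) (x : ℕ → ℂ) (r : ℕ → ℝ) : Set ℂ :=
  {z | ∀ s : ℝ, 0 < s → ∀ᶠ i in (𝒰 : Filter ℕ), ∃ y ∈ E1, ‖y - (x i + r i * z)‖ < s * r i}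

lemma LimSet_closed (𝒰 : Ultrafilter ℕ) (E1 : Set ℂ) (x : ℕ → ℂ) (r : ℕ → ℝ) (hr : ∀ i, 0 < r i) :
    IsClosed (LimSet 𝒰 E1 x r) := by
  rw [← isSeqClosed_iff_isClosed]
  intro u z hu hz s hs
  obtain ⟨n, hn⟩ := ((Metric.tendsto_nhds.1 hz) (s / 2) (by positivity)).exists
  filter_upwards [hu n (s / 2) (by positivity)] with i hi
  obtain ⟨y, hy, hy2⟩ := hi
  refine ⟨y, hy, ?_⟩
  have h1 : y - (x i + r i * z) = (y - (x i + r i * u n)) + r i * (u n - z) := by ring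
  rw [h1]
  refine (norm_add_le _ _).trans_lt ?_
  rw [norm_mul, Complex.norm_real, Real.norm_of_nonneg (hr i).le]
  rw [dist_eq_norm] at hn
  have := mul_lt_mul_of_pos_left hn (hr i)
  nlinarith

section blowup
variable {U : ℂ → ℂ} {ω : ℝ → ℝ} {c : ℝ} {μ : Measure ℂ} [IsLocallyFiniteMeasure μ]
  {E1 E2 : Set ℂ} {C r0 : ℝ} {x : ℕ → ℂ} {r : ℕ → ℝ} {𝒰 : Ultrafilter ℕ}

lemma small_event (hr0 : Tendsto r 𝒰 (𝓝 0)) (A : ℝ) {d : ℝ} (hd : 0 < d) :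
    ∀ᶠ i in (𝒰 : Filter ℕ), A * r i < d := by
  have h := hr0.const_mul A
  rw [mul_zero] at h
  exact h.eventually_lt_const hd

lemma blow_upper (hG : Good U μ E1 C r0) (hr : ∀ i, 0 < r i) (hr0 : Tendsto r 𝒰 (𝓝 0))
    {z : ℂ} (hz : z ∈ LimSet 𝒰 E1 x r) {ρ ρ' : ℝ} (hρ : 0 < ρ) (hρ' : ρ < ρ') :
    ∀ᶠ i in (𝒰 : Filter ℕ), blow μ (x i) (r i) (closedBall z ρ) ≤ ENNReal.ofReal (C * ρ') := by
  filter_upwards [hz (ρ' - ρ) (by linarith), small_event hr0 ρ' hG.r0p] with i hi hi2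
  obtain ⟨y, hy, hy2⟩ := hi
  rw [blow_closedBall μ _ (hr i)]
  have hri := hr i
  have h1 : closedBall (x i + r i * z) (r i * ρ) ⊆ closedBall y (ρ' * r i) := by
    refine closedBall_subset_closedBall' ?_
    rw [dist_comm, dist_eq_norm]
    nlinarith
  refine (mul_le_mul_right ((measure_mono h1).trans (hG.upper y hy _ (by nlinarith) hi2)) _).trans ?_
  rw [← ENNReal.ofReal_mul (by positivity)]
  refine ENNReal.ofReal_le_ofReal (le_of_eq ?_)
  field_simp

lemma blow_lower (hG : Good U μ E1 C r0) (hr : ∀ i, 0 < r i) (hr0 : Tendsto r 𝒰 (𝓝 0))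
    {z : ℂ} (hz : z ∈ LimSet 𝒰 E1 x r) {ρ ρ' : ℝ} (hρ : 0 < ρ) (hρ' : ρ < ρ') :
    ∀ᶠ i in (𝒰 : Filter ℕ), ENNReal.ofReal (ρ / C) ≤ blow μ (x i) (r i) (closedBall z ρ') := by
  filter_upwards [hz (ρ' - ρ) (by linarith), small_event hr0 ρ hG.r0p] with i hi hi2
  obtain ⟨y, hy, hy2⟩ := hi
  rw [blow_closedBall μ _ (hr i)]
  have hri := hr i
  have h1 : closedBall y (ρ * r i) ⊆ closedBall (x i + r i * z) (r i * ρ') := by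
    refine closedBall_subset_closedBall' ?_
    rw [dist_eq_norm]
    nlinarith
  refine le_trans ?_ (mul_le_mul_right ((hG.lower y hy _ (by nlinarith) hi2).trans (measure_mono h1)) _)
  rw [← ENNReal.ofReal_mul (by positivity)]
  refine ENNReal.ofReal_le_ofReal (le_of_eq ?_)
  field_simp

lemma blow_null (hE : E2 ⊆ E1) (hD : UDens μ E1 E2) (hx : ∀ i, x i ∈ E2)
    (hr : ∀ i, 0 < r i) (hr0 : Tendsto r 𝒰 (𝓝 0))
    {z : ℂ} (hz : z ∉ LimSet 𝒰 E1 x r) : ∃ s : ℝ, 0 < s ∧ ∀ η : ℝ, 0 < η →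
    ∀ᶠ i in (𝒰 : Filter ℕ), blow μ (x i) (r i) (closedBall z s) ≤ ENNReal.ofReal η := by
  simp only [LimSet, mem_ofPred_eq] at hz
  push Not at hz
  obtain ⟨s, hs, hz⟩ := hz
  have hz2 : ∀ᶠ i in (𝒰 : Filter ℕ), ∀ y ∈ E1, s * r i ≤ ‖y - (x i + r i * z)‖ :=
    hz
  refine ⟨s / 2, by positivity, fun η hη => ?_⟩
  have hA : 0 < ‖z‖ + s := by positivity
  obtain ⟨r1, hr1, hd⟩ := hD (η / (‖z‖ + s)) (by positivity)
  filter_upwards [hz2, small_event hr0 (‖z‖ + s) hr1] with i hi hi2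
  rw [blow_closedBall μ _ (hr i)]
  have hri := hr i
  have h1 : closedBall (x i + r i * z) (r i * (s / 2)) ⊆ closedBall (x i) ((‖z‖ + s) * r i) \ E1 := by
    intro y hy
    rw [mem_closedBall_iff_norm] at hy
    refine ⟨?_, fun hyE => ?_⟩
    swap
    · have := hi y hyE
      nlinarith
    rw [mem_closedBall_iff_norm]
    have h2 : y - x i = (y - (x i + r i * z)) + r i * z := by ring
    rw [h2]
    refine (norm_add_le _ _).trans ?_
    rw [norm_mul, Complex.norm_real, Real.norm_of_nonneg hri.le]
    nlinarith
  refine (mul_le_mul_right ((measure_mono h1).trans (hd _ (hx i) _ (by positivity) hi2)) _).trans ?_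
  rw [← ENNReal.ofReal_mul (by positivity)]
  refine ENNReal.ofReal_le_ofReal (le_of_eq ?_)
  field_simp

end blowup


lemma TF.exists_K {ψ : ℝ → ℝ} {a b : ℝ} (hψ : TF ψ a b) (L : ℝ) : ∃ K : ℕ, 1 ≤ K ∧ L ≤ K ∧
    TF ψ (K : ℝ)⁻¹ K ∧ (∀ ρ, |ψ ρ| ≤ K) ∧ (∀ ρ, |deriv ψ ρ| ≤ K) := by
  have hc : HasCompactSupport ψ := HasCompactSupport.intro isCompact_Icc hψ.zero
  obtain ⟨M1, hM1⟩ := hψ.cd.continuous.bounded_above_of_compact_support hc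
  obtain ⟨M2, hM2⟩ := (hψ.cd.continuous_deriv le_rfl).bounded_above_of_compact_support hc.deriv
  obtain ⟨K, hK⟩ := exists_nat_ge (max 1 (max L (max a⁻¹ (max b (max M1 M2)))))
  simp only [max_le_iff] at hK
  obtain ⟨k1, k2, k3, k4, k5, k6⟩ := hK
  have k0 : (0 : ℝ) < K := by linarith
  refine ⟨K, by exact_mod_cast k1, k2, ⟨hψ.cd, by positivity, fun ρ hρ => hψ.zero ρ fun h => hρ ?_⟩,
    fun ρ => (hM1 ρ).trans k5, fun ρ => (hM2 ρ).trans k6⟩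
  exact ⟨(inv_le_of_inv_le₀ hψ.apos k3).trans h.1, h.2.trans k4⟩

section blowup
variable {U : ℂ → ℂ} {ω : ℝ → ℝ} {c : ℝ} {μ : Measure ℂ} [IsLocallyFiniteMeasure μ]
  {E1 E2 : Set ℂ} {C r0 : ℝ} {x : ℕ → ℂ} {r : ℕ → ℝ} {𝒰 : Ultrafilter ℕ}

lemma blow_sym (h : UOK U ω) (hω : LiftOK ω c) (hG : Good U μ E1 C r0) (hr : ∀ i, 0 < r i)
    (hr0 : Tendsto r 𝒰 (𝓝 0)) {z : ℂ} (hz : z ∈ LimSet 𝒰 E1 x r) {ψ : ℝ → ℝ} {a b : ℝ}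
    (hψ : TF ψ a b) :
    Tendsto (fun i => ∫ y, GK U ψ (z - y) ∂(blow μ (x i) (r i))) 𝒰 (𝓝 0) := by
  have hGc := (GK_contDiff h hω hψ).continuous
  have huc := (GK_compact (U := U) hψ).uniformContinuous_of_continuous hGc
  rw [Metric.tendsto_nhds]
  intro ε hε
  obtain ⟨K, hK1, hKε, hTF, hb1, hb2⟩ := hψ.exists_K (2 / ε)
  have hK0 : (0 : ℝ) < K := by exact_mod_cast hK1
  obtain ⟨r1, hr1, hpv⟩ := hG.pv K hK1
  have hC := hG.C1
  set B : ℝ := K + 1 with hB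
  have hB0 : 0 < B := by positivity
  obtain ⟨s, hs, hus⟩ := Metric.uniformContinuous_iff.1 huc (ε / (4 * C * B)) (by positivity)
  filter_upwards [hz (min s 1) (by positivity), small_event hr0 1 hr1,
    small_event hr0 B hG.r0p] with i hi hi1 hi2
  obtain ⟨y0, hy0, hy1⟩ := hi
  have hri := hr i
  have hrc : (r i : ℂ) ≠ 0 := by exact_mod_cast hri.ne'
  rw [one_mul] at hi1
  have hp := hpv y0 hy0 (r i) hri hi1 ψ hTF hb1 hb2
  rw [blow_integral μ (x i) hri (by fun_prop), dist_zero_right, norm_smul, norm_inv,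
    Real.norm_of_nonneg hri.le]
  set w : ℂ := (y0 - (x i + r i * z)) / r i with hw
  have hwn : ‖w‖ < min s 1 := by
    rw [hw, norm_div, Complex.norm_real, Real.norm_of_nonneg hri.le, div_lt_iff₀ hri]
    exact hy1
  have e1 : ∀ y, z - (y - x i) / r i = (y0 - y) / r i - w := by
    intro y; rw [hw]; field_simp; ring
  have hd : ∀ y, ‖GK U ψ ((y0 - y) / r i - w) - GK U ψ ((y0 - y) / r i)‖ ≤ ε / (4 * C * B) := by
    intro y
    rw [← dist_eq_norm]
    refine (hus ?_).le
    rw [dist_eq_norm]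
    simpa using hwn.trans_le (min_le_left _ _)
  have hz0 : ∀ y, y ∉ closedBall y0 (B * r i) →
      GK U ψ ((y0 - y) / r i - w) - GK U ψ ((y0 - y) / r i) = 0 := by
    intro y hy
    rw [mem_closedBall_iff_norm, not_le, norm_sub_rev] at hy
    have h1 : B < ‖(y0 - y) / r i‖ := by
      rw [norm_div, Complex.norm_real, Real.norm_of_nonneg hri.le, lt_div_iff₀ hri]
      exact hy
    have h2 := hwn.trans_le (min_le_right _ _)
    have h3 := norm_sub_norm_le ((y0 - y) / r i) w
    rw [GK_zero hTF, GK_zero hTF, sub_zero]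
    · rw [mem_closedBall_zero_iff]; linarith
    · rw [mem_closedBall_zero_iff]; linarith
  have hsupp : ∀ v : ℂ, HasCompactSupport (fun y => GK U ψ ((y0 - y) / r i - v)) := by
    intro v
    refine HasCompactSupport.intro (isCompact_closedBall y0 ((K + ‖v‖) * r i)) fun y hy => ?_
    rw [mem_closedBall_iff_norm, not_le, norm_sub_rev] at hy
    have h1 : K + ‖v‖ < ‖(y0 - y) / r i‖ := by
      rw [norm_div, Complex.norm_real, Real.norm_of_nonneg hri.le, lt_div_iff₀ hri]
      exact hy
    have h3 := norm_sub_norm_le ((y0 - y) / r i) v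
    refine GK_zero hTF _ ?_
    rw [mem_closedBall_zero_iff]; linarith
  have hI : ∀ v : ℂ, Integrable (fun y => GK U ψ ((y0 - y) / r i - v)) μ := fun v =>
    Continuous.integrable_of_hasCompactSupport (by fun_prop) (hsupp v)
  have hI0 : Integrable (fun y => GK U ψ ((y0 - y) / r i)) μ := by simpa using hI 0
  have hdiff : ‖(∫ y, GK U ψ ((y0 - y) / r i - w) ∂μ) - ∫ y, GK U ψ ((y0 - y) / r i) ∂μ‖
      ≤ ε / 4 * r i := by
    rw [← integral_sub (hI w) hI0, ← setIntegral_eq_integral_of_forall_compl_eq_zero hz0]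
    have hfin : μ (closedBall y0 (B * r i)) < ⊤ := (isCompact_closedBall _ _).measure_lt_top
    refine (norm_setIntegral_le_of_norm_le_const hfin (fun y _ => hd y)).trans ?_
    have h5 : μ.real (closedBall y0 (B * r i)) ≤ C * (B * r i) := by
      have := ENNReal.toReal_mono ENNReal.ofReal_ne_top (hG.upper y0 hy0 (B * r i) (by positivity) hi2)
      rwa [ENNReal.toReal_ofReal (by positivity)] at this
    refine (mul_le_mul_of_nonneg_left h5 (by positivity)).trans (le_of_eq ?_)
    field_simp
  have htot : ‖∫ y, GK U ψ (z - (y - x i) / r i) ∂μ‖ ≤ r i / K + ε / 4 * r i := by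
    simp_rw [e1]
    have := norm_sub_norm_le (∫ y, GK U ψ ((y0 - y) / r i - w) ∂μ) (∫ y, GK U ψ ((y0 - y) / r i) ∂μ)
    linarith
  have hKK : r i / K ≤ ε / 2 * r i := by
    rw [div_le_iff₀ hK0]
    rw [div_le_iff₀ hε] at hKε
    nlinarith
  rw [inv_mul_lt_iff₀ hri]
  nlinarith

lemma blowup_line (h : UOK U ω) (hω : LiftOK ω c) (hG : Good U μ E1 C r0) (hE : E2 ⊆ E1)
    (hD : UDens μ E1 E2) (hx : ∀ i, x i ∈ E2) (hr : ∀ i, 0 < r i) (hr0 : Tendsto r 𝒰 (𝓝 0)) :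
    ∃ e : ℂ, ‖e‖ = 1 ∧ (∀ t : ℝ, (t : ℂ) * e ∈ LimSet 𝒰 E1 x r) ∧
      ∀ y ∈ LimSet 𝒰 E1 x r, cim e y = 0 := by
  have hC := hG.C1
  have h0 : (0 : ℂ) ∈ LimSet 𝒰 E1 x r := by
    intro s hs
    refine Eventually.of_forall fun i => ⟨x i, hE (hx i), ?_⟩
    simpa using mul_pos hs (hr i)
  haveI : ∀ i, IsLocallyFiniteMeasure (blow μ (x i) (r i)) := fun i => blow_locFin μ _ (hr i)
  obtain ⟨ν, hνf, hν⟩ := exists_ultra_limit 𝒰 (fun i => blow μ (x i) (r i)) (by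
    intro R
    have h1 := blow_upper hG hr hr0 h0 (ρ := |R| + 1) (ρ' := |R| + 2) (by positivity) (by linarith)
    refine ⟨_, h1.mono fun i hi => le_trans (measure_mono ?_) hi⟩
    exact closedBall_subset_closedBall ((le_abs_self R).trans (by linarith)))
  have hS : SymM U ν (LimSet 𝒰 E1 x r) (4 * C) := by
    refine ⟨LimSet_closed 𝒰 E1 x r hr, ?_, by positivity, ?_, ?_, ?_⟩
    · refine measure_null_of_locally_null _ fun z hz => ?_
      obtain ⟨s, hs, hnull⟩ := blow_null hE hD hx hr hr0 hz
      refine ⟨closedBall z (s / 2), mem_nhdsWithin_of_mem_nhds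
        (closedBall_mem_nhds z (by positivity)), ?_⟩
      refine le_antisymm (ENNReal.le_of_forall_pos_le_add fun η hη _ => ?_) zero_le
      have := ultra_le hν (a := s / 2) (by linarith) (hnull η (by exact_mod_cast hη))
      simpa using this
    · intro z hz ρ hρ
      have := ultra_ge hν (a := ρ / 2) (b := ρ) (by linarith)
        (blow_lower hG hr hr0 hz (ρ := ρ / 4) (ρ' := ρ / 2) (by linarith) (by linarith))
      refine le_trans (ENNReal.ofReal_le_ofReal (le_of_eq ?_)) this
      field_simp
    · intro z hz ρ hρ
      have := ultra_le hν (a := ρ) (b := 2 * ρ) (by linarith)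
        (blow_upper hG hr hr0 hz (ρ := 2 * ρ) (ρ' := 4 * ρ) (by linarith) (by linarith))
      refine le_trans this (ENNReal.ofReal_le_ofReal (le_of_eq ?_))
      ring
    · intro z hz ψ a b hψ
      have hGc : Continuous fun y => GK U ψ (z - y) := 
        (GK_contDiff h hω hψ).continuous.comp (by fun_prop)
      have hcs := hasCompactSupport_sub (GK_compact (U := U) hψ) z
      have hlim := blow_sym h hω hG hr hr0 hz hψ
      have hI : ∀ (m : Measure ℂ) [IsLocallyFiniteMeasure m], 
          Integrable (fun y => GK U ψ (z - y)) m := fun m _ =>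
        hGc.integrable_of_hasCompactSupport hcs
      apply Complex.ext
      · rw [Complex.zero_re]
        have h1 := hν (fun y => (GK U ψ (z - y)).re) (Complex.continuous_re.comp hGc)
          (hcs.comp_left (g := Complex.re) Complex.zero_re)
        have h2 := (Complex.continuous_re.tendsto _).comp hlim
        rw [Complex.zero_re] at h2
        have e1 := tendsto_nhds_unique h1 (h2.congr fun i => (integral_re (hI _)).symm)
        rw [← e1]; exact (integral_re (hI ν)).symm
      · rw [Complex.zero_im]
        have h1 := hν (fun y => (GK U ψ (z - y)).im) (Complex.continuous_im.comp hGc)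
          (hcs.comp_left (g := Complex.im) Complex.zero_im)
        have h2 := (Complex.continuous_im.tendsto _).comp hlim
        rw [Complex.zero_im] at h2
        have e1 := tendsto_nhds_unique h1 (h2.congr fun i => (integral_im (hI _)).symm)
        rw [← e1]; exact (integral_im (hI ν)).symm
  exact hS.is_line h hω h0

end blowup


/-- Uniform two-sided flatness at small scales. -/
lemma flat_small {U : ℂ → ℂ} {ω : ℝ → ℝ} {c : ℝ} {μ : Measure ℂ} [IsLocallyFiniteMeasure μ]
    {E1 E2 : Set ℂ} {C r0 : ℝ} (h : UOK U ω) (hω : LiftOK ω c) (hG : Good U μ E1 C r0)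
    (hE : E2 ⊆ E1) (hD : UDens μ E1 E2) (ε : ℝ) (hε : 0 < ε) :
    ∃ ρ0 : ℝ, 0 < ρ0 ∧ ∀ x ∈ E2, ∀ r : ℝ, 0 < r → r < ρ0 → ∃ e : ℂ, ‖e‖ = 1 ∧
      (∀ y ∈ E1, ‖y - x‖ ≤ r → |cim e (y - x)| ≤ ε * r) ∧
      (∀ t : ℝ, |t| ≤ r → ∃ y ∈ E1, ‖y - (x + t * e)‖ ≤ ε * r) := by
  by_contra hcon
  push Not at hcon
  have hc2 : ∀ n : ℕ, ∃ x ∈ E2, ∃ r : ℝ, 0 < r ∧ r < 1 / ((n : ℝ) + 1) ∧ ∀ e : ℂ, ‖e‖ = 1 →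
      ¬ ((∀ y ∈ E1, ‖y - x‖ ≤ r → |cim e (y - x)| ≤ ε * r) ∧
      (∀ t : ℝ, |t| ≤ r → ∃ y ∈ E1, ‖y - (x + t * e)‖ ≤ ε * r)) := by
    intro n
    obtain ⟨x, hx, r, hr, hr2, hh⟩ := hcon (1 / ((n : ℝ) + 1)) (by positivity)
    refine ⟨x, hx, r, hr, hr2, fun e he hand => ?_⟩
    obtain ⟨t, ht, hno⟩ := hh e he hand.1
    obtain ⟨y, hy, hy2⟩ := hand.2 t ht
    exact absurd (hno y hy) (not_lt.2 hy2)
  choose x hx r hr hrn hbad using hc2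
  let 𝒰 : Ultrafilter ℕ := hyperfilter ℕ
  have hr0 : Tendsto r 𝒰 (𝓝 0) := by
    have : Tendsto r atTop (𝓝 0) :=
      squeeze_zero (fun n => (hr n).le) (fun n => (hrn n).le) tendsto_one_div_add_atTop_nhds_zero_nat
    exact this.mono_left (by rw [← Nat.cofinite_eq_atTop]; exact hyperfilter_le_cofinite)
  obtain ⟨e, he, hline, hflat⟩ := blowup_line h hω hG hE hD hx hr hr0
  have hev : ∀ᶠ i in (𝒰 : Filter ℕ), 
      (¬ ∀ y ∈ E1, ‖y - x i‖ ≤ r i → |cim e (y - x i)| ≤ ε * r i) ∨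
      (¬ ∀ t : ℝ, |t| ≤ r i → ∃ y ∈ E1, ‖y - (x i + t * e)‖ ≤ ε * r i) :=
    Eventually.of_forall fun i => not_and_or.1 (hbad i e he)
  rw [Ultrafilter.eventually_or] at hev
  rcases hev with hev | hev
  · have h1 : ∀ i, ∃ y, (¬ ∀ y ∈ E1, ‖y - x i‖ ≤ r i → |cim e (y - x i)| ≤ ε * r i) →
        y ∈ E1 ∧ ‖y - x i‖ ≤ r i ∧ ε * r i < |cim e (y - x i)| := by
      intro i
      by_cases hh : ∀ y ∈ E1, ‖y - x i‖ ≤ r i → |cim e (y - x i)| ≤ ε * r i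
      · exact ⟨0, fun h => absurd hh h⟩
      · push Not at hh
        obtain ⟨y, hy, hy2, hy3⟩ := hh
        exact ⟨y, fun _ => ⟨hy, hy2, hy3⟩⟩
    choose y hy using h1
    have hev2 : ∀ᶠ i in (𝒰 : Filter ℕ), (y i - x i) / r i ∈ closedBall (0 : ℂ) 1 := by
      filter_upwards [hev] with i hi
      have hri := hr i
      rw [mem_closedBall_zero_iff, norm_div, Complex.norm_real, Real.norm_of_nonneg hri.le,
        div_le_one hri]
      exact (hy i hi).2.1
    obtain ⟨z, -, hz⟩ := (isCompact_closedBall (0 : ℂ) 1).ultrafilter_le_nhds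
      (𝒰.map fun i => (y i - x i) / r i) (by rw [le_principal_iff]; exact hev2)
    have hz' : Tendsto (fun i => (y i - x i) / (r i : ℂ)) 𝒰 (𝓝 z) := hz
    have hzX : z ∈ LimSet 𝒰 E1 x r := by
      intro s hs
      filter_upwards [hev, (Metric.tendsto_nhds.1 hz') s hs] with i hi hi2
      refine ⟨y i, (hy i hi).1, ?_⟩
      have hri := hr i
      have hrc : (r i : ℂ) ≠ 0 := by exact_mod_cast hri.ne'
      have e1 : y i - (x i + r i * z) = r i * ((y i - x i) / r i - z) := by
        field_simp; ring
      rw [e1, norm_mul, Complex.norm_real, Real.norm_of_nonneg hri.le, ← dist_eq_norm, mul_comm]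
      exact mul_lt_mul_of_pos_right hi2 hri
    have hcz := hflat z hzX
    have hlim : Tendsto (fun i => |cim e ((y i - x i) / (r i : ℂ))|) 𝒰 (𝓝 |cim e z|) :=
      (((continuous_cim e).abs).tendsto z).comp hz'
    have : ε ≤ |cim e z| := by
      refine ge_of_tendsto hlim ?_
      filter_upwards [hev] with i hi
      have hri := hr i
      have e1 : (y i - x i) / (r i : ℂ) = ((r i)⁻¹ : ℝ) * (y i - x i) := by
        push_cast; rw [div_eq_inv_mul]
      rw [e1, cim_real_mul, abs_mul, abs_of_pos (inv_pos.2 hri), le_inv_mul_iff₀ hri, mul_comm]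
      exact (hy i hi).2.2.le
    rw [hcz, abs_zero] at this
    linarith
  · have h1 : ∀ i, ∃ t : ℝ, (¬ ∀ t : ℝ, |t| ≤ r i → ∃ y ∈ E1, ‖y - (x i + t * e)‖ ≤ ε * r i) →
        |t| ≤ r i ∧ ∀ y ∈ E1, ε * r i < ‖y - (x i + t * e)‖ := by
      intro i
      by_cases hh : ∀ t : ℝ, |t| ≤ r i → ∃ y ∈ E1, ‖y - (x i + t * e)‖ ≤ ε * r i
      · exact ⟨0, fun h => absurd hh h⟩
      · push Not at hh
        obtain ⟨t, ht, ht2⟩ := hh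
        exact ⟨t, fun _ => ⟨ht, ht2⟩⟩
    choose t ht using h1
    have hev2 : ∀ᶠ i in (𝒰 : Filter ℕ), t i / r i ∈ Icc (-1 : ℝ) 1 := by
      filter_upwards [hev] with i hi
      have hri := hr i
      rw [mem_Icc, ← abs_le, abs_div, abs_of_pos hri, div_le_one hri]
      exact (ht i hi).1
    obtain ⟨z, -, hz⟩ := (isCompact_Icc (a := (-1 : ℝ)) (b := 1)).ultrafilter_le_nhds
      (𝒰.map fun i => t i / r i) (by rw [le_principal_iff]; exact hev2)
    have hz' : Tendsto (fun i => t i / r i) 𝒰 (𝓝 z) := hz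
    obtain ⟨i, hi, hi2, y, hyE, hy2⟩ := (hev.and (((Metric.tendsto_nhds.1 hz') (ε / 2) (by positivity)).and
      (hline z (ε / 2) (by positivity)))).exists
    have hri := hr i
    have hlt := (ht i hi).2 y hyE
    have e1 : y - (x i + t i * e) = (y - (x i + r i * (z * e))) - ((t i - r i * z : ℝ) : ℂ) * e := by
      push_cast; ring
    have h4 : ‖y - (x i + t i * e)‖ ≤ ‖y - (x i + r i * (z * e))‖ + |t i - r i * z| := by
      rw [e1]
      refine (norm_sub_le _ _).trans ?_
      rw [norm_mul, he, mul_one, Complex.norm_real, Real.norm_eq_abs]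
    have h5 : |t i - r i * z| ≤ ε / 2 * r i := by
      have e2 : t i - r i * z = r i * (t i / r i - z) := by field_simp
      rw [e2, abs_mul, abs_of_pos hri, mul_comm]
      rw [Real.dist_eq] at hi2
      exact mul_le_mul_of_nonneg_right hi2.le hri.le
    linarith


/-- A Vitali covering estimate for a set of projections. -/
lemma vitali_proj (T : Set ℝ) (x : ℝ → ℂ) (ρ : ℝ → ℝ) (p : ℂ → ℝ) (m : Measure ℂ) (B : Set ℂ)
    (R q A M : ℝ) (hq : 0 < q) (hA : 0 < A) (hM : 0 ≤ M) (hρ : ∀ t ∈ T, 0 < ρ t)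
    (hρR : ∀ t ∈ T, ρ t ≤ R)
    (hm : ∀ t ∈ T, ENNReal.ofReal (A * ρ t) ≤ m (closedBall (x t) (ρ t)))
    (hB : ∀ t ∈ T, closedBall (x t) (ρ t) ⊆ B) (hBM : m B ≤ ENNReal.ofReal M)
    (hp : ∀ t ∈ T, ∀ t' ∈ T, ‖x t - x t'‖ ≤ 5 * ρ t' → |p (x t) - p (x t')| ≤ 5 * q * ρ t')
    (ht : ∀ t ∈ T, |t - p (x t)| ≤ q * ρ t) :
    volume T ≤ ENNReal.ofReal (30 * q * M / A) := by
  obtain ⟨u, huT, hdisj, hcov⟩ := Vitali.exists_disjoint_subfamily_covering_enlargement_closedBall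
    T x ρ R hρR 5 (by norm_num)
  have hcount : u.Countable := by
    refine hdisj.countable_of_nonempty_interior fun t htu => ?_
    exact ⟨x t, mem_interior.2 ⟨ball (x t) (ρ t), ball_subset_closedBall, isOpen_ball,
      mem_ball_self (hρ t (huT htu))⟩⟩
  have hsub : T ⊆ ⋃ b ∈ u, Icc (p (x b) - 15 * q * ρ b) (p (x b) + 15 * q * ρ b) := by
    intro t htT
    obtain ⟨b, hb, hsub⟩ := hcov t htT
    have hbT := huT hb
    have h0 := hρ t htT
    have h1 : ‖x t - x b‖ ≤ 5 * ρ b := by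
      have := hsub (mem_closedBall_self h0.le)
      rwa [mem_closedBall_iff_norm] at this
    have h2 : ‖x t + ρ t - x b‖ ≤ 5 * ρ b := by
      have : x t + ρ t ∈ closedBall (x t) (ρ t) := by
        rw [mem_closedBall_iff_norm]; simp [abs_of_pos h0]
      have := hsub this
      rwa [mem_closedBall_iff_norm] at this
    have h3 : ρ t ≤ 10 * ρ b := by
      have e1 : (ρ t : ℂ) = (x t + ρ t - x b) - (x t - x b) := by ring
      have : ‖(ρ t : ℂ)‖ ≤ 5 * ρ b + 5 * ρ b := by
        rw [e1]; exact (norm_sub_le _ _).trans (add_le_add h2 h1)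
      rw [Complex.norm_real, Real.norm_of_nonneg h0.le] at this
      linarith
    have h4 := abs_le.1 (hp t htT b hbT h1)
    have h5 := abs_le.1 (ht t htT)
    have h6 : q * ρ t ≤ 10 * q * ρ b := by nlinarith
    refine mem_biUnion hb ⟨?_, ?_⟩
    · linarith [h4.1, h5.1]
    · linarith [h4.2, h5.2]
  haveI : Countable u := hcount.to_subtype
  have hsum : ∑' b : u, ENNReal.ofReal (A * ρ b) ≤ ENNReal.ofReal M := by
    calc ∑' b : u, ENNReal.ofReal (A * ρ b) ≤ ∑' b : u, m (closedBall (x b) (ρ b)) :=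
          ENNReal.tsum_le_tsum fun b => hm b (huT b.2)
      _ = m (⋃ b ∈ u, closedBall (x b) (ρ b)) :=
          (measure_biUnion hcount hdisj fun _ _ => measurableSet_closedBall).symm
      _ ≤ m B := measure_mono (iUnion₂_subset fun b hb => hB b (huT hb))
      _ ≤ _ := hBM
  calc volume T ≤ volume (⋃ b ∈ u, Icc (p (x b) - 15 * q * ρ b) (p (x b) + 15 * q * ρ b)) :=
        measure_mono hsub
    _ ≤ ∑' b : u, volume (Icc (p (x b) - 15 * q * ρ b) (p (x b) + 15 * q * ρ b)) :=
        measure_biUnion_le _ hcount _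
    _ = ∑' b : u, ENNReal.ofReal (30 * q / A) * ENNReal.ofReal (A * ρ b) := by
        congr 1; ext b
        rw [Real.volume_Icc, ← ENNReal.ofReal_mul (by positivity)]
        congr 1
        field_simp
        ring
    _ = ENNReal.ofReal (30 * q / A) * ∑' b : u, ENNReal.ofReal (A * ρ b) := ENNReal.tsum_mul_left
    _ ≤ ENNReal.ofReal (30 * q / A) * ENNReal.ofReal M := mul_le_mul_right hsum _
    _ = _ := by
        rw [← ENNReal.ofReal_mul (by positivity)]
        congr 1
        ring

lemma cre_sub (e a b : ℂ) : cre e (a - b) = cre e a - cre e b := by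
  simp [cre]; ring

lemma cre_add (e a b : ℂ) : cre e (a + b) = cre e a + cre e b := by
  simp [cre]; ring

lemma cre_real_mul (e w : ℂ) (t : ℝ) : cre e (t * w) = t * cre e w := by
  simp [cre]; ring

/-- Points satisfying a cone condition form a null set when Lipschitz curves are null. -/
lemma cone_null (μ : Measure ℂ) (S E : Set ℂ) (hES : E ⊆ S)
    (hno : ∀ γ : ℝ → ℂ, (∃ C : ℝ≥0, LipschitzWith C γ) → μ (S ∩ range γ) = 0)
    (s : ℝ) (hs : 0 < s) (v : ℂ) (d : ℝ) (hd : 0 < d) :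
    μ {x ∈ E | ∀ y ∈ E, ‖y - x‖ < d → s * ‖y - x‖ ≤ |cre v (y - x)|} = 0 := by
  set A : Set ℂ := {x ∈ E | ∀ y ∈ E, ‖y - x‖ < d → s * ‖y - x‖ ≤ |cre v (y - x)|} with hA
  have hpiece : ∀ z : ℂ, μ (A ∩ ball z (d / 2)) = 0 := by
    intro z
    set P := A ∩ ball z (d / 2) with hP
    have hin : ∀ x ∈ P, ∀ y ∈ P, s * ‖y - x‖ ≤ |cre v y - cre v x| := by
      intro x hx y hy
      rw [← cre_sub]
      refine hx.1.2 y hy.1.1 ?_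
      have h1 := hx.2
      have h2 := hy.2
      rw [mem_ball] at h1 h2
      rw [← dist_eq_norm]
      have := dist_triangle_right y x z
      linarith
    have hinj : InjOn (cre v) P := by
      intro x hx y hy hxy
      have := hin x hx y hy
      rw [hxy, sub_self, abs_zero] at this
      have h0 : ‖y - x‖ ≤ 0 := by
        by_contra hc
        push Not at hc
        have := mul_pos hs hc
        linarith
      have := norm_le_zero_iff.1 h0
      exact (sub_eq_zero.1 this).symm
    have hlip : LipschitzOnWith (Real.toNNReal s⁻¹) (Function.invFunOn (cre v) P) (cre v '' P) := by
      refine LipschitzOnWith.of_dist_le_mul ?_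
      rintro _ ⟨a, ha, rfl⟩ _ ⟨b, hb, rfl⟩
      rw [hinj.leftInvOn_invFunOn ha, hinj.leftInvOn_invFunOn hb, dist_eq_norm, Real.dist_eq,
        Real.coe_toNNReal _ (by positivity), le_inv_mul_iff₀ hs]
      exact hin b hb a ha
    obtain ⟨γ, hγ, heq⟩ := hlip.extend_finite_dimension
    refine measure_mono_null ?_ (hno γ ⟨_, hγ⟩)
    intro x hx
    refine ⟨hES hx.1.1, cre v x, ?_⟩
    rw [← heq (mem_image_of_mem _ hx)]
    exact hinj.leftInvOn_invFunOn hx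
  refine measure_mono_null (t := ⋃ n, A ∩ ball (TopologicalSpace.denseSeq ℂ n) (d / 2)) ?_
    (measure_iUnion_null fun n => hpiece _)
  intro x hx
  obtain ⟨n, hn⟩ := (TopologicalSpace.denseRange_denseSeq ℂ).exists_dist_lt x (half_pos hd)
  exact mem_iUnion.2 ⟨n, hx, hn⟩


lemma cre_self (e : ℂ) (he : ‖e‖ = 1) : cre e e = 1 := by
  have := Complex.sq_norm e
  rw [he, Complex.normSq_apply] at this
  rw [cre]; linarith

/-- In a ball where `E` is flat in direction `e`, projections onto `e0` are small if `e0` is almost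
orthogonal to `e`. -/
lemma proj_small {e e0 w : ℂ} {ρ σ ε : ℝ} (he : ‖e‖ = 1) (he0 : ‖e0‖ = 1) (hw : ‖w‖ ≤ ρ)
    (hσ : |cre e0 e| ≤ σ) (hc : |cim e w| ≤ ε * ρ) : |cre e0 w| ≤ (σ + ε) * ρ := by
  have h1 : cre e0 w = cre e w * cre e0 e + cim e w * cre e0 (I * e) := by
    conv_lhs => rw [decomp_cre_cim e w he]
    rw [cre_add, cre_real_mul, cre_real_mul]
  have h2 : |cre e0 (I * e)| ≤ 1 := (abs_cre_le e0 _ he0).trans (by simp [he])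
  have h3 := abs_cre_le e w he
  have h4 := abs_nonneg (cre e0 e)
  have h5 := abs_nonneg (cim e w)
  have h6 := abs_nonneg (cre e w)
  have h7 := norm_nonneg w
  rw [h1]
  refine (abs_add_le _ _).trans ?_
  rw [abs_mul, abs_mul]
  have a1 : |cre e w| * |cre e0 e| ≤ ρ * σ := by
    apply mul_le_mul (h3.trans hw) hσ h4 (h7.trans hw)
  have a2 : |cim e w| * |cre e0 (I * e)| ≤ ε * ρ * 1 :=
    mul_le_mul hc h2 (abs_nonneg _) (h5.trans hc)
  linarith

lemma core_point {μ : Measure ℂ} {E1 E2 E3 : Set ℂ} {C r0 ρ0 s ε R : ℝ} {x0 e0 : ℂ}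
    (hC : 1 ≤ C)
    (hlo : ∀ x ∈ E1, ∀ r, 0 < r → r < r0 → ENNReal.ofReal (r / C) ≤ μ (closedBall x r))
    (hE3 : IsCompact E3) (h23 : E3 ⊆ E2) (h12 : E2 ⊆ E1)
    (hs : 0 < s) (hs1 : 600 * s ≤ 1) (hε : 240 * ε = s)
    (hflat : ∀ x ∈ E2, ∀ r : ℝ, 0 < r → r < ρ0 → ∃ e : ℂ, ‖e‖ = 1 ∧
      (∀ y ∈ E1, ‖y - x‖ ≤ r → |cim e (y - x)| ≤ ε * r) ∧
      (∀ t : ℝ, |t| ≤ r → ∃ y ∈ E1, ‖y - (x + t * e)‖ ≤ ε * r))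
    (hcone : ∀ x ∈ E3, ∀ e : ℂ, ∀ ρ : ℝ, 0 < ρ → ∃ y ∈ E2, y ≠ x ∧ ‖y - x‖ < ρ ∧
      |cre e (y - x)| ≤ 2 * s * ‖y - x‖)
    (hR : 0 < R) (hRr : 4 * R < r0) (hRρ : 4 * R < ρ0) (he0 : ‖e0‖ = 1)
    (hdens : μ (closedBall x0 (4 * R) \ E3) ≤ ENNReal.ofReal (ε / (480 * C) * (4 * R)))
    (hF1 : ∀ y ∈ E1, ‖y - x0‖ ≤ 2 * R → |cim e0 (y - x0)| ≤ ε * (2 * R))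
    (hF2 : ∀ t : ℝ, |t| ≤ 2 * R → ∃ y ∈ E1, ‖y - (x0 + t * e0)‖ ≤ ε * (2 * R))
    (t : ℝ) (ht : |t| ≤ R / 2) :
    ∃ (x : ℂ) (ρ : ℝ), x ∈ E3 ∧ ‖x - x0‖ ≤ 3 * R / 4 ∧ 0 < ρ ∧ ρ ≤ R / 20 ∧
      ((|t - cre e0 (x - x0)| ≤ s * ρ ∧ ∀ y ∈ E1, ‖y - x‖ ≤ ρ → |cre e0 (y - x)| ≤ 5 * s * ρ) ∨
       (|t - cre e0 (x - x0)| ≤ ρ ∧ ENNReal.ofReal (ε / C * ρ) ≤ μ (closedBall x ρ \ E3))) := by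
  have hε0 : 0 < ε := by linarith
  have hεR : ε * R ≤ R / 1000 := by nlinarith
  have hεR0 : 0 < ε * R := by positivity
  -- a first point of `E3` near `x0 + t e0`
  obtain ⟨y, hy, hyt⟩ := hF2 t (by linarith)
  have hcret : ∀ z : ℂ, ‖z - (x0 + t * e0)‖ ≤ 3 * (ε * R) → |cre e0 (z - x0) - t| ≤ 3 * (ε * R) := by
    intro z hz
    have h1 : cre e0 (z - x0) - t = cre e0 (z - (x0 + t * e0)) := by
      have : z - x0 = (z - (x0 + t * e0)) + t * e0 := by ring
      rw [this, cre_add, cre_real_mul, cre_self e0 he0]; ring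
    rw [h1]
    exact (abs_cre_le e0 _ he0).trans hz
  have hx1 : ∃ x1 ∈ E3, ‖x1 - y‖ ≤ ε * R := by
    by_contra hcon
    push Not at hcon
    have hsub : closedBall y (ε * R) ⊆ closedBall x0 (4 * R) \ E3 := by
      intro z hz
      rw [mem_closedBall_iff_norm] at hz
      refine ⟨?_, fun hz3 => absurd hz (not_le.2 (hcon z hz3))⟩
      rw [mem_closedBall_iff_norm]
      have e1 : z - x0 = (z - y) + (y - (x0 + t * e0)) + t * e0 := by ring
      rw [e1]
      have h1 := norm_add₃_le (a := z - y) (b := y - (x0 + t * e0)) (c := t * e0)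
      have h2 : ‖(t : ℂ) * e0‖ = |t| := by
        rw [norm_mul, he0, Complex.norm_real, Real.norm_eq_abs, mul_one]
      linarith
    have h1 := (hlo y hy (ε * R) hεR0 (by linarith)).trans ((measure_mono hsub).trans hdens)
    rw [ENNReal.ofReal_le_ofReal_iff (by positivity)] at h1
    have h2 : ε / (480 * C) * (4 * R) = (ε * R / C) / 120 := by field_simp; ring
    have h3 : 0 < ε * R / C := by positivity
    linarith
  obtain ⟨x1, hx1, hx1y⟩ := hx1
  have hx1t : ‖x1 - (x0 + t * e0)‖ ≤ 3 * (ε * R) := by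
    have e1 : x1 - (x0 + t * e0) = (x1 - y) + (y - (x0 + t * e0)) := by ring
    rw [e1]
    refine (norm_add_le _ _).trans ?_
    linarith
  have hx1n : ‖x1 - x0‖ ≤ R := by
    have e1 : x1 - x0 = (x1 - (x0 + t * e0)) + t * e0 := by ring
    rw [e1]
    refine (norm_add_le _ _).trans ?_
    rw [norm_mul, he0, Complex.norm_real, Real.norm_eq_abs, mul_one]
    linarith
  -- the minimizer
  have hcpt : IsCompact (E3 ∩ closedBall x0 R) := hE3.inter_right isClosed_closedBall
  have hcont : Continuous fun z : ℂ => |cre e0 (z - x0) - t| := by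
    unfold cre; fun_prop
  obtain ⟨x, ⟨hx3, hxR⟩, hmin⟩ := hcpt.exists_isMinOn
    ⟨x1, hx1, mem_closedBall_iff_norm.2 hx1n⟩ hcont.continuousOn
  rw [mem_closedBall_iff_norm] at hxR
  have hmin' : ∀ z ∈ E3, ‖z - x0‖ ≤ R → |cre e0 (x - x0) - t| ≤ |cre e0 (z - x0) - t| :=
    fun z hz hzR => hmin ⟨hz, mem_closedBall_iff_norm.2 hzR⟩
  set r := |cre e0 (x - x0) - t| with hr
  have hr3 : r ≤ 3 * (ε * R) := (hmin' x1 hx1 hx1n).trans (hcret x1 hx1t)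
  have hx2 := h23 hx3
  have hxx0 : ‖x - x0‖ ≤ 3 * R / 4 := by
    have h1 := norm_le_cre_cim e0 (x - x0) he0
    have h2 := hF1 x (h12 hx2) (by linarith)
    have h3 : |cre e0 (x - x0)| ≤ |t| + r := by
      have : cre e0 (x - x0) = t + (cre e0 (x - x0) - t) := by ring
      rw [this]
      exact abs_add_le _ _
    linarith
  have hts : |t - cre e0 (x - x0)| = r := abs_sub_comm _ _
  rcases (abs_nonneg (cre e0 (x - x0) - t)).eq_or_lt with hr0' | hrpos
  · -- `r = 0`
    rw [← hr] at hr0'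
    obtain ⟨y, hyE, hyx, hyR, hyc⟩ := hcone x hx3 e0 (R / 20) (by positivity)
    set ρ := ‖y - x‖ with hρ
    have hρ0 : 0 < ρ := norm_pos_iff.2 (sub_ne_zero.2 hyx)
    obtain ⟨e, he, hf1, -⟩ := hflat x hx2 ρ hρ0 (by linarith)
    refine ⟨x, ρ, hx3, hxx0, hρ0, hyR.le, Or.inl ⟨by rw [hts, ← hr0']; positivity, ?_⟩⟩
    have h1 := hf1 y (h12 hyE) le_rfl
    have h2 := norm_le_cre_cim e (y - x) he
    have h3 : |cre e0 e| ≤ 4 * s := by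
      have h4 : cre e0 (y - x) = cre e (y - x) * cre e0 e + cim e (y - x) * cre e0 (I * e) := by
        conv_lhs => rw [decomp_cre_cim e (y - x) he]
        rw [cre_add, cre_real_mul, cre_real_mul]
      have h5 : |cre e0 (I * e)| ≤ 1 := (abs_cre_le e0 _ he0).trans (by simp [he])
      have h6 : |cre e (y - x) * cre e0 e| ≤ 2 * s * ρ + ε * ρ := by
        have e1 : cre e (y - x) * cre e0 e = cre e0 (y - x) - cim e (y - x) * cre e0 (I * e) := by
          rw [h4]; ring
        rw [e1]
        refine (abs_sub _ _).trans (add_le_add hyc ?_)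
        rw [abs_mul]
        have := mul_le_mul h1 h5 (abs_nonneg _) (by positivity)
        linarith
      rw [abs_mul] at h6
      have h7 : ρ * (9 / 10) ≤ |cre e (y - x)| := by nlinarith
      have h8 : ρ * (9 / 10) * |cre e0 e| ≤ 2 * s * ρ + ε * ρ :=
        (mul_le_mul_of_nonneg_right h7 (abs_nonneg _)).trans h6
      have h9 : (9 / 10) * |cre e0 e| ≤ 2 * s + ε := by
        by_contra hc
        push Not at hc
        have := mul_lt_mul_of_pos_left hc hρ0
        nlinarith
      linarith
    intro y' hy' hy'n
    refine (proj_small he he0 hy'n h3 (hf1 y' hy' hy'n)).trans ?_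
    refine mul_le_mul_of_nonneg_right ?_ hρ0.le
    linarith
  · -- `r > 0`
    rw [← hr] at hrpos
    set ρ := 2 * r / s with hρ
    have hρs : s * ρ = 2 * r := by rw [hρ]; field_simp
    have hρ0 : 0 < ρ := by positivity
    have hρR : ρ ≤ R / 20 := by
      rw [hρ, div_le_iff₀ hs]
      nlinarith
    obtain ⟨e, he, hf1, hf2⟩ := hflat x hx2 ρ hρ0 (by linarith)
    refine ⟨x, ρ, hx3, hxx0, hρ0, hρR, ?_⟩
    by_cases hc : |cre e0 e| ≤ s
    · left
      refine ⟨by rw [hts, hρs]; linarith, fun y' hy' hy'n => ?_⟩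
      refine (proj_small he he0 hy'n hc (hf1 y' hy' hy'n)).trans ?_
      refine mul_le_mul_of_nonneg_right ?_ hρ0.le
      linarith
    · right
      push Not at hc
      refine ⟨by rw [hts]; nlinarith, ?_⟩
      have hne : cre e0 e ≠ 0 := by
        intro h0; rw [h0, abs_zero] at hc; linarith
      set t' := (t - cre e0 (x - x0)) / cre e0 e with ht'
      have ht'n : |t'| ≤ ρ / 2 := by
        rw [ht', abs_div, hts, div_le_iff₀ (by linarith)]
        nlinarith
      obtain ⟨y, hy, hyt⟩ := hf2 t' (by linarith)
      have hερ : ε * ρ ≤ ρ / 1000 := by nlinarith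
      have hερ0 : 0 < ε * ρ := by positivity
      have ht'e : ‖(t' : ℂ) * e‖ = |t'| := by
        rw [norm_mul, he, Complex.norm_real, Real.norm_eq_abs, mul_one]
      have hsub : closedBall y (ε * ρ) ⊆ closedBall x ρ \ E3 := by
        intro z hz
        rw [mem_closedBall_iff_norm] at hz
        have hzt : ‖z - (x + t' * e)‖ ≤ 2 * (ε * ρ) := by
          have e1 : z - (x + t' * e) = (z - y) + (y - (x + t' * e)) := by ring
          rw [e1]
          refine (norm_add_le _ _).trans ?_
          linarith
        have hzx : ‖z - x‖ ≤ ρ := by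
          have e1 : z - x = (z - (x + t' * e)) + t' * e := by ring
          rw [e1]
          refine (norm_add_le _ _).trans ?_
          linarith
        refine ⟨mem_closedBall_iff_norm.2 hzx, fun hz3 => ?_⟩
        have hzx0 : ‖z - x0‖ ≤ R := by
          have e1 : z - x0 = (z - x) + (x - x0) := by ring
          rw [e1]
          refine (norm_add_le _ _).trans ?_
          linarith
        have h1 := hmin' z hz3 hzx0
        have h2 : cre e0 (z - x0) - t = cre e0 (z - (x + t' * e)) := by
          have e1 : z - x0 = (z - (x + t' * e)) + t' * e + (x - x0) := by ring
          rw [e1, cre_add, cre_add, cre_real_mul, ht', div_mul_cancel₀ _ hne]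
          ring
        have h3 := abs_cre_le e0 (z - (x + t' * e)) he0
        rw [h2] at h1
        have h4 : 240 * (ε * ρ) = 2 * r := by rw [← mul_assoc, hε, hρs]
        linarith
      refine le_trans ?_ ((hlo y hy (ε * ρ) hερ0 (by linarith)).trans (measure_mono hsub))
      refine ENNReal.ofReal_le_ofReal (le_of_eq ?_)
      ring

lemma core_false {μ : Measure ℂ} {E1 E2 E3 : Set ℂ} {C r0 ρ0 r1 s ε : ℝ} {x0 : ℂ}
    (hC : 1 ≤ C) (hr0 : 0 < r0) (hρ0 : 0 < ρ0) (hr1 : 0 < r1)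
    (hlo : ∀ x ∈ E1, ∀ r, 0 < r → r < r0 → ENNReal.ofReal (r / C) ≤ μ (closedBall x r))
    (hup : ∀ x ∈ E1, ∀ r, 0 < r → r < r0 → μ (closedBall x r) ≤ ENNReal.ofReal (C * r))
    (hE3 : IsCompact E3) (h23 : E3 ⊆ E2) (h12 : E2 ⊆ E1)
    (hs : 600 * C ^ 2 * s = 1) (hε : 240 * ε = s)
    (hflat : ∀ x ∈ E2, ∀ r : ℝ, 0 < r → r < ρ0 → ∃ e : ℂ, ‖e‖ = 1 ∧
      (∀ y ∈ E1, ‖y - x‖ ≤ r → |cim e (y - x)| ≤ ε * r) ∧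
      (∀ t : ℝ, |t| ≤ r → ∃ y ∈ E1, ‖y - (x + t * e)‖ ≤ ε * r))
    (hcone : ∀ x ∈ E3, ∀ e : ℂ, ∀ ρ : ℝ, 0 < ρ → ∃ y ∈ E2, y ≠ x ∧ ‖y - x‖ < ρ ∧
      |cre e (y - x)| ≤ 2 * s * ‖y - x‖)
    (hx0 : x0 ∈ E3)
    (hdens : ∀ r, 0 < r → r < r1 →
      μ (closedBall x0 r \ E3) ≤ ENNReal.ofReal (ε / (480 * C) * r)) : False := by
  have hs0 : 0 < s := by
    by_contra hc
    push Not at hc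
    nlinarith [sq_nonneg C]
  have hs1 : 600 * s ≤ 1 := by
    have h1 : 1 ≤ C ^ 2 := one_le_pow₀ hC
    have h2 : 1 * s ≤ C ^ 2 * s := mul_le_mul_of_nonneg_right h1 hs0.le
    linarith
  have hε0 : 0 < ε := by linarith
  obtain ⟨R, hR, hRm⟩ : ∃ R : ℝ, 0 < R ∧ 4 * R < min r0 (min ρ0 r1) :=
    ⟨min r0 (min ρ0 r1) / 8, by positivity, by
      have : 0 < min r0 (min ρ0 r1) := by positivity
      linarith⟩
  simp only [lt_min_iff] at hRm
  obtain ⟨hRr0, hRρ0, hRr1⟩ := hRm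
  obtain ⟨e0, he0, hF1, hF2⟩ := hflat x0 (h23 hx0) (2 * R) (by positivity) (by linarith)
  have hd := hdens (4 * R) (by positivity) hRr1
  have key := fun t => core_point hC hlo hE3 h23 h12 hs0 hs1 hε hflat hcone hR hRr0 hRρ0 he0 hd
    hF1 hF2 t
  have key2 : ∀ t : ℝ, ∃ x ρ, |t| ≤ R / 2 → x ∈ E3 ∧ ‖x - x0‖ ≤ 3 * R / 4 ∧ 0 < ρ ∧ ρ ≤ R / 20 ∧
      ((|t - cre e0 (x - x0)| ≤ s * ρ ∧ ∀ y ∈ E1, ‖y - x‖ ≤ ρ → |cre e0 (y - x)| ≤ 5 * s * ρ) ∨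
       (|t - cre e0 (x - x0)| ≤ ρ ∧ ENNReal.ofReal (ε / C * ρ) ≤ μ (closedBall x ρ \ E3))) := by
    intro t
    by_cases ht : |t| ≤ R / 2
    · obtain ⟨x, ρ, h⟩ := key t ht
      exact ⟨x, ρ, fun _ => h⟩
    · exact ⟨0, 0, fun h => absurd h ht⟩
  choose x ρ hxρ using key2
  set Ta : Set ℝ := {t | |t| ≤ R / 2 ∧ |t - cre e0 (x t - x0)| ≤ s * ρ t ∧
    ∀ y ∈ E1, ‖y - x t‖ ≤ ρ t → |cre e0 (y - x t)| ≤ 5 * s * ρ t} with hTa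
  set Tb : Set ℝ := {t | |t| ≤ R / 2 ∧ |t - cre e0 (x t - x0)| ≤ ρ t ∧
    ENNReal.ofReal (ε / C * ρ t) ≤ μ (closedBall (x t) (ρ t) \ E3)} with hTb
  have hcov : Icc (-(R / 2)) (R / 2) ⊆ Ta ∪ Tb := by
    intro t ht
    have ht' := abs_le.2 ht
    rcases (hxρ t ht').2.2.2.2 with h | h
    · exact Or.inl ⟨ht', h⟩
    · exact Or.inr ⟨ht', h⟩
  have hballs : ∀ t, |t| ≤ R / 2 → closedBall (x t) (ρ t) ⊆ closedBall x0 R := by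
    intro t ht
    obtain ⟨h1, h2, h3, h4, -⟩ := hxρ t ht
    refine closedBall_subset_closedBall' ?_
    rw [dist_eq_norm]
    linarith
  have hpdiff : ∀ a b : ℂ, cre e0 (a - x0) - cre e0 (b - x0) = cre e0 (a - b) := by
    intro a b; rw [← cre_sub]; congr 1; ring
  have hx01 := h12 (h23 hx0)
  have hva : volume Ta ≤ ENNReal.ofReal (30 * (5 * s) * (C * R) / (1 / C)) := by
    refine vitali_proj Ta x (fun t => ρ t / 5) (fun y => cre e0 (y - x0)) μ (closedBall x0 R)
      (R / 20) (5 * s) (1 / C) (C * R) (by positivity) (by positivity) (by positivity)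
      ?_ ?_ ?_ ?_ ?_ ?_ ?_
    · intro t ht
      have := (hxρ t ht.1).2.2.1
      positivity
    · intro t ht
      obtain ⟨h1, h2, h3, h4, -⟩ := hxρ t ht.1
      linarith
    · intro t ht
      obtain ⟨h1, h2, h3, h4, -⟩ := hxρ t ht.1
      refine le_trans (ENNReal.ofReal_le_ofReal (le_of_eq ?_))
        (hlo (x t) (h12 (h23 h1)) (ρ t / 5) (by positivity) (by linarith))
      ring
    · intro t ht
      obtain ⟨h1, h2, h3, h4, -⟩ := hxρ t ht.1
      exact (closedBall_subset_closedBall (by linarith)).trans (hballs t ht.1)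
    · exact hup x0 hx01 R hR (by linarith)
    · intro t ht t' ht' hn
      obtain ⟨h1, -⟩ := hxρ t ht.1
      rw [hpdiff]
      refine (ht'.2.2 (x t) (h12 (h23 h1)) (by linarith)).trans (le_of_eq ?_)
      ring
    · intro t ht
      refine ht.2.1.trans (le_of_eq ?_)
      ring
  have hvb : volume Tb ≤ ENNReal.ofReal (30 * 1 * (ε / (480 * C) * (4 * R)) / (ε / C)) := by
    refine vitali_proj Tb x ρ (fun y => cre e0 (y - x0)) (μ.restrict E3ᶜ) (closedBall x0 R)
      (R / 20) 1 (ε / C) (ε / (480 * C) * (4 * R)) (by positivity) (by positivity) (by positivity)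
      ?_ ?_ ?_ ?_ ?_ ?_ ?_
    · intro t ht
      exact (hxρ t ht.1).2.2.1
    · intro t ht
      exact (hxρ t ht.1).2.2.2.1
    · intro t ht
      rw [Measure.restrict_apply measurableSet_closedBall, ← Set.sdiff_eq]
      exact ht.2.2
    · intro t ht
      exact hballs t ht.1
    · rw [Measure.restrict_apply measurableSet_closedBall, ← Set.sdiff_eq]
      exact (measure_mono (sdiff_subset_sdiff_left (closedBall_subset_closedBall (by linarith)))).trans hd
    · intro t ht t' ht' hn
      rw [hpdiff]
      refine (abs_cre_le e0 _ he0).trans (hn.trans (le_of_eq ?_))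
      ring
    · intro t ht
      rw [one_mul]
      exact ht.2.1
  have hsa : 30 * (5 * s) * (C * R) / (1 / C) = R / 4 := by
    field_simp
    nlinarith
  have hsb : 30 * 1 * (ε / (480 * C) * (4 * R)) / (ε / C) = R / 4 := by
    field_simp
    norm_num
  have hfin : volume (Icc (-(R / 2)) (R / 2)) ≤ ENNReal.ofReal (R / 4) + ENNReal.ofReal (R / 4) :=
    (measure_mono hcov).trans ((measure_union_le _ _).trans
      (add_le_add (hsa ▸ hva) (hsb ▸ hvb)))
  rw [Real.volume_Icc, ← ENNReal.ofReal_add (by positivity) (by positivity),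
    ENNReal.ofReal_le_ofReal_iff (by positivity)] at hfin
  linarith


lemma abs_cre_le_mul (a w : ℂ) : |cre a w| ≤ ‖a‖ * ‖w‖ := by
  have h1 : cre a w = (starRingEnd ℂ a * w).re := by simp [cre]
  rw [h1]
  refine (Complex.abs_re_le_norm _).trans ?_
  rw [norm_mul, Complex.norm_conj]

lemma rect_pos {U : ℂ → ℂ} {ω : ℝ → ℝ} {c : ℝ} (h : UOK U ω) (hω : LiftOK ω c)
    (μ : Measure ℂ) [IsLocallyFiniteMeasure μ]
    (hdens : ∀ᵐ x ∂μ,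
      0 < Filter.liminf (fun r : ℝ => μ (ball x r) / ENNReal.ofReal r) (𝓝[>] (0 : ℝ)) ∧
      Filter.limsup (fun r : ℝ => μ (ball x r) / ENNReal.ofReal r) (𝓝[>] (0 : ℝ)) < ⊤)
    (hpv : ∀ᵐ x ∂μ, ∀ K : ℝ, 1 ≤ K → ∃ r1 : ℝ, 0 < r1 ∧ ∀ r : ℝ, 0 < r → r < r1 → ∀ ψ : ℝ → ℝ,
      TF ψ K⁻¹ K → (∀ ρ, |ψ ρ| ≤ K) → (∀ ρ, |deriv ψ ρ| ≤ K) →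
      ‖∫ y, GK U ψ ((x - y) / r) ∂μ‖ ≤ r / K)
    (S : Set ℂ) (hS : MeasurableSet S) (hpos : 0 < μ S) :
    ∃ γ : ℝ → ℂ, (∃ C : ℝ≥0, LipschitzWith C γ) ∧ 0 < μ (S ∩ range γ) := by
  by_contra hcon
  push Not at hcon
  have hno : ∀ γ : ℝ → ℂ, (∃ C : ℝ≥0, LipschitzWith C γ) → μ (S ∩ range γ) = 0 := by
    intro γ hL
    exact le_antisymm (hcon γ hL) zero_le
  obtain ⟨E1, hE1S, C, r0, hE1pos, hG⟩ := exists_good h hω μ hdens hpv S hS hpos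
  have hC := hG.C1
  have hC0 : 0 < C := by linarith
  obtain ⟨E2, h12, hE2c, hE2pos, hD⟩ := exists_udens μ E1 E1 hG.cpt hG.cpt.measurableSet
    subset_rfl hE1pos C r0 hG.r0p hC0 hG.upper
  set s : ℝ := 1 / (600 * C ^ 2) with hs
  have hs0 : 0 < s := by positivity
  have hsC : 600 * C ^ 2 * s = 1 := by rw [hs]; field_simp
  set ε : ℝ := s / 240 with hε
  have hε0 : 0 < ε := by positivity
  obtain ⟨ρ0, hρ0, hflat⟩ := flat_small h hω hG h12 hD ε hε0
  set A : ℕ → ℕ → Set ℂ := fun k n => {x ∈ E2 | ∀ y ∈ E2, ‖y - x‖ < 1 / ((n : ℝ) + 1) →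
    s * ‖y - x‖ ≤ |cre (TopologicalSpace.denseSeq ℂ k) (y - x)|} with hA
  have hnull : μ (⋃ k, ⋃ n, A k n) = 0 := by
    refine measure_iUnion_null fun k => measure_iUnion_null fun n => ?_
    exact cone_null μ S E2 (h12.trans hE1S) hno s hs0 _ _ (by positivity)
  set N := toMeasurable μ (⋃ k, ⋃ n, A k n) with hN
  have hNn : μ N = 0 := by rw [hN, measure_toMeasurable, hnull]
  have hpos3 : 0 < μ (E2 \ N) := by
    rw [measure_sdiff_null hNn]; exact hE2pos
  obtain ⟨E3, hE3, hE3c, hE3pos⟩ := exists_compact_pos μ (E2 \ N)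
    (hE2c.measurableSet.diff (measurableSet_toMeasurable _ _)) hpos3
  have h23 : E3 ⊆ E2 := hE3.trans sdiff_subset
  obtain ⟨E4, h34, hE4c, hE4pos, hD3⟩ := exists_udens μ E3 E3 hE3c hE3c.measurableSet
    subset_rfl hE3pos C r0 hG.r0p hC0 (fun x hx => hG.upper x (h12 (h23 hx)))
  obtain ⟨x0, hx0⟩ : E4.Nonempty := nonempty_of_measure_ne_zero hE4pos.ne'
  obtain ⟨r1, hr1, hd⟩ := hD3 (ε / (480 * C)) (by positivity)
  refine core_false hC hG.r0p hρ0 hr1 hG.lower hG.upper hE3c h23 h12 hsC (by rw [hε]; ring) hflat ?_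
    (h34 hx0) (fun r hr hrr => hd x0 hx0 r hr hrr)
  intro x hx e ρ hρ
  obtain ⟨k, hk⟩ := (TopologicalSpace.denseRange_denseSeq ℂ).exists_dist_lt e hs0
  obtain ⟨n, hn⟩ := exists_nat_one_div_lt hρ
  have hxA : x ∉ A k n := fun hxA => (hE3 hx).2
    (subset_toMeasurable μ _ (mem_iUnion.2 ⟨k, mem_iUnion.2 ⟨n, hxA⟩⟩))
  simp only [hA, mem_ofPred_eq] at hxA
  push Not at hxA
  obtain ⟨y, hy, hyn, hyc⟩ := hxA (h23 hx)
  refine ⟨y, hy, ?_, hyn.trans hn, ?_⟩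
  · rintro rfl
    simp [cre] at hyc
  · have h1 : cre e (y - x) = cre (TopologicalSpace.denseSeq ℂ k) (y - x)
        + cre (e - TopologicalSpace.denseSeq ℂ k) (y - x) := by
      simp [cre]; ring
    rw [h1]
    refine (abs_add_le _ _).trans ?_
    have h2 := abs_cre_le_mul (e - TopologicalSpace.denseSeq ℂ k) (y - x)
    rw [dist_eq_norm] at hk
    have h3 := mul_le_mul_of_nonneg_right hk.le (norm_nonneg (y - x))
    linarith

lemma rect_exhaust (μ : Measure ℂ) [IsLocallyFiniteMeasure μ]
    (hpos : ∀ S : Set ℂ, MeasurableSet S → 0 < μ S →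
      ∃ γ : ℝ → ℂ, (∃ C : ℝ≥0, LipschitzWith C γ) ∧ 0 < μ (S ∩ range γ)) :
    ∃ γ : ℕ → ℝ → ℂ, (∀ i, ∃ C : ℝ≥0, LipschitzWith C (γ i)) ∧
      μ (Set.univ \ ⋃ i, Set.range (γ i)) = 0 := by
  set m := μ.toFinite with hm
  let 𝒢 : Type := {γ : ℕ → ℝ → ℂ // ∀ i, ∃ C : ℝ≥0, LipschitzWith C (γ i)}
  let f : 𝒢 → ℝ≥0∞ := fun γ => m (⋃ i, range (γ.1 i))
  have hne : (range f).Nonempty :=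
    ⟨_, ⟨fun _ _ => 0, fun _ => ⟨0, LipschitzWith.const 0⟩⟩, rfl⟩
  obtain ⟨u, -, hu, hmem⟩ := exists_seq_tendsto_sSup hne (OrderTop.bddAbove _)
  choose Γ hΓ using hmem
  let G : 𝒢 := ⟨fun n => (Γ n.unpair.1).1 n.unpair.2, fun n => (Γ n.unpair.1).2 n.unpair.2⟩
  have hmeas : ∀ γ : ℝ → ℂ, (∃ C : ℝ≥0, LipschitzWith C γ) → MeasurableSet (range γ) := by
    rintro γ ⟨C, hγ⟩
    obtain ⟨K, hK, hKu⟩ := isSigmaCompact_range hγ.continuous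
    rw [← hKu]
    exact MeasurableSet.iUnion fun n => (hK n).measurableSet
  have hGsub : ∀ n, ⋃ i, range ((Γ n).1 i) ⊆ ⋃ i, range (G.1 i) := by
    intro n
    refine iUnion_subset fun i => ?_
    refine subset_trans ?_ (subset_iUnion _ (Nat.pair n i))
    simp [G]
  have hGmax : sSup (range f) ≤ f G := by
    refine le_of_tendsto' hu fun n => ?_
    rw [← hΓ n]
    exact measure_mono (hGsub n)
  refine ⟨G.1, G.2, ?_⟩
  by_contra hne0
  set Z : Set ℂ := ⋃ i, range (G.1 i) with hZ
  have hZm : MeasurableSet Z := MeasurableSet.iUnion fun i => hmeas _ (G.2 i)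
  obtain ⟨γ, hγ, hγp⟩ := hpos (Set.univ \ Z) (MeasurableSet.univ.diff hZm) (pos_iff_ne_zero.2 hne0)
  have hγm : m ((Set.univ \ Z) ∩ range γ) ≠ 0 := fun h0 =>
    hγp.ne' (absolutelyContinuous_toFinite μ h0)
  let G' : 𝒢 := ⟨fun n => Nat.casesOn n γ G.1, fun n => by
    cases n with
    | zero => exact hγ
    | succ k => exact G.2 k⟩
  have h1 : m Z + m ((Set.univ \ Z) ∩ range γ) ≤ f G' := by
    rw [← measure_union _ ((MeasurableSet.univ.diff hZm).inter (hmeas γ hγ))]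
    · refine measure_mono (union_subset ?_ ?_)
      · refine iUnion_subset fun i => ?_
        exact subset_iUnion (fun n => range (G'.1 n)) (i + 1)
      · exact inter_subset_right.trans (subset_iUnion (fun n => range (G'.1 n)) 0)
    · exact disjoint_sdiff_right.mono_right inter_subset_left
  have h2 : f G' ≤ m Z := (le_sSup (mem_range_self G')).trans hGmax
  have h3 : m Z < m Z + m ((Set.univ \ Z) ∩ range γ) :=
    ENNReal.lt_add_right (measure_ne_top _ _) hγm
  exact absurd (h1.trans h2) (not_le.2 h3)

/-- If μ is a Radon measure on ℂ with positive lower density and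
finite upper density a.e., and the principal value of the Ω-singular integral exists
a.e., then μ is 1-rectifiable. -/
theorem stmt_1 (δ : ℝ) (hδ0 : 0 ≤ δ) (hδ1 : δ ≤ 1 / 20)
    (Ω : ℂ → ℂ) (hmap : MapsCircle Ω) (hodd : OddOnCircle Ω)
    (hbilip : BiLipOnCircle Ω δ) (hC2 : CircleCk Ω 2)
    (μ : Measure ℂ) [IsLocallyFiniteMeasure μ]
    (hdens : ∀ᵐ x ∂μ,
      0 < Filter.liminf (fun r : ℝ => μ (ball x r) / ENNReal.ofReal r) (𝓝[>] (0 : ℝ)) ∧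
      Filter.limsup (fun r : ℝ => μ (ball x r) / ENNReal.ofReal r) (𝓝[>] (0 : ℝ)) < ⊤)
    (hpv : ∀ᵐ x ∂μ,
      (∀ ε : ℝ, 0 < ε →
        IntegrableOn (fun y => Kmap Ω (x - y) / ((‖x - y‖ : ℂ)) ^ 2) (ball x ε)ᶜ μ) ∧
      ∃ z : ℂ, Tendsto
        (fun ε : ℝ => ∫ y in (ball x ε)ᶜ, Kmap Ω (x - y) / ((‖x - y‖ : ℂ)) ^ 2 ∂μ)
        (𝓝[>] (0 : ℝ)) (𝓝 z)) :
    ∃ γ : ℕ → ℝ → ℂ, (∀ i : ℕ, ∃ C : ℝ≥0, LipschitzWith C (γ i)) ∧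
      μ (Set.univ \ ⋃ i : ℕ, Set.range (γ i)) = 0 := by
  obtain ⟨ω, c, hω, hU⟩ := exists_liftOK δ hδ0 hδ1 Ω hodd hbilip hC2
  have hpv1 : ∀ᵐ x ∂μ, ∀ K : ℝ, 1 ≤ K → ∃ r1 : ℝ, 0 < r1 ∧ ∀ r : ℝ, 0 < r → r < r1 →
      ∀ ψ : ℝ → ℝ, TF ψ K⁻¹ K → (∀ ρ, |ψ ρ| ≤ K) → (∀ ρ, |deriv ψ ρ| ≤ K) →
      ‖∫ y, GK (fun w => Ω (w / (‖w‖ : ℂ))) ψ ((x - y) / r) ∂μ‖ ≤ r / K := by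
    filter_upwards [hpv] with x hx K hK
    obtain ⟨hint, z, hlim⟩ := hx
    exact pv_smooth Ω μ x z hint hlim K hK
  refine rect_exhaust μ fun S hS hpos => ?_
  rcases hU with hU | hU
  · exact rect_pos hU hω μ hdens hpv1 S hS hpos
  · refine rect_pos hU hω μ hdens ?_ S hS hpos
    filter_upwards [hpv1] with x hx K hK
    obtain ⟨r1, hr1, hh⟩ := hx K hK
    refine ⟨r1, hr1, fun r hr hrr ψ h1 h2 h3 => ?_⟩
    have hconj : ∀ w : ℂ, GK (fun y => starRingEnd ℂ (Ω (y / (‖y‖ : ℂ)))) ψ w =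
        starRingEnd ℂ (GK (fun y => Ω (y / (‖y‖ : ℂ))) ψ w) := by
      intro w
      simp [GK]
    simp_rw [hconj]
    rw [integral_conj, Complex.norm_conj]
    exact hh r hr hrr ψ h1 h2 h3
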